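/- Let 0 < l < 2π and λ₊, λ₋ ≥ 0 with λ₊ ≠ λ₋. There exists ε = ε(l, λ₊, λ₋) > 0 such that for every minimizer u of J(C_1, λ₊, λ₋) on the cone of length l with ∫_{C_1} |Du|² ≤ 1, either u > 0 everywhere on C_ε, or u < 0 everywhere on C_ε, or u ≡ 0 on C_ε. -/

import Mathlib

open MeasureTheory Set

noncomputable section

/-- The cone distance on the cone of length `l`, in polar coordinates:
`d((r,θ),(s,φ)) = sqrt(r² + s² − 2 r s cos(min(δ, π)))` with
`δ = min_{k ∈ ℤ} |θ − φ + k l|`. -/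
def coneDist (l : ℝ) (p q : ℝ × ℝ) : ℝ :=
  Real.sqrt (p.1 ^ 2 + q.1 ^ 2 -
    2 * p.1 * q.1 * Real.cos (min (⨅ k : ℤ, |p.2 - q.2 + (k : ℝ) * l|) Real.pi))

/-- A Lipschitz function on the cone ball `C_R` of the cone of length `l`, given in
polar coordinates: `l`-periodic in `θ` and Lipschitz for the cone distance (this forces
a well-defined vertex value `u 0 _` and continuity at the vertex). -/
structure ConeLip (l R : ℝ) (u : ℝ → ℝ → ℝ) : Prop where
  periodic : ∀ r θ : ℝ, u r (θ + l) = u r θ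
  lipschitz : ∃ K : ℝ, ∀ p q : ℝ × ℝ, p.1 ∈ Set.Icc 0 R → q.1 ∈ Set.Icc 0 R →
    |u p.1 p.2 - u q.1 q.2| ≤ K * coneDist l p q

/-- The squared cone gradient `|Du|² = (∂_r u)² + (∂_θ u)²/r²` at a polar point,
computed from Lean's a.e.-defined derivatives. -/
def gradSq (u : ℝ → ℝ → ℝ) (p : ℝ × ℝ) : ℝ :=
  (deriv (fun s => u s p.2) p.1) ^ 2 + (deriv (fun φ => u p.1 φ) p.2) ^ 2 / p.1 ^ 2

/-- The two-phase functional
`J(u, C_R) = ∫_{C_R} |Du|² + λ₊ area({u > 0} ∩ C_R) + λ₋ area({u < 0} ∩ C_R)`,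
computed in polar coordinates with area measure `r dr dθ`, `θ` ranging over `(0, l)`. -/
def Jfun (l lp lm : ℝ) (u : ℝ → ℝ → ℝ) (R : ℝ) : ℝ :=
  ∫ p in Set.Ioo (0:ℝ) R ×ˢ Set.Ioo (0:ℝ) l,
    (gradSq u p + (if 0 < u p.1 p.2 then lp else 0)
      + (if u p.1 p.2 < 0 then lm else 0)) * p.1

/-- The Dirichlet energy `∫_{C_R} |Du|²` with respect to the area measure `r dr dθ`. -/
def Dir (l : ℝ) (u : ℝ → ℝ → ℝ) (R : ℝ) : ℝ :=
  ∫ p in Set.Ioo (0:ℝ) R ×ˢ Set.Ioo (0:ℝ) l, gradSq u p * p.1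

/-- `u` is a minimizer of `J(C_R, λ₊, λ₋)` on the cone of length `l`: a cone Lipschitz
function beating every cone Lipschitz competitor with the same boundary values on
`{r = R}`. -/
def IsMinimizerJ (l lp lm R : ℝ) (u : ℝ → ℝ → ℝ) : Prop :=
  ConeLip l R u ∧ ∀ w : ℝ → ℝ → ℝ, ConeLip l R w → (∀ θ : ℝ, w R θ = u R θ) →
    Jfun l lp lm u R ≤ Jfun l lp lm w R


set_option linter.unusedVariables false

/-! ### Lipschitz classes in polar coordinates -/

/-- Polar Lipschitz condition on the unit cone ball. -/
structure RL (l : ℝ) (w : ℝ → ℝ → ℝ) : Prop where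
  per : ∀ r θ : ℝ, w r (θ + l) = w r θ
  lip : ∃ K : ℝ, 0 ≤ K ∧
    (∀ θ : ℝ, ∀ s ∈ Icc (0:ℝ) 1, ∀ s' ∈ Icc (0:ℝ) 1, |w s θ - w s' θ| ≤ K * |s - s'|) ∧
    (∀ s ∈ Icc (0:ℝ) 1, ∀ θ θ' : ℝ, |w s θ - w s θ'| ≤ K * s * |θ - θ'|)

/-- Global polar Lipschitz condition. -/
structure GLp (l : ℝ) (w : ℝ → ℝ → ℝ) : Prop where
  per : ∀ r θ : ℝ, w r (θ + l) = w r θ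
  lip : ∃ K : ℝ, 0 ≤ K ∧
    (∀ θ s s' : ℝ, |w s θ - w s' θ| ≤ K * |s - s'|) ∧
    (∀ s θ θ' : ℝ, |w s θ - w s θ'| ≤ K * |s| * |θ - θ'|)

theorem GLp.toRL {l : ℝ} {w : ℝ → ℝ → ℝ} (h : GLp l w) : RL l w := by
  obtain ⟨K, hK, h1, h2⟩ := h.lip
  refine ⟨h.per, K, hK, fun θ s _ s' _ => h1 θ s s', fun s hs θ θ' => ?_⟩
  have := h2 s θ θ'
  rwa [abs_of_nonneg hs.1] at this

def del (l x : ℝ) : ℝ := ⨅ k : ℤ, |x + (k : ℝ) * l|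

theorem del_bdd (l x : ℝ) : BddBelow (range fun k : ℤ => |x + (k : ℝ) * l|) :=
  ⟨0, by rintro _ ⟨k, rfl⟩; exact abs_nonneg _⟩

theorem del_le (l x : ℝ) (k : ℤ) : del l x ≤ |x + (k : ℝ) * l| := ciInf_le (del_bdd l x) k

theorem del_nonneg (l x : ℝ) : 0 ≤ del l x := Real.iInf_nonneg fun _ => abs_nonneg _

theorem del_le_abs (l x : ℝ) : del l x ≤ |x| := by simpa using del_le l x 0

theorem del_le_half {l : ℝ} (hl0 : 0 < l) (x : ℝ) : del l x ≤ l / 2 := by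
  refine (del_le l x (-round (x / l))).trans ?_
  have h := abs_sub_round (x / l)
  have : x + ((-round (x / l) : ℤ) : ℝ) * l = (x / l - round (x / l)) * l := by
    push_cast; field_simp; ring
  rw [this, abs_mul, abs_of_pos hl0]
  nlinarith

theorem coneDist_eq (l : ℝ) (p q : ℝ × ℝ) : coneDist l p q =
    Real.sqrt ((p.1 - q.1) ^ 2 + 2 * p.1 * q.1 * (1 - Real.cos (min (del l (p.2 - q.2)) Real.pi))) := by
  unfold coneDist del
  congr 1; ring

theorem coneDist_rad (l s s' θ : ℝ) : coneDist l (s, θ) (s', θ) = |s - s'| := by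
  rw [coneDist_eq]
  have : del l 0 = 0 := le_antisymm (by simpa using del_le_abs l 0) (del_nonneg _ _)
  simp [this, min_eq_left Real.pi_pos.le, Real.sqrt_sq_eq_abs]

theorem coneDist_tan (l s θ θ' : ℝ) (hs : 0 ≤ s) :
    coneDist l (s, θ) (s, θ') ≤ s * |θ - θ'| := by
  rw [coneDist_eq]
  apply Real.sqrt_le_iff.2 ⟨by positivity, ?_⟩
  simp only [sub_self]
  set m := min (del l (θ - θ')) Real.pi
  have hm0 : 0 ≤ m := le_min (del_nonneg _ _) Real.pi_pos.le
  have hm1 : m ≤ |θ - θ'| := (min_le_left _ _).trans (del_le_abs _ _)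
  have := Real.one_sub_sq_div_two_le_cos (x := m)
  have h2 : m ^ 2 ≤ |θ - θ'| ^ 2 := by gcongr
  have h3 : 1 - Real.cos m ≤ |θ - θ'| ^ 2 / 2 := by linarith
  nlinarith [mul_le_mul_of_nonneg_left h3 (sq_nonneg s)]

theorem abs_le_coneDist (l : ℝ) (p q : ℝ × ℝ) (hp : 0 ≤ p.1) (hq : 0 ≤ q.1) :
    |p.1 - q.1| ≤ coneDist l p q := by
  rw [coneDist_eq]
  apply Real.abs_le_sqrt
  have := Real.cos_le_one (min (del l (p.2 - q.2)) Real.pi)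
  have : 0 ≤ 2 * p.1 * q.1 * (1 - Real.cos (min (del l (p.2 - q.2)) Real.pi)) := by
    apply mul_nonneg (by positivity); linarith
  linarith

theorem del_le_coneDist {l : ℝ} (hl0 : 0 < l) (hl : l < 2 * Real.pi) (p q : ℝ × ℝ) (m : ℝ)
    (hm : 0 ≤ m) (hp : m ≤ p.1) (hq : m ≤ q.1) :
    m * del l (p.2 - q.2) ≤ (Real.pi / 2) * coneDist l p q := by
  rw [coneDist_eq]
  have hd := del_le_half hl0 (p.2 - q.2)
  have hd0 := del_nonneg l (p.2 - q.2)
  set d := del l (p.2 - q.2)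
  have hdp : d ≤ Real.pi := by linarith
  rw [min_eq_left hdp]
  have hc := Real.cos_le_one_sub_mul_cos_sq (x := d) (by rwa [abs_of_nonneg hd0])
  have hpi := Real.pi_pos
  have key : (2 / Real.pi * (m * d)) ≤ Real.sqrt ((p.1 - q.1) ^ 2 + 2 * p.1 * q.1 * (1 - Real.cos d)) := by
    apply Real.le_sqrt_of_sq_le
    have h1 : 2 / Real.pi ^ 2 * d ^ 2 ≤ 1 - Real.cos d := by linarith
    have h2 : m * m ≤ p.1 * q.1 := mul_le_mul hp hq hm (hm.trans hp)
    have h4 : 0 ≤ 2 / Real.pi ^ 2 * d ^ 2 := by positivity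
    have h3 : 2 * (m * m) * (2 / Real.pi ^ 2 * d ^ 2) ≤ 2 * (p.1 * q.1) * (1 - Real.cos d) := by
      gcongr
      nlinarith
    have e : (2 / Real.pi * (m * d)) ^ 2 = 2 * (m * m) * (2 / Real.pi ^ 2 * d ^ 2) := by
      field_simp; 
    rw [e]; nlinarith [sq_nonneg (p.1 - q.1)]
  calc m * d = (Real.pi / 2) * (2 / Real.pi * (m * d)) := by field_simp
    _ ≤ _ := by gcongr

theorem per_int {l : ℝ} {f : ℝ → ℝ} (h : ∀ θ, f (θ + l) = f θ) (k : ℤ) (θ : ℝ) :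
    f (θ + k * l) = f θ := by
  have : Function.Periodic f l := h
  have := this.int_mul k θ
  simpa using this

theorem RL.coneLip {l : ℝ} (hl0 : 0 < l) (hl : l < 2 * Real.pi) {w : ℝ → ℝ → ℝ} (h : RL l w) :
    ConeLip l 1 w := by
  obtain ⟨K, hK, h1, h2⟩ := h.lip
  refine ⟨h.per, K * (1 + Real.pi / 2), ?_⟩
  have tan : ∀ s ∈ Icc (0:ℝ) 1, ∀ θ θ', |w s θ - w s θ'| ≤ K * (s * del l (θ - θ')) := by
    intro s hs θ θ'
    have : ∀ k : ℤ, |w s θ - w s θ'| ≤ K * s * |θ - θ' + k * l| := by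
      intro k
      have := h2 s hs (θ + k * l) θ'
      rw [per_int (h.per s)] at this
      convert this using 3; ring
    rw [← mul_assoc]
    unfold del
    rw [Real.mul_iInf_of_nonneg (mul_nonneg hK hs.1)]
    exact le_ciInf this
  intro p q hp hq
  have a1 := abs_le_coneDist l p q hp.1 hq.1
  rcases le_total p.1 q.1 with hpq | hpq
  · have a2 := del_le_coneDist hl0 hl p q p.1 hp.1 le_rfl hpq
    have b1 := tan p.1 hp p.2 q.2
    have b2 := h1 q.2 p.1 hp q.1 hq
    calc |w p.1 p.2 - w q.1 q.2| ≤ |w p.1 p.2 - w p.1 q.2| + |w p.1 q.2 - w q.1 q.2| := abs_sub_le _ _ _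
      _ ≤ K * (Real.pi / 2 * coneDist l p q) + K * coneDist l p q := by
        refine add_le_add (b1.trans ?_) (b2.trans ?_) <;> gcongr
      _ = _ := by ring
  · have a2 := del_le_coneDist hl0 hl p q q.1 hq.1 hpq le_rfl
    have b1 := tan q.1 hq p.2 q.2
    have b2 := h1 p.2 p.1 hp q.1 hq
    calc |w p.1 p.2 - w q.1 q.2| ≤ |w p.1 p.2 - w q.1 p.2| + |w q.1 p.2 - w q.1 q.2| := abs_sub_le _ _ _
      _ ≤ K * coneDist l p q + K * (Real.pi / 2 * coneDist l p q) := by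
        refine add_le_add (b2.trans ?_) (b1.trans ?_) <;> gcongr
      _ = _ := by ring

theorem ConeLip.toRL {l : ℝ} {w : ℝ → ℝ → ℝ} (h : ConeLip l 1 w) : RL l w := by
  obtain ⟨K, hK⟩ := h.lipschitz
  have hd : ∀ p q, 0 ≤ coneDist l p q := fun p q => Real.sqrt_nonneg _
  refine ⟨h.periodic, |K|, abs_nonneg _, fun θ s hs s' hs' => ?_, fun s hs θ θ' => ?_⟩
  · have := hK (s, θ) (s', θ) hs hs'
    rw [coneDist_rad] at this
    exact this.trans (by gcongr; exact le_abs_self K)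
  · have := hK (s, θ) (s, θ') hs hs
    refine this.trans ?_
    have h2 := coneDist_tan l s θ θ' hs.1
    calc K * coneDist l (s, θ) (s, θ') ≤ |K| * coneDist l (s, θ) (s, θ') := by
          gcongr; exact hd _ _; exact le_abs_self K
      _ ≤ |K| * (s * |θ - θ'|) := by gcongr
      _ = _ := by ring

/-- Clamp the radial variable to `[0,1]`. -/
def cl (s : ℝ) : ℝ := max 0 (min s 1)

theorem cl_mem (s : ℝ) : cl s ∈ Icc (0:ℝ) 1 := by
  unfold cl; constructor
  · exact le_max_left _ _
  · exact max_le zero_le_one (min_le_right _ _)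

theorem cl_of_mem {s : ℝ} (h : s ∈ Icc (0:ℝ) 1) : cl s = s := by
  unfold cl; rw [min_eq_left h.2, max_eq_right h.1]

theorem cl_lip (s s' : ℝ) : |cl s - cl s'| ≤ |s - s'| := by
  unfold cl
  refine (abs_max_sub_max_le_max _ _ _ _).trans ?_
  refine max_le (by simp) ((abs_min_sub_min_le_max _ _ _ _).trans ?_)
  simp

theorem cl_abs_le (s : ℝ) : cl s ≤ |s| := by
  have := cl_lip s 0
  have h0 : cl 0 = 0 := cl_of_mem (by simp)
  rw [h0, sub_zero, sub_zero] at this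
  exact (le_abs_self _).trans this

theorem RL.clamp {l : ℝ} {w : ℝ → ℝ → ℝ} (h : RL l w) : GLp l (fun s θ => w (cl s) θ) := by
  obtain ⟨K, hK, h1, h2⟩ := h.lip
  refine ⟨fun r θ => h.per _ θ, K, hK, fun θ s s' => ?_, fun s θ θ' => ?_⟩
  · exact (h1 θ _ (cl_mem s) _ (cl_mem s')).trans (mul_le_mul_of_nonneg_left (cl_lip s s') hK)
  · exact (h2 _ (cl_mem s) θ θ').trans (by gcongr; exact cl_abs_le s)

theorem GLp.cont {l : ℝ} {w : ℝ → ℝ → ℝ} (h : GLp l w) : Continuous (Function.uncurry w) := by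
  obtain ⟨K, hK, h1, h2⟩ := h.lip
  rw [continuous_iff_continuousAt]
  rintro ⟨s, θ⟩
  rw [ContinuousAt, tendsto_iff_dist_tendsto_zero]
  refine squeeze_zero (g := fun p : ℝ × ℝ => K * |p.1 - s| + K * |s| * |p.2 - θ|)
    (fun _ => dist_nonneg) (fun p => ?_) ?_
  · rw [Real.dist_eq]
    refine (abs_sub_le _ (w s p.2) _).trans ?_
    exact add_le_add (h1 _ _ _) (h2 _ _ _)
  · have : Continuous fun p : ℝ × ℝ => K * |p.1 - s| + K * |s| * |p.2 - θ| := by fun_prop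
    have := this.tendsto (s, θ)
    simpa using this

/-- The area density. -/
def ar (lp lm x : ℝ) : ℝ := (if 0 < x then lp else 0) + (if x < 0 then lm else 0)

/-- The functional over the radial range `(0, R)`. -/
def En (l lp lm : ℝ) (u : ℝ → ℝ → ℝ) (R : ℝ) : ℝ :=
  ∫ p in Ioo (0:ℝ) R ×ˢ Ioo (0:ℝ) l, (gradSq u p + ar lp lm (u p.1 p.2)) * p.1

theorem Jfun_eq (l lp lm : ℝ) (u : ℝ → ℝ → ℝ) (R : ℝ) : Jfun l lp lm u R = En l lp lm u R := by
  unfold Jfun En ar; simp only [add_assoc]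

theorem gradSq_congr {u w : ℝ → ℝ → ℝ} {S : Set ℝ} (hS : IsOpen S)
    (h : ∀ s ∈ S, ∀ θ, u s θ = w s θ) (p : ℝ × ℝ) (hp : p.1 ∈ S) : gradSq u p = gradSq w p := by
  unfold gradSq
  have e1 : (fun s => u s p.2) =ᶠ[nhds p.1] fun s => w s p.2 := by
    filter_upwards [hS.mem_nhds hp] with s hs using h s hs _
  have e2 : (fun φ => u p.1 φ) = fun φ => w p.1 φ := funext fun φ => h _ hp φ
  rw [e1.deriv_eq, e2]

theorem En_congr {l lp lm : ℝ} {u w : ℝ → ℝ → ℝ} {R : ℝ}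
    (h : ∀ s ∈ Ioo (0:ℝ) R, ∀ θ, u s θ = w s θ) : En l lp lm u R = En l lp lm w R := by
  unfold En
  refine setIntegral_congr_fun (measurableSet_Ioo.prod measurableSet_Ioo) ?_
  intro p hp
  simp only
  rw [gradSq_congr isOpen_Ioo h p hp.1, h _ hp.1]

/-- Minimizers, in globally Lipschitz form. -/
structure Mn (l lp lm : ℝ) (u : ℝ → ℝ → ℝ) : Prop where
  gl : GLp l u
  le : ∀ w, RL l w → (∀ θ, w 1 θ = u 1 θ) → En l lp lm u 1 ≤ En l lp lm w 1

theorem IsMinimizerJ.toMn {l lp lm : ℝ} (hl0 : 0 < l) (hl : l < 2 * Real.pi) {u : ℝ → ℝ → ℝ}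
    (h : IsMinimizerJ l lp lm 1 u) : Mn l lp lm (fun s θ => u (cl s) θ) := by
  refine ⟨h.1.toRL.clamp, fun w hw hb => ?_⟩
  have := h.2 w (hw.coneLip hl0 hl) (fun θ => by rw [hb, cl_of_mem (by simp)])
  rw [Jfun_eq, Jfun_eq] at this
  rw [En_congr (w := u)]
  · exact this
  · intro s hs θ
    rw [cl_of_mem ⟨hs.1.le, hs.2.le⟩]

/-! ### Bounded measurable integrands on the strip -/

/-- Measurable, and bounded on the strip `0 ≤ s ≤ 1`. -/
structure BM (F : ℝ × ℝ → ℝ) : Prop where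
  meas : Measurable F
  bdd : ∃ C : ℝ, 0 ≤ C ∧ ∀ s ∈ Icc (0:ℝ) 1, ∀ θ, |F (s, θ)| ≤ C

theorem BM.const (c : ℝ) : BM (fun _ => c) := ⟨measurable_const, |c|, abs_nonneg _, fun _ _ _ => le_rfl⟩

theorem BM.add {F G : ℝ × ℝ → ℝ} (hF : BM F) (hG : BM G) : BM (fun p => F p + G p) := by
  obtain ⟨C, hC, h⟩ := hF.bdd
  obtain ⟨D, hD, h'⟩ := hG.bdd
  exact ⟨hF.meas.add hG.meas, C + D, by positivity,
    fun s hs θ => (abs_add_le _ _).trans (add_le_add (h s hs θ) (h' s hs θ))⟩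

theorem BM.mul {F G : ℝ × ℝ → ℝ} (hF : BM F) (hG : BM G) : BM (fun p => F p * G p) := by
  obtain ⟨C, hC, h⟩ := hF.bdd
  obtain ⟨D, hD, h'⟩ := hG.bdd
  refine ⟨hF.meas.mul hG.meas, C * D, by positivity, fun s hs θ => ?_⟩
  rw [abs_mul]
  exact mul_le_mul (h s hs θ) (h' s hs θ) (abs_nonneg _) hC

theorem BM.neg {F : ℝ × ℝ → ℝ} (hF : BM F) : BM (fun p => - F p) := by
  obtain ⟨C, hC, h⟩ := hF.bdd
  exact ⟨hF.meas.neg, C, hC, fun s hs θ => by rw [abs_neg]; exact h s hs θ⟩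

theorem BM.sub {F G : ℝ × ℝ → ℝ} (hF : BM F) (hG : BM G) : BM (fun p => F p - G p) := by
  simpa [sub_eq_add_neg] using hF.add hG.neg

theorem BM.pow2 {F : ℝ × ℝ → ℝ} (hF : BM F) : BM (fun p => F p ^ 2) := by
  simpa [sq] using hF.mul hF

theorem BM.cmul {F : ℝ × ℝ → ℝ} (c : ℝ) (hF : BM F) : BM (fun p => c * F p) := (BM.const c).mul hF

theorem BM.fst : BM (fun p => p.1) :=
  ⟨measurable_fst, 1, zero_le_one, fun s hs _ => abs_le.2 ⟨by linarith [hs.1], hs.2⟩⟩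

theorem BM.of_fst {f : ℝ → ℝ} (hf : Measurable f) (C : ℝ) (h : ∀ s ∈ Icc (0:ℝ) 1, |f s| ≤ C) :
    BM (fun p => f p.1) :=
  ⟨hf.comp measurable_fst, C, (abs_nonneg _).trans (h 0 (by simp)), fun s hs _ => h s hs⟩

theorem BM.of_snd {f : ℝ → ℝ} (hf : Measurable f) (C : ℝ) (h : ∀ s, |f s| ≤ C) :
    BM (fun p => f p.2) :=
  ⟨hf.comp measurable_snd, C, (abs_nonneg _).trans (h 0), fun _ _ θ => h θ⟩

theorem BM.indicator {F : ℝ × ℝ → ℝ} (hF : BM F) {S : Set (ℝ × ℝ)} (hS : MeasurableSet S) :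
    BM (S.indicator F) := by
  obtain ⟨C, hC, h⟩ := hF.bdd
  refine ⟨hF.meas.indicator hS, C, hC, fun s hs θ => ?_⟩
  by_cases hp : (s, θ) ∈ S
  · rw [indicator_of_mem hp]; exact h s hs θ
  · rw [indicator_of_notMem hp]; simpa using hC

/-- The polar box. -/
def Q (l R : ℝ) : Set (ℝ × ℝ) := Ioo (0:ℝ) R ×ˢ Ioo (0:ℝ) l

theorem Q_meas (l R : ℝ) : MeasurableSet (Q l R) := measurableSet_Ioo.prod measurableSet_Ioo

theorem Q_vol (l R : ℝ) : volume (Q l R) < ⊤ := by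
  unfold Q
  rw [Measure.volume_eq_prod, Measure.prod_prod, Real.volume_Ioo, Real.volume_Ioo]
  exact ENNReal.mul_lt_top ENNReal.ofReal_lt_top ENNReal.ofReal_lt_top

theorem BM.int {F : ℝ × ℝ → ℝ} (hF : BM F) {l R : ℝ} (hR : R ≤ 1) : IntegrableOn F (Q l R) := by
  obtain ⟨C, hC, h⟩ := hF.bdd
  have : IsFiniteMeasure (volume.restrict (Q l R)) := ⟨by simpa using Q_vol l R⟩
  refine Measure.integrableOn_of_bounded (Q_vol l R).ne hF.meas.aestronglyMeasurable (M := C) ?_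
  refine (ae_restrict_iff' (Q_meas l R)).2 (Filter.Eventually.of_forall ?_)
  rintro ⟨s, θ⟩ hp
  exact h s ⟨hp.1.1.le, hp.1.2.le.trans hR⟩ θ

/-- Integral over a circle. -/
def sl (l : ℝ) (F : ℝ × ℝ → ℝ) (s : ℝ) : ℝ := ∫ θ in (0:ℝ)..l, F (s, θ)

theorem BM.intθ {F : ℝ × ℝ → ℝ} (hF : BM F) {s : ℝ} (hs : s ∈ Icc (0:ℝ) 1) (a b : ℝ) :
    IntervalIntegrable (fun θ => F (s, θ)) volume a b := by
  obtain ⟨C, hC, h⟩ := hF.bdd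
  rw [intervalIntegrable_iff]
  refine Measure.integrableOn_of_bounded (M := C) (by simp)
    (hF.meas.comp measurable_prodMk_left).aestronglyMeasurable ?_
  exact Filter.Eventually.of_forall fun θ => h s hs θ

theorem sl_meas {F : ℝ × ℝ → ℝ} (hF : Measurable F) (l : ℝ) : Measurable (sl l F) := by
  unfold sl intervalIntegral
  exact ((hF.stronglyMeasurable.integral_prod_right' (ν := volume.restrict (Ioc 0 l))).sub
    (hF.stronglyMeasurable.integral_prod_right' (ν := volume.restrict (Ioc l 0)))).measurable

theorem sl_bdd {F : ℝ × ℝ → ℝ} {l : ℝ} (hl : 0 ≤ l) {C : ℝ} {s : ℝ} (h : ∀ θ, |F (s, θ)| ≤ C) :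
    |sl l F s| ≤ C * l := by
  unfold sl
  have := intervalIntegral.norm_integral_le_of_norm_le_const (a := 0) (b := l)
    (f := fun θ => F (s, θ)) (C := C) (fun x _ => h x)
  simpa [abs_of_nonneg hl] using this

theorem BM.int_sl {F : ℝ × ℝ → ℝ} (hF : BM F) {l : ℝ} (hl : 0 ≤ l) {a b : ℝ}
    (ha : a ∈ Icc (0:ℝ) 1) (hb : b ∈ Icc (0:ℝ) 1) : IntervalIntegrable (sl l F) volume a b := by
  obtain ⟨C, hC, h⟩ := hF.bdd
  rw [intervalIntegrable_iff]
  refine Measure.integrableOn_of_bounded (M := C * l) (by simp)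
    (sl_meas hF.meas l).aestronglyMeasurable ?_
  refine (ae_restrict_iff' measurableSet_uIoc).2 (Filter.Eventually.of_forall fun s hs => ?_)
  have : s ∈ Icc (0:ℝ) 1 := by
    have := uIoc_subset_uIcc hs
    exact (uIcc_subset_Icc ha hb) this
  exact sl_bdd hl fun θ => h s this θ

/-- Integral over the box. -/
def I2 (l : ℝ) (F : ℝ × ℝ → ℝ) (R : ℝ) : ℝ := ∫ p in Q l R, F p

theorem I2_eq {F : ℝ × ℝ → ℝ} (hF : BM F) {l R : ℝ} (hl : 0 ≤ l) (hR0 : 0 ≤ R) (hR : R ≤ 1) :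
    I2 l F R = ∫ s in (0:ℝ)..R, sl l F s := by
  unfold I2
  have h := hF.int (l := l) hR
  unfold Q at *
  rw [Measure.volume_eq_prod] at *
  rw [setIntegral_prod _ h, intervalIntegral.integral_of_le hR0, integral_Ioc_eq_integral_Ioo]
  congr 1; ext s
  unfold sl
  rw [intervalIntegral.integral_of_le hl, integral_Ioc_eq_integral_Ioo]

theorem I2_add {F G : ℝ × ℝ → ℝ} (hF : BM F) (hG : BM G) {l R : ℝ} (hR : R ≤ 1) :
    I2 l (fun p => F p + G p) R = I2 l F R + I2 l G R := integral_add (hF.int hR) (hG.int hR)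

theorem I2_sub {F G : ℝ × ℝ → ℝ} (hF : BM F) (hG : BM G) {l R : ℝ} (hR : R ≤ 1) :
    I2 l (fun p => F p - G p) R = I2 l F R - I2 l G R := integral_sub (hF.int hR) (hG.int hR)

theorem I2_cmul {F : ℝ × ℝ → ℝ} {l R : ℝ} (c : ℝ) :
    I2 l (fun p => c * F p) R = c * I2 l F R := integral_const_mul _ _

theorem I2_mono {F G : ℝ × ℝ → ℝ} {l R : ℝ} (hF : BM F) (hG : BM G) (hR : R ≤ 1)
    (h : ∀ p ∈ Q l R, F p ≤ G p) : I2 l F R ≤ I2 l G R :=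
  setIntegral_mono_on (hF.int hR) (hG.int hR) (Q_meas l R) h

theorem I2_nonneg {F : ℝ × ℝ → ℝ} {l R : ℝ} (h : ∀ p ∈ Q l R, 0 ≤ F p) : 0 ≤ I2 l F R :=
  setIntegral_nonneg (Q_meas l R) h

theorem I2_congr {F G : ℝ × ℝ → ℝ} {l R : ℝ} (h : ∀ p ∈ Q l R, F p = G p) : I2 l F R = I2 l G R :=
  setIntegral_congr_fun (Q_meas l R) h

theorem I2_mono_set {F : ℝ × ℝ → ℝ} {l R R' : ℝ} (hF : BM F) (hR : R ≤ R') (hR' : R' ≤ 1)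
    (h : ∀ p ∈ Q l R', 0 ≤ F p) : I2 l F R ≤ I2 l F R' := by
  refine setIntegral_mono_set (hF.int hR') ?_ ?_
  · exact (ae_restrict_iff' (Q_meas l R')).2 (Filter.Eventually.of_forall h)
  · exact (prod_mono (Ioo_subset_Ioo_right hR) le_rfl).eventuallyLE

/-! ### Partial derivatives -/

/-- Radial derivative. -/
def dr (u : ℝ → ℝ → ℝ) (p : ℝ × ℝ) : ℝ := deriv (fun s => u s p.2) p.1
/-- Angular derivative. -/
def dt (u : ℝ → ℝ → ℝ) (p : ℝ × ℝ) : ℝ := deriv (fun φ => u p.1 φ) p.2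
/-- Tangential derivative. -/
def tn (u : ℝ → ℝ → ℝ) (p : ℝ × ℝ) : ℝ := dt u p / p.1

theorem gradSq_eq (u : ℝ → ℝ → ℝ) (p : ℝ × ℝ) : gradSq u p = dr u p ^ 2 + tn u p ^ 2 := by
  unfold gradSq dr tn dt; rw [div_pow]

theorem gradSq_nonneg (u : ℝ → ℝ → ℝ) (p : ℝ × ℝ) : 0 ≤ gradSq u p := by
  rw [gradSq_eq]; positivity

theorem abs_deriv_le {f : ℝ → ℝ} {K : ℝ} (hK : 0 ≤ K) (h : ∀ x y, |f x - f y| ≤ K * |x - y|) (x : ℝ) :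
    |deriv f x| ≤ K := by
  have : LipschitzWith (Real.toNNReal K) f := LipschitzWith.of_dist_le_mul fun x y => by
    simpa [Real.dist_eq, Real.coe_toNNReal _ hK] using h x y
  have := norm_deriv_le_of_lipschitz (x₀ := x) this
  simpa [Real.coe_toNNReal _ hK] using this

namespace GLp
variable {l : ℝ} {u : ℝ → ℝ → ℝ}

theorem cont_s (h : GLp l u) (θ : ℝ) : Continuous fun s => u s θ :=
  h.cont.comp (by fun_prop : Continuous fun s : ℝ => (s, θ))

theorem cont_t (h : GLp l u) (s : ℝ) : Continuous fun θ => u s θ :=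
  h.cont.comp (by fun_prop : Continuous fun θ : ℝ => (s, θ))

theorem dr_meas (h : GLp l u) : Measurable (dr u) := by
  have hc : Continuous (Function.uncurry fun θ s => u s θ) :=
    h.cont.comp (by fun_prop : Continuous fun p : ℝ × ℝ => (p.2, p.1))
  exact (measurable_deriv_with_param hc).comp measurable_swap

theorem dt_meas (h : GLp l u) : Measurable (dt u) := measurable_deriv_with_param h.cont

theorem tn_meas (h : GLp l u) : Measurable (tn u) := h.dt_meas.div measurable_fst

theorem bddAll (h : GLp l u) : ∃ K : ℝ, 0 ≤ K ∧ (∀ p, |dr u p| ≤ K) ∧ (∀ p, |dt u p| ≤ K * |p.1|) ∧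
    (∀ p, |tn u p| ≤ K) := by
  obtain ⟨K, hK, h1, h2⟩ := h.lip
  have hd : ∀ p, |dt u p| ≤ K * |p.1| := fun p => abs_deriv_le (by positivity) (h2 p.1) p.2
  refine ⟨K, hK, fun p => abs_deriv_le hK (h1 p.2) p.1, hd, fun p => ?_⟩
  unfold tn
  rw [abs_div]
  exact div_le_of_le_mul₀ (abs_nonneg _) hK (hd p)

theorem bm_dr (h : GLp l u) : BM (dr u) := by
  obtain ⟨K, hK, h1, h2, h3⟩ := h.bddAll
  exact ⟨h.dr_meas, K, hK, fun s _ θ => h1 _⟩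

theorem bm_tn (h : GLp l u) : BM (tn u) := by
  obtain ⟨K, hK, h1, h2, h3⟩ := h.bddAll
  exact ⟨h.tn_meas, K, hK, fun s _ θ => h3 _⟩

theorem bm_dt (h : GLp l u) : BM (dt u) := by
  obtain ⟨K, hK, h1, h2, h3⟩ := h.bddAll
  exact ⟨h.dt_meas, K, hK, fun s hs θ => (h2 _).trans (by
    simp only [abs_of_nonneg hs.1]; nlinarith [hs.2])⟩

theorem bm_grad (h : GLp l u) : BM (gradSq u) := by
  have := h.bm_dr.pow2.add h.bm_tn.pow2
  simpa only [← gradSq_eq] using this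

theorem vertex (h : GLp l u) (θ θ' : ℝ) : u 0 θ = u 0 θ' := by
  obtain ⟨K, hK, h1, h2⟩ := h.lip
  have := h2 0 θ θ'
  simp at this; linarith

theorem bm_u (h : GLp l u) : BM (fun p => u p.1 p.2) := by
  obtain ⟨K, hK, h1, h2⟩ := h.lip
  refine ⟨h.cont.measurable, K + |u 0 0|, by positivity, fun s hs θ => ?_⟩
  have := h1 θ s 0
  rw [h.vertex θ 0, sub_zero, abs_of_nonneg hs.1] at this
  have h3 := abs_sub_abs_le_abs_sub (u s θ) (u 0 0)
  simp only
  nlinarith [hs.2]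

theorem ae_dr (h : GLp l u) : ∀ᵐ p : ℝ × ℝ, DifferentiableAt ℝ (fun s => u s p.2) p.1 := by
  obtain ⟨K, hK, h1, h2⟩ := h.lip
  have hc : Continuous (Function.uncurry fun θ s => u s θ) :=
    h.cont.comp (by fun_prop : Continuous fun p : ℝ × ℝ => (p.2, p.1))
  have hm := measurableSet_of_differentiableAt_with_param (𝕜 := ℝ) hc
  have : ∀ᵐ q : ℝ × ℝ, DifferentiableAt ℝ (fun s => u s q.1) q.2 := by
    rw [Measure.volume_eq_prod, Measure.ae_prod_iff_ae_ae hm]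
    refine Filter.Eventually.of_forall fun θ => ?_
    have hL : LipschitzWith K.toNNReal (fun s => u s θ) := LipschitzWith.of_dist_le_mul fun x y => by
      simpa [Real.dist_eq, Real.coe_toNNReal _ hK] using h1 θ x y
    exact hL.ae_differentiableAt_real
  have hs : MeasurePreserving (Prod.swap : ℝ × ℝ → ℝ × ℝ) volume volume :=
    Measure.measurePreserving_swap
  exact hs.quasiMeasurePreserving.ae this

theorem ae_dt_s (h : GLp l u) (s : ℝ) : ∀ᵐ θ : ℝ, DifferentiableAt ℝ (fun φ => u s φ) θ := by
  obtain ⟨K, hK, h1, h2⟩ := h.lip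
  have hL : LipschitzWith (K * |s|).toNNReal (fun φ => u s φ) := LipschitzWith.of_dist_le_mul fun x y => by
      simpa [Real.dist_eq, Real.coe_toNNReal _ (by positivity : 0 ≤ K * |s|)] using h2 s x y
  exact hL.ae_differentiableAt_real

theorem ae_dt (h : GLp l u) : ∀ᵐ p : ℝ × ℝ, DifferentiableAt ℝ (fun φ => u p.1 φ) p.2 := by
  have hm := measurableSet_of_differentiableAt_with_param (𝕜 := ℝ) h.cont
  rw [Measure.volume_eq_prod, Measure.ae_prod_iff_ae_ae hm]
  exact Filter.Eventually.of_forall fun s => h.ae_dt_s s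

end GLp

theorem ar_meas (lp lm : ℝ) : Measurable (ar lp lm) := by
  unfold ar
  exact (Measurable.ite measurableSet_Ioi measurable_const measurable_const).add
    (Measurable.ite measurableSet_Iio measurable_const measurable_const)

theorem ar_nonneg {lp lm : ℝ} (hp : 0 ≤ lp) (hm : 0 ≤ lm) (x : ℝ) : 0 ≤ ar lp lm x := by
  unfold ar; split_ifs <;> linarith

theorem ar_le {lp lm : ℝ} (hp : 0 ≤ lp) (hm : 0 ≤ lm) (x : ℝ) : ar lp lm x ≤ max lp lm := by
  unfold ar
  have h1 := le_max_left lp lm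
  have h2 := le_max_right lp lm
  split_ifs <;> linarith

theorem ar_bdd (lp lm x : ℝ) : |ar lp lm x| ≤ |lp| + |lm| := by
  unfold ar
  refine (abs_add_le _ _).trans (add_le_add ?_ ?_) <;> split_ifs <;> simp

theorem ar_pos {lp lm x : ℝ} (h : 0 < x) : ar lp lm x = lp := by
  unfold ar; simp [h, h.le.not_gt]
theorem ar_neg {lp lm x : ℝ} (h : x < 0) : ar lp lm x = lm := by
  unfold ar; simp [h, h.le.not_gt]
theorem ar_zero (lp lm : ℝ) : ar lp lm 0 = 0 := by
  unfold ar; simp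
theorem ar_symm (lp lm x : ℝ) : ar lm lp (-x) = ar lp lm x := by
  unfold ar; simp [add_comm]

theorem GLp.bm_ar {l : ℝ} {u : ℝ → ℝ → ℝ} (h : GLp l u) (lp lm : ℝ) :
    BM (fun p => ar lp lm (u p.1 p.2)) :=
  ⟨(ar_meas lp lm).comp h.cont.measurable, |lp| + |lm|, by positivity, fun _ _ _ => ar_bdd _ _ _⟩

/-- The energy density (without area factor). -/
def ed (lp lm : ℝ) (u : ℝ → ℝ → ℝ) (p : ℝ × ℝ) : ℝ := gradSq u p + ar lp lm (u p.1 p.2)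

theorem GLp.bm_ed {l : ℝ} {u : ℝ → ℝ → ℝ} (h : GLp l u) (lp lm : ℝ) : BM (ed lp lm u) :=
  h.bm_grad.add (h.bm_ar lp lm)

theorem En_I2 (l lp lm : ℝ) (u : ℝ → ℝ → ℝ) (R : ℝ) :
    En l lp lm u R = I2 l (fun p => ed lp lm u p * p.1) R := rfl

/-- Upper bound for the energy of a competitor. -/
theorem En_le {l lp lm : ℝ} (hp : 0 ≤ lp) (hm : 0 ≤ lm) {w : ℝ → ℝ → ℝ} {Φ : ℝ × ℝ → ℝ} {R : ℝ}
    (hR : R ≤ 1) (hΦ : BM Φ) (h : ∀ᵐ p, p ∈ Q l R → ed lp lm w p * p.1 ≤ Φ p) :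
    En l lp lm w R ≤ I2 l Φ R := by
  rw [En_I2]
  unfold I2
  refine integral_mono_of_nonneg ?_ (hΦ.int hR) ?_
  · refine (ae_restrict_iff' (Q_meas l R)).2 (Filter.Eventually.of_forall ?_)
    intro p hp'
    exact mul_nonneg (add_nonneg (gradSq_nonneg _ _) (ar_nonneg hp hm _)) hp'.1.1.le
  · exact (ae_restrict_iff' (Q_meas l R)).2 h

theorem En_nonneg {l lp lm : ℝ} (hp : 0 ≤ lp) (hm : 0 ≤ lm) (w : ℝ → ℝ → ℝ) (R : ℝ) :
    0 ≤ En l lp lm w R := by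
  rw [En_I2]
  exact I2_nonneg fun p hp' =>
    mul_nonneg (add_nonneg (gradSq_nonneg _ _) (ar_nonneg hp hm _)) hp'.1.1.le

/-! ### Symmetry and rescaling -/

theorem gradSq_neg (u : ℝ → ℝ → ℝ) (p : ℝ × ℝ) : gradSq (fun s θ => - u s θ) p = gradSq u p := by
  unfold gradSq
  rw [show (fun s => - u s p.2) = -(fun s => u s p.2) from rfl,
    show (fun φ => - u p.1 φ) = -(fun φ => u p.1 φ) from rfl, deriv.neg, deriv.neg]
  simp

theorem ed_neg (lp lm : ℝ) (u : ℝ → ℝ → ℝ) (p : ℝ × ℝ) :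
    ed lm lp (fun s θ => - u s θ) p = ed lp lm u p := by
  unfold ed; rw [gradSq_neg, ar_symm]

theorem En_neg (l lp lm : ℝ) (u : ℝ → ℝ → ℝ) (R : ℝ) :
    En l lm lp (fun s θ => - u s θ) R = En l lp lm u R := by
  rw [En_I2, En_I2]; simp only [ed_neg]

theorem RL.neg {l : ℝ} {u : ℝ → ℝ → ℝ} (h : RL l u) : RL l (fun s θ => - u s θ) := by
  obtain ⟨K, hK, h1, h2⟩ := h.lip
  refine ⟨fun r θ => by rw [h.per], K, hK, fun θ s hs s' hs' => ?_, fun s hs θ θ' => ?_⟩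
  · rw [← abs_neg]; convert h1 θ s hs s' hs' using 2; ring
  · rw [← abs_neg]; convert h2 s hs θ θ' using 2; ring

theorem GLp.neg {l : ℝ} {u : ℝ → ℝ → ℝ} (h : GLp l u) : GLp l (fun s θ => - u s θ) := by
  obtain ⟨K, hK, h1, h2⟩ := h.lip
  refine ⟨fun r θ => by rw [h.per], K, hK, fun θ s s' => ?_, fun s θ θ' => ?_⟩
  · rw [← abs_neg]; convert h1 θ s s' using 2; ring
  · rw [← abs_neg]; convert h2 s θ θ' using 2; ring

theorem Mn.neg {l lp lm : ℝ} {u : ℝ → ℝ → ℝ} (h : Mn l lp lm u) : Mn l lm lp (fun s θ => - u s θ) := by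
  refine ⟨h.gl.neg, fun w hw hb => ?_⟩
  rw [En_neg, ← En_neg l lm lp w]
  exact h.le _ hw.neg fun θ => by rw [hb]; simp

/-- Rescaling. -/
def sc (r : ℝ) (u : ℝ → ℝ → ℝ) (s θ : ℝ) : ℝ := u (r * s) θ / r

theorem GLp.sc {l : ℝ} {u : ℝ → ℝ → ℝ} (h : GLp l u) {r : ℝ} (hr : 0 < r) : GLp l (sc r u) := by
  obtain ⟨K, hK, h1, h2⟩ := h.lip
  refine ⟨fun s θ => by unfold _root_.sc; rw [h.per], K, hK, fun θ s s' => ?_, fun s θ θ' => ?_⟩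
  · unfold _root_.sc
    rw [← sub_div, abs_div, abs_of_pos hr, div_le_iff₀ hr]
    refine (h1 _ _ _).trans (le_of_eq ?_)
    rw [← mul_sub, abs_mul, abs_of_pos hr]; ring
  · unfold _root_.sc
    rw [← sub_div, abs_div, abs_of_pos hr, div_le_iff₀ hr]
    refine (h2 _ _ _).trans (le_of_eq ?_)
    rw [abs_mul, abs_of_pos hr]; ring

theorem dr_sc (u : ℝ → ℝ → ℝ) {r : ℝ} (hr : 0 < r) (s θ : ℝ) : dr (sc r u) (s, θ) = dr u (r * s, θ) := by
  unfold dr sc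
  simp only
  rw [deriv_div_const, deriv_comp_mul_left r (fun s => u s θ) s]
  simp; field_simp

theorem dt_sc (u : ℝ → ℝ → ℝ) (r s θ : ℝ) : dt (sc r u) (s, θ) = dt u (r * s, θ) / r := by
  unfold dt sc
  simp only
  rw [deriv_div_const]

theorem tn_sc (u : ℝ → ℝ → ℝ) {r : ℝ} (hr : 0 < r) (s θ : ℝ) : tn (sc r u) (s, θ) = tn u (r * s, θ) := by
  unfold tn; rw [dt_sc]; simp only [div_div]

theorem gradSq_sc (u : ℝ → ℝ → ℝ) {r : ℝ} (hr : 0 < r) (s θ : ℝ) :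
    gradSq (sc r u) (s, θ) = gradSq u (r * s, θ) := by
  rw [gradSq_eq, gradSq_eq, dr_sc u hr, tn_sc u hr]

theorem ar_div {lp lm x r : ℝ} (hr : 0 < r) : ar lp lm (x / r) = ar lp lm x := by
  unfold ar
  have h1 : 0 < x / r ↔ 0 < x := by rw [lt_div_iff₀ hr]; simp
  have h2 : x / r < 0 ↔ x < 0 := by rw [div_lt_iff₀ hr]; simp
  simp only [h1, h2]

theorem ed_sc {lp lm : ℝ} (u : ℝ → ℝ → ℝ) {r : ℝ} (hr : 0 < r) (s θ : ℝ) :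
    ed lp lm (sc r u) (s, θ) = ed lp lm u (r * s, θ) := by
  unfold ed; rw [gradSq_sc u hr]; simp only [sc, ar_div hr]

theorem En_slice {l lp lm : ℝ} (hl : 0 ≤ l) {u : ℝ → ℝ → ℝ} (h : GLp l u) {R : ℝ} (hR0 : 0 ≤ R)
    (hR : R ≤ 1) : En l lp lm u R = ∫ s in (0:ℝ)..R, sl l (fun p => ed lp lm u p * p.1) s := by
  rw [En_I2, I2_eq ((h.bm_ed lp lm).mul BM.fst) hl hR0 hR]

theorem En_sc {l lp lm : ℝ} (hl : 0 ≤ l) {u : ℝ → ℝ → ℝ} (h : GLp l u) {r R : ℝ} (hr : 0 < r)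
    (hr1 : r ≤ 1) (hR0 : 0 ≤ R) (hR : R ≤ 1) :
    En l lp lm (sc r u) R = En l lp lm u (r * R) / r ^ 2 := by
  rw [En_slice hl (h.sc hr) hR0 hR, En_slice hl h (by positivity) (by nlinarith)]
  have : ∀ s, sl l (fun p => ed lp lm (sc r u) p * p.1) s
      = r⁻¹ * sl l (fun p => ed lp lm u p * p.1) (r * s) := by
    intro s
    unfold sl
    rw [← intervalIntegral.integral_const_mul]
    congr 1; ext θ
    simp only
    rw [ed_sc u hr]
    field_simp
  simp only [this]
  rw [intervalIntegral.integral_const_mul, intervalIntegral.integral_comp_mul_left _ hr.ne']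
  simp; field_simp

/-- Gluing a competitor. -/
theorem glue {l lp lm : ℝ} (hl : 0 ≤ l) {u w : ℝ → ℝ → ℝ} (hu : GLp l u) (hw : GLp l w)
    {r : ℝ} (hr : 0 < r) (hr1 : r ≤ 1) (hc : ∀ s, 1 ≤ s → ∀ θ, w s θ = u r θ / r) :
    ∃ W, GLp l W ∧ (∀ θ, W 1 θ = u 1 θ) ∧
      En l lp lm W 1 - En l lp lm u 1 = r ^ 2 * En l lp lm w 1 - En l lp lm u r := by
  obtain ⟨K, hK, h1, h2⟩ := hu.lip
  obtain ⟨K', hK', h1', h2'⟩ := hw.lip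
  let W : ℝ → ℝ → ℝ := fun s θ => r * w (s / r) θ + (u (max s r) θ - u r θ)
  have W1 : ∀ s ≤ r, ∀ θ, W s θ = r * w (s / r) θ := by
    intro s hs θ; simp only [W, max_eq_right hs]; ring
  have W2 : ∀ s, r ≤ s → ∀ θ, W s θ = u s θ := by
    intro s hs θ
    simp only [W, max_eq_left hs, hc (s / r) (by rw [le_div_iff₀ hr]; linarith)]
    field_simp; ring
  have hW : GLp l W := by
    refine ⟨fun s θ => by simp only [W, hw.per, hu.per], K' + K, by positivity, fun θ s s' => ?_,
      fun s θ θ' => ?_⟩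
    · have a := h1' θ (s / r) (s' / r)
      have b := h1 θ (max s r) (max s' r)
      have c : |max s r - max s' r| ≤ |s - s'| := by
        refine (abs_max_sub_max_le_max _ _ _ _).trans (by simp)
      have e : W s θ - W s' θ = r * (w (s / r) θ - w (s' / r) θ) + (u (max s r) θ - u (max s' r) θ) := by
        simp only [W]; ring
      rw [e]
      refine (abs_add_le _ _).trans ?_
      rw [abs_mul, abs_of_pos hr]
      rw [← sub_div, abs_div, abs_of_pos hr] at a
      have a' : r * |w (s / r) θ - w (s' / r) θ| ≤ K' * |s - s'| := by
        calc _ ≤ r * (K' * (|s - s'| / r)) := by gcongr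
          _ = _ := by field_simp
      have b' := b.trans (mul_le_mul_of_nonneg_left c hK)
      linarith
    · rcases le_total s r with hs | hs
      · rw [W1 s hs, W1 s hs, ← mul_sub, abs_mul, abs_of_pos hr]
        have a := h2' (s / r) θ θ'
        rw [abs_div, abs_of_pos hr] at a
        calc _ ≤ r * (K' * (|s| / r) * |θ - θ'|) := by gcongr
          _ = K' * |s| * |θ - θ'| := by field_simp
          _ ≤ _ := by gcongr; linarith
      · rw [W2 s hs, W2 s hs]
        refine (h2 s θ θ').trans ?_
        gcongr; linarith
  refine ⟨W, hW, W2 1 hr1, ?_⟩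
  have hws : En l lp lm w 1 = En l lp lm (sc r W) 1 := by
    apply En_congr
    intro s hs θ
    unfold sc
    rw [W1 _ (by nlinarith [hs.2])]
    rw [mul_div_cancel_left₀ _ hr.ne', mul_div_cancel_left₀ _ hr.ne']
  rw [hws, En_sc hl hW hr hr1 zero_le_one le_rfl]
  have split : ∀ {v : ℝ → ℝ → ℝ}, GLp l v → En l lp lm v 1 = En l lp lm v r +
      ∫ s in r..1, sl l (fun p => ed lp lm v p * p.1) s := by
    intro v hv
    rw [En_slice hl hv zero_le_one le_rfl, En_slice hl hv hr.le hr1]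
    have hb := (hv.bm_ed lp lm).mul BM.fst
    rw [intervalIntegral.integral_add_adjacent_intervals
      (hb.int_sl hl (by simp) ⟨hr.le, hr1⟩) (hb.int_sl hl ⟨hr.le, hr1⟩ (by simp))]
  rw [split hW, split hu]
  have : ∫ s in r..1, sl l (fun p => ed lp lm W p * p.1) s
      = ∫ s in r..1, sl l (fun p => ed lp lm u p * p.1) s := by
    rw [intervalIntegral.integral_of_le hr1, intervalIntegral.integral_of_le hr1]
    refine setIntegral_congr_fun measurableSet_Ioc fun s hs => ?_
    unfold sl
    congr 1; ext θ
    unfold ed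
    show (gradSq W (s, θ) + ar lp lm (W s θ)) * s = (gradSq u (s, θ) + ar lp lm (u s θ)) * s
    rw [gradSq_congr (isOpen_Ioi (a := r)) (fun s hs θ => W2 s hs.le θ) (s, θ) hs.1, W2 s hs.1.le]
  rw [this, mul_one]
  field_simp; ring

theorem Mn.sc {l lp lm : ℝ} (hl : 0 ≤ l) {u : ℝ → ℝ → ℝ} (h : Mn l lp lm u) {r : ℝ} (hr : 0 < r)
    (hr1 : r ≤ 1) : Mn l lp lm (sc r u) := by
  refine ⟨h.gl.sc hr, fun w hw hb => ?_⟩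
  obtain ⟨W, hW, hW1, hE⟩ := glue (lp := lp) (lm := lm) hl h.gl hw.clamp hr hr1 (by
    intro s hs θ
    have : cl s = 1 := by unfold cl; rw [min_eq_right hs]; simp
    rw [this, hb]; simp [_root_.sc])
  have h1 := h.le W hW.toRL hW1
  rw [En_sc hl h.gl hr hr1 zero_le_one le_rfl, mul_one]
  have h2 : En l lp lm (fun s θ => w (cl s) θ) 1 = En l lp lm w 1 := by
    apply En_congr
    intro s hs θ
    rw [cl_of_mem ⟨hs.1.le, hs.2.le⟩]
  rw [h2] at hE
  rw [div_le_iff₀ (by positivity)]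
  linarith

/-! ### One dimensional tools -/

theorem ac_ftc {F F' : ℝ → ℝ} {a b : ℝ} (hF : AbsolutelyContinuousOnInterval F a b)
    (h : ∀ᵐ x, x ∈ uIoc a b → HasDerivAt F (F' x) x) : ∫ x in a..b, F' x = F b - F a := by
  rw [← hF.integral_deriv_eq_sub]
  apply intervalIntegral.integral_congr_ae
  filter_upwards [h] with x hx hx'
  exact (hx hx').deriv.symm

theorem ac_lip {F : ℝ → ℝ} {K : ℝ} (hK : 0 ≤ K) (h : ∀ x y, |F x - F y| ≤ K * |x - y|) (a b : ℝ) :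
    AbsolutelyContinuousOnInterval F a b := by
  have hL : LipschitzWith K.toNNReal F := LipschitzWith.of_dist_le_mul fun x y => by
    simpa [Real.dist_eq, Real.coe_toNNReal _ hK] using h x y
  exact (hL.lipschitzOnWith (s := uIcc a b)).absolutelyContinuousOnInterval

theorem ae_diff_lip {F : ℝ → ℝ} {K : ℝ} (hK : 0 ≤ K) (h : ∀ x y, |F x - F y| ≤ K * |x - y|) :
    ∀ᵐ x, DifferentiableAt ℝ F x := by
  have hL : LipschitzWith K.toNNReal F := LipschitzWith.of_dist_le_mul fun x y => by
    simpa [Real.dist_eq, Real.coe_toNNReal _ hK] using h x y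
  exact hL.ae_differentiableAt_real

theorem ac_C1 {F F' : ℝ → ℝ} {a b : ℝ} (h : ∀ x ∈ uIcc a b, HasDerivAt F (F' x) x)
    (hc : ContinuousOn F' (uIcc a b)) : AbsolutelyContinuousOnInterval F a b := by
  obtain ⟨C, hC⟩ := isCompact_uIcc.exists_bound_of_continuousOn hc
  have : LipschitzOnWith C.toNNReal F (uIcc a b) := by
    apply Convex.lipschitzOnWith_of_nnnorm_hasDerivWithin_le (convex_uIcc a b)
      (fun x hx => (h x hx).hasDerivWithinAt)
    intro x hx
    rw [← NNReal.coe_le_coe, coe_nnnorm]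
    exact (hC x hx).trans (Real.le_coe_toNNReal C)
  exact this.absolutelyContinuousOnInterval

/-- Integration by parts with an indefinite integral. -/
theorem ibp {p φ φ' : ℝ → ℝ} {s t : ℝ} (P0 : ℝ) (hs : 0 ≤ s) (hst : s ≤ t)
    (hp : IntervalIntegrable p volume 0 t)
    (h : ∀ x ∈ Icc s t, HasDerivAt φ (φ' x) x) (hc : ContinuousOn φ' (Icc s t)) :
    (P0 + ∫ x in (0:ℝ)..t, p x) * φ t - (P0 + ∫ x in (0:ℝ)..s, p x) * φ s
      = ∫ x in s..t, (p x * φ x + (P0 + ∫ y in (0:ℝ)..x, p y) * φ' x) := by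
  have hsub : uIcc s t ⊆ uIcc 0 t := by
    rw [uIcc_of_le hst, uIcc_of_le (hs.trans hst)]; exact Icc_subset_Icc_left hs
  have a1 : AbsolutelyContinuousOnInterval (fun x => P0 + ∫ y in (0:ℝ)..x, p y) s t := by
    have h0 := (hp.absolutelyContinuousOnInterval_intervalIntegral (c := 0) (by simp)).mono hsub
    have h1 : AbsolutelyContinuousOnInterval (fun _ : ℝ => P0) s t :=
      ac_lip le_rfl (by simp) s t
    exact h1.add h0
  have a2 : AbsolutelyContinuousOnInterval φ s t := by
    apply ac_C1 (F' := φ') <;> rwa [uIcc_of_le hst]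
  symm
  have := ac_ftc (F := fun x => (P0 + ∫ y in (0:ℝ)..x, p y) * φ x)
    (F' := fun x => p x * φ x + (P0 + ∫ y in (0:ℝ)..x, p y) * φ' x) (a1.fun_mul a2) (by
      filter_upwards [hp.ae_hasDerivAt_integral] with x hx hx'
      have hx2 : x ∈ uIcc s t := uIoc_subset_uIcc hx'
      have d1 := (hx (hsub hx2) 0 (by simp)).const_add P0
      exact d1.mul (h x (by rwa [uIcc_of_le hst] at hx2)))
  exact this

theorem cs_int {f : ℝ → ℝ} {a b : ℝ} (hab : a ≤ b) (hf : IntervalIntegrable f volume a b)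
    (hf2 : IntervalIntegrable (fun x => f x ^ 2) volume a b) :
    (∫ x in a..b, f x) ^ 2 ≤ (b - a) * ∫ x in a..b, f x ^ 2 := by
  rcases hab.eq_or_lt with rfl | hlt
  · simp
  have hb : 0 < b - a := sub_pos.2 hlt
  set m := (∫ x in a..b, f x) / (b - a) with hm
  have h0 : 0 ≤ ∫ x in a..b, (f x ^ 2 - 2 * m * f x + m ^ 2) :=
    intervalIntegral.integral_nonneg hab fun x _ => by nlinarith [sq_nonneg (f x - m)]
  rw [intervalIntegral.integral_add (hf2.sub (hf.const_mul _)) (by simp),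
    intervalIntegral.integral_sub hf2 (hf.const_mul _), intervalIntegral.integral_const_mul] at h0
  simp only [intervalIntegral.integral_const, smul_eq_mul] at h0
  have e : ∫ x in a..b, f x = m * (b - a) := by rw [hm]; field_simp
  rw [e] at h0 ⊢
  nlinarith

theorem exists_le_of_int {f : ℝ → ℝ} {a b M : ℝ} (hab : a < b) (hf : IntervalIntegrable f volume a b)
    (h : ∫ x in a..b, f x ≤ M * (b - a)) : ∃ x ∈ Ioo a b, f x ≤ M := by
  by_contra! hcon
  have : 0 < ∫ x in a..b, (f x - M) := by
    apply intervalIntegral.intervalIntegral_pos_of_pos_on (hf.sub (by simp))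
    · intro x hx; linarith [hcon x hx]
    · exact hab
  rw [intervalIntegral.integral_sub hf (by simp)] at this
  simp only [intervalIntegral.integral_const, smul_eq_mul] at this
  linarith

/-! ### Closure properties of `GLp` -/

namespace GLp
variable {l : ℝ} {u v : ℝ → ℝ → ℝ}

theorem const (c : ℝ) : GLp l (fun _ _ => c) :=
  ⟨fun _ _ => rfl, 0, le_rfl, by simp, by simp⟩

theorem add (hu : GLp l u) (hv : GLp l v) : GLp l (fun s θ => u s θ + v s θ) := by
  obtain ⟨K, hK, h1, h2⟩ := hu.lip
  obtain ⟨K', hK', h1', h2'⟩ := hv.lip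
  refine ⟨fun s θ => by rw [hu.per, hv.per], K + K', by positivity, fun θ s s' => ?_, fun s θ θ' => ?_⟩
  · rw [add_sub_add_comm]
    refine (abs_add_le _ _).trans ?_
    linarith [h1 θ s s', h1' θ s s']
  · rw [add_sub_add_comm]
    refine (abs_add_le _ _).trans ?_
    linarith [h2 s θ θ', h2' s θ θ']

theorem cmul (c : ℝ) (hu : GLp l u) : GLp l (fun s θ => c * u s θ) := by
  obtain ⟨K, hK, h1, h2⟩ := hu.lip
  refine ⟨fun s θ => by rw [hu.per], |c| * K, by positivity, fun θ s s' => ?_, fun s θ θ' => ?_⟩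
  · rw [← mul_sub, abs_mul, mul_assoc]; gcongr; exact h1 θ s s'
  · rw [← mul_sub, abs_mul, mul_assoc, mul_assoc]; gcongr; rw [← mul_assoc]; exact h2 s θ θ'

theorem sub (hu : GLp l u) (hv : GLp l v) : GLp l (fun s θ => u s θ - v s θ) := by
  simpa [sub_eq_add_neg] using hu.add hv.neg

theorem max (hu : GLp l u) (hv : GLp l v) : GLp l (fun s θ => Max.max (u s θ) (v s θ)) := by
  obtain ⟨K, hK, h1, h2⟩ := hu.lip
  obtain ⟨K', hK', h1', h2'⟩ := hv.lip
  refine ⟨fun s θ => by rw [hu.per, hv.per], K + K', by positivity, fun θ s s' => ?_, fun s θ θ' => ?_⟩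
  · refine (abs_max_sub_max_le_max _ _ _ _).trans (max_le ?_ ?_)
    · nlinarith [h1 θ s s', abs_nonneg (s - s')]
    · nlinarith [h1' θ s s', abs_nonneg (s - s')]
  · refine (abs_max_sub_max_le_max _ _ _ _).trans (max_le ?_ ?_)
    · refine (h2 s θ θ').trans ?_
      gcongr; linarith
    · refine (h2' s θ θ').trans ?_
      gcongr; linarith

theorem min (hu : GLp l u) (hv : GLp l v) : GLp l (fun s θ => Min.min (u s θ) (v s θ)) := by
  have := (hu.neg.max hv.neg).neg
  simpa [max_neg_neg] using this

end GLp

/-! ### Pointwise gradients -/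

theorem ev_slice1 {P : ℝ × ℝ → Prop} {p : ℝ × ℝ} (h : ∀ᶠ q in nhds p, P q) :
    ∀ᶠ s in nhds p.1, P (s, p.2) := by
  have : Filter.Tendsto (fun s : ℝ => (s, p.2)) (nhds p.1) (nhds p) :=
    (by fun_prop : Continuous fun s : ℝ => (s, p.2)).tendsto p.1
  exact this.eventually h

theorem ev_slice2 {P : ℝ × ℝ → Prop} {p : ℝ × ℝ} (h : ∀ᶠ q in nhds p, P q) :
    ∀ᶠ s in nhds p.2, P (p.1, s) := by
  have : Filter.Tendsto (fun s : ℝ => (p.1, s)) (nhds p.2) (nhds p) :=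
    (by fun_prop : Continuous fun s : ℝ => (p.1, s)).tendsto p.2
  exact this.eventually h

theorem gradSq_local {u w : ℝ → ℝ → ℝ} {p : ℝ × ℝ} (h : ∀ᶠ q in nhds p, u q.1 q.2 = w q.1 q.2) :
    gradSq u p = gradSq w p := by
  unfold gradSq
  have e1 : (fun s => u s p.2) =ᶠ[nhds p.1] fun s => w s p.2 := ev_slice1 h
  have e2 : (fun φ => u p.1 φ) =ᶠ[nhds p.2] fun φ => w p.1 φ := ev_slice2 h
  rw [e1.deriv_eq, e2.deriv_eq]

theorem gradSq_min {w : ℝ → ℝ → ℝ} {p : ℝ × ℝ} (h : ∀ᶠ q in nhds p, w p.1 p.2 ≤ w q.1 q.2) :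
    gradSq w p = 0 := by
  unfold gradSq
  have e1 : IsLocalMin (fun s => w s p.2) p.1 := ev_slice1 h
  have e2 : IsLocalMin (fun φ => w p.1 φ) p.2 := ev_slice2 h
  rw [e1.deriv_eq_zero, e2.deriv_eq_zero]; simp

theorem gradSq_max {w : ℝ → ℝ → ℝ} {p : ℝ × ℝ} (h : ∀ᶠ q in nhds p, w q.1 q.2 ≤ w p.1 p.2) :
    gradSq w p = 0 := by
  rw [← gradSq_neg]
  apply gradSq_min
  filter_upwards [h] with q hq using neg_le_neg hq

theorem GLp.ev_lt {l : ℝ} {u v : ℝ → ℝ → ℝ} (hu : GLp l u) (hv : GLp l v) {p : ℝ × ℝ}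
    (h : u p.1 p.2 < v p.1 p.2) : ∀ᶠ q in nhds p, u q.1 q.2 < v q.1 q.2 :=
  (hu.cont.tendsto p).eventually_lt (hv.cont.tendsto p) h

/-! ### Radial Fubini -/

theorem I2_nonneg_radial {F : ℝ × ℝ → ℝ} (hF : BM F) {l R : ℝ} (hR0 : 0 ≤ R) (hR : R ≤ 1)
    (h : ∀ θ, 0 ≤ ∫ s in (0:ℝ)..R, F (s, θ)) : 0 ≤ I2 l F R := by
  unfold I2
  have hi := hF.int (l := l) hR
  unfold Q at *
  rw [Measure.volume_eq_prod] at *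
  rw [← setIntegral_prod_swap, setIntegral_prod]
  · apply integral_nonneg
    intro θ
    have := h θ
    rw [intervalIntegral.integral_of_le hR0, integral_Ioc_eq_integral_Ioo] at this
    exact this
  · exact hi.swap

theorem poincare_rad {l : ℝ} {f : ℝ → ℝ → ℝ} (hf : GLp l f) (h1 : ∀ θ, f 1 θ = 0) :
    I2 l (fun p => f p.1 p.2 ^ 2 * p.1) 1 ≤ I2 l (fun p => dr f p ^ 2 * p.1) 1 := by
  have b1 := hf.bm_u.pow2.mul BM.fst
  have b2 := hf.bm_dr.pow2.mul BM.fst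
  have : 0 ≤ I2 l (fun p => dr f p ^ 2 * p.1 - f p.1 p.2 ^ 2 * p.1) 1 := by
    refine I2_nonneg_radial (b2.sub b1) zero_le_one le_rfl fun θ => ?_
    obtain ⟨K, hK, hl1, hl2⟩ := hf.lip
    have acf := ac_lip hK (hl1 θ) 0 1
    have aci : AbsolutelyContinuousOnInterval (fun s : ℝ => s) 0 1 :=
      ac_lip (K := 1) zero_le_one (by simp) 0 1
    have := ac_ftc (F := fun s => (s * f s θ) * (s * f s θ))
      (F' := fun s => 2 * (s * f s θ) * (f s θ + s * dr f (s, θ))) (a := 0) (b := 1)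
      ((aci.fun_mul acf).fun_mul (aci.fun_mul acf)) (by
        filter_upwards [ae_diff_lip hK (hl1 θ)] with s hs _
        have := ((hasDerivAt_id s).mul hs.hasDerivAt).mul ((hasDerivAt_id s).mul hs.hasDerivAt)
        refine this.congr_deriv ?_
        simp [dr]; ring)
    simp only [h1] at this
    have e0 : (∫ s in (0:ℝ)..1, 2 * (s * f s θ) * (f s θ + s * dr f (s, θ))) = 0 := by
      rw [this]; simp
    have mf : Measurable fun s => f s θ := (hf.cont_s θ).measurable
    have md : Measurable fun s => dr f (s, θ) := hf.dr_meas.comp measurable_prodMk_right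
    obtain ⟨C, hC, hCu⟩ := hf.bm_u.bdd
    obtain ⟨D, hD, hDu⟩ := hf.bm_dr.bdd
    have ii : ∀ F : ℝ → ℝ, Measurable F → (∃ E, ∀ s ∈ Icc (0:ℝ) 1, |F s| ≤ E) →
        IntervalIntegrable F volume 0 1 := by
      rintro F hF ⟨E, hE⟩
      rw [intervalIntegrable_iff]
      refine Measure.integrableOn_of_bounded (M := E) (by simp) hF.aestronglyMeasurable ?_
      refine (ae_restrict_iff' measurableSet_uIoc).2 (Filter.Eventually.of_forall fun s hs => ?_)
      have := uIoc_subset_uIcc hs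
      rw [uIcc_of_le zero_le_one] at this
      exact hE s this
    rw [← e0]
    have hs1 : ∀ s ∈ Icc (0:ℝ) 1, |s| ≤ 1 := fun s hs => abs_le.2 ⟨by linarith [hs.1], hs.2⟩
    have i1 : IntervalIntegrable (fun s => 2 * (s * f s θ) * (f s θ + s * dr f (s, θ))) volume 0 1 := by
      apply ii _ (by fun_prop)
      refine ⟨2 * (1 * C) * (C + 1 * D), fun s hs => ?_⟩
      rw [abs_mul, abs_mul, abs_mul, abs_two]
      have := hs1 s hs
      have a := hCu s hs θ
      have b := hDu s hs θ
      have c : |f s θ + s * dr f (s, θ)| ≤ C + 1 * D := by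
        refine (abs_add_le _ _).trans (add_le_add a ?_)
        rw [abs_mul]; gcongr
      simp only at a
      gcongr
    have i2 : IntervalIntegrable (fun s => dr f (s, θ) ^ 2 * s - f s θ ^ 2 * s) volume 0 1 := by
      apply ii _ (by fun_prop)
      refine ⟨D ^ 2 * 1 + C ^ 2 * 1, fun s hs => ?_⟩
      refine (abs_sub _ _).trans ?_
      rw [abs_mul, abs_mul, abs_pow, abs_pow]
      have := hs1 s hs
      have a := hCu s hs θ
      have b := hDu s hs θ
      simp only at a
      gcongr
    have := intervalIntegral.integral_mono_on zero_le_one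
      (i1.neg) i2 (μ := volume) ?_
    · rw [show (-fun s => 2 * (s * f s θ) * (f s θ + s * dr f (s, θ))) =
        fun s => -(2 * (s * f s θ) * (f s θ + s * dr f (s, θ))) from rfl,
        intervalIntegral.integral_neg, e0] at this
      rw [e0]; linarith
    · intro s hs
      simp only [Pi.neg_apply]
      have hs0 := hs.1
      have k1 : 0 ≤ s * (f s θ + s * dr f (s, θ)) ^ 2 := by positivity
      have k2 : 0 ≤ s * (dr f (s, θ)) ^ 2 * (1 - s ^ 2) := by
        apply mul_nonneg (by positivity); nlinarith [hs.2]
      nlinarith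
  rw [I2_sub b2 b1 le_rfl] at this
  linarith

theorem zero_of_I2 {l : ℝ} (hl : 0 < l) {w : ℝ → ℝ → ℝ} (hw : GLp l w) {R : ℝ} (hR0 : 0 < R) (hR : R ≤ 1)
    (h : I2 l (fun p => w p.1 p.2 ^ 2 * p.1) R ≤ 0) : ∀ s ∈ Icc 0 R, ∀ θ, w s θ = 0 := by
  have hb := hw.bm_u.pow2.mul BM.fst
  have h0 : ∀ᵐ p ∂(volume.restrict (Q l R)), 0 ≤ w p.1 p.2 ^ 2 * p.1 :=
    (ae_restrict_iff' (Q_meas l R)).2 (Filter.Eventually.of_forall fun p hp =>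
      mul_nonneg (sq_nonneg _) hp.1.1.le)
  have h1 : I2 l (fun p => w p.1 p.2 ^ 2 * p.1) R = 0 := le_antisymm h (integral_nonneg_of_ae h0)
  have h2 := (integral_eq_zero_iff_of_nonneg_ae h0 (hb.int hR)).1 h1
  have hc := hw.cont
  have hc' : Continuous fun p : ℝ × ℝ => w p.1 p.2 ^ 2 * p.1 := by
    have : Continuous fun p : ℝ × ℝ => w p.1 p.2 := hc
    fun_prop
  have ho : IsOpen (Q l R) := isOpen_Ioo.prod isOpen_Ioo
  have h3 : EqOn (fun p : ℝ × ℝ => w p.1 p.2 ^ 2 * p.1) 0 (Q l R) :=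
    Measure.eqOn_open_of_ae_eq h2 ho hc'.continuousOn continuousOn_const
  have h4 : EqOn (Function.uncurry w) 0 (Q l R) := by
    intro p hp
    have := h3 hp
    simp only [Pi.zero_apply] at this
    have hp1 : 0 < p.1 := hp.1.1
    have : w p.1 p.2 ^ 2 = 0 := by
      rcases mul_eq_zero.1 this with h | h
      · exact h
      · exact absurd h hp1.ne'
    exact pow_eq_zero_iff (two_ne_zero) |>.1 this
  have h5 := h4.closure hc continuous_zero
  intro s hs θ
  have hcl : closure (Q l R) = Icc 0 R ×ˢ Icc 0 l := by
    unfold Q; rw [closure_prod_eq, closure_Ioo hR0.ne, closure_Ioo hl.ne]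
  rw [hcl] at h5
  have hθ := toIcoMod_mem_Ico hl 0 θ
  rw [zero_add] at hθ
  have h6 : w s (toIcoMod hl 0 θ) = 0 := h5 (x := (s, toIcoMod hl 0 θ)) (mk_mem_prod hs ⟨hθ.1, hθ.2.le⟩)
  have h7 := per_int (hw.per s) (toIcoDiv hl 0 θ) (toIcoMod hl 0 θ)
  have h8 := toIcoMod_add_toIcoDiv_zsmul hl 0 θ
  rw [zsmul_eq_mul] at h8
  rw [h8] at h7
  rw [h7, h6]

/-- Minimum principle. -/
theorem Mn.min_principle {l lp lm : ℝ} (hl : 0 < l) (hp : 0 ≤ lp) (hm : 0 ≤ lm) {u : ℝ → ℝ → ℝ}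
    (h : Mn l lp lm u) {c κ : ℝ} (hκ : κ < 1) (hc : ∀ θ, c ≤ u 1 θ)
    (hk : ∀ x < c, ar lp lm c - ar lp lm x ≤ κ * (c - x) ^ 2) :
    ∀ s ∈ Icc (0:ℝ) 1, ∀ θ, c ≤ u s θ := by
  have hw : GLp l (fun s θ => max (u s θ) c) := h.gl.max (GLp.const c)
  have hf : GLp l (fun s θ => max (c - u s θ) 0) := ((GLp.const c).sub h.gl).max (GLp.const 0)
  set f : ℝ → ℝ → ℝ := fun s θ => max (c - u s θ) 0 with hfdef
  have hE := h.le _ hw.toRL (fun θ => by simp [hc θ])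
  have bu := (h.gl.bm_ed lp lm).mul BM.fst
  have bg := hf.bm_grad.mul BM.fst
  have bf := hf.bm_u.pow2.mul BM.fst
  have hE2 := En_le hp hm (l := l) (R := 1) (w := fun s θ => max (u s θ) c) le_rfl
    ((bu.sub bg).add (bf.cmul κ)) (by
      refine Filter.Eventually.of_forall fun p hpQ => ?_
      have hp1 : 0 < p.1 := hpQ.1.1
      suffices hs : ed lp lm (fun s θ => max (u s θ) c) p ≤ ed lp lm u p - gradSq f p
          + κ * f p.1 p.2 ^ 2 by nlinarith
      unfold ed
      rcases lt_trichotomy (u p.1 p.2) c with hlt | heq | hgt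
      · have ev := h.gl.ev_lt (GLp.const c) hlt
        have e1 : gradSq (fun s θ => max (u s θ) c) p = 0 := by
          apply gradSq_min
          filter_upwards with q
          rw [max_eq_right hlt.le]; exact le_max_right _ _
        have e2 : gradSq f p = gradSq u p := by
          rw [← gradSq_neg u]
          have : gradSq f p = gradSq (fun s θ => c + -u s θ) p := by
            apply gradSq_local
            filter_upwards [ev] with q hq
            simp only [hfdef]
            rw [max_eq_left (by linarith)]; ring
          rw [this]; unfold gradSq
          simp only [deriv_const_add]
        have e3 : f p.1 p.2 = c - u p.1 p.2 := by
          simp only [hfdef]; rw [max_eq_left (by linarith)]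
        rw [e1, e2, e3]
        simp only [max_eq_right hlt.le]
        linarith [hk _ hlt]
      · have e1 : gradSq (fun s θ => max (u s θ) c) p = 0 := by
          apply gradSq_min
          filter_upwards with q
          rw [max_eq_right heq.le]; exact le_max_right _ _
        have e2 : gradSq f p = 0 := by
          apply gradSq_min
          filter_upwards with q
          simp only [hfdef]
          rw [heq]; simp
        have e3 : f p.1 p.2 = 0 := by simp [hfdef, heq]
        rw [e1, e2, e3]
        simp only [heq, max_self]
        linarith [gradSq_nonneg u p]
      · have ev := (GLp.const (l := l) c).ev_lt h.gl hgt
        have e1 : gradSq (fun s θ => max (u s θ) c) p = gradSq u p := by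
          apply gradSq_local
          filter_upwards [ev] with q hq
          rw [max_eq_left hq.le]
        have e3 : f p.1 p.2 = 0 := by
          simp only [hfdef]; rw [max_eq_right (by linarith)]
        have e2 : gradSq f p = 0 := by
          apply gradSq_min
          filter_upwards with q
          rw [e3]; exact le_max_right _ _
        rw [e1, e2, e3]
        simp only [max_eq_left hgt.le]
        linarith)
  rw [I2_add (bu.sub bg) (bf.cmul κ) le_rfl, I2_sub bu bg le_rfl, I2_cmul] at hE2
  rw [← En_I2] at hE2
  have hf1 : ∀ θ, f 1 θ = 0 := fun θ => by simp only [hfdef]; rw [max_eq_right (by linarith [hc θ])]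
  have hP := poincare_rad hf hf1
  have hG : I2 l (fun p => dr f p ^ 2 * p.1) 1 ≤ I2 l (fun p => gradSq f p * p.1) 1 := by
    refine I2_mono (hf.bm_dr.pow2.mul BM.fst) bg le_rfl fun p hpQ => ?_
    have hp1 : 0 < p.1 := hpQ.1.1
    rw [gradSq_eq]; nlinarith [sq_nonneg (tn f p)]
  have hz := zero_of_I2 hl hf zero_lt_one le_rfl (by nlinarith)
  intro s hs θ
  have := hz s hs θ
  simp only [hfdef] at this
  have h2 := le_max_left (c - u s θ) 0
  linarith

/-! ### Traces -/

/-- Periodic Lipschitz functions on the circle. -/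
structure Tr (l : ℝ) (g : ℝ → ℝ) : Prop where
  per : ∀ θ, g (θ + l) = g θ
  lip : ∃ K : ℝ, 0 ≤ K ∧ ∀ x y, |g x - g y| ≤ K * |x - y|

theorem GLp.tr {l : ℝ} {u : ℝ → ℝ → ℝ} (h : GLp l u) (s : ℝ) : Tr l (u s) := by
  obtain ⟨K, hK, h1, h2⟩ := h.lip
  exact ⟨h.per s, K * |s|, by positivity, h2 s⟩

namespace Tr
variable {l : ℝ} {g : ℝ → ℝ}

theorem cont (h : Tr l g) : Continuous g := by
  obtain ⟨K, hK, h1⟩ := h.lip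
  have hL : LipschitzWith K.toNNReal g := LipschitzWith.of_dist_le_mul fun x y => by
    simpa [Real.dist_eq, Real.coe_toNNReal _ hK] using h1 x y
  exact hL.continuous

theorem ac (h : Tr l g) (a b : ℝ) : AbsolutelyContinuousOnInterval g a b := by
  obtain ⟨K, hK, h1⟩ := h.lip
  exact ac_lip hK h1 a b

theorem ae_diff (h : Tr l g) : ∀ᵐ x, DifferentiableAt ℝ g x := by
  obtain ⟨K, hK, h1⟩ := h.lip
  exact ae_diff_lip hK h1

theorem dbdd (h : Tr l g) : ∃ K : ℝ, 0 ≤ K ∧ ∀ x, |deriv g x| ≤ K := by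
  obtain ⟨K, hK, h1⟩ := h.lip
  exact ⟨K, hK, abs_deriv_le hK h1⟩

theorem bdd (h : Tr l g) (hl : 0 < l) : ∃ C : ℝ, 0 ≤ C ∧ ∀ x, |g x| ≤ C := by
  obtain ⟨C, hC⟩ := (isCompact_Icc (a := 0) (b := l)).exists_bound_of_continuousOn h.cont.continuousOn
  refine ⟨|C|, abs_nonneg _, fun x => ?_⟩
  have hθ := toIcoMod_mem_Ico hl 0 x
  rw [zero_add] at hθ
  have h7 := per_int h.per (toIcoDiv hl 0 x) (toIcoMod hl 0 x)
  have h8 := toIcoMod_add_toIcoDiv_zsmul hl 0 x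
  rw [zsmul_eq_mul] at h8
  rw [h8] at h7
  rw [h7]
  exact (hC _ ⟨hθ.1, hθ.2.le⟩).trans (le_abs_self _)

theorem dper (h : Tr l g) (x : ℝ) : deriv g (x + l) = deriv g x := by
  rw [← deriv_comp_add_const g l x]
  congr 1; ext y; exact h.per y

theorem ii (F : ℝ → ℝ) (hF : Measurable F) (C : ℝ) (h : ∀ x, |F x| ≤ C) (a b : ℝ) :
    IntervalIntegrable F volume a b := by
  rw [intervalIntegrable_iff]
  exact Measure.integrableOn_of_bounded (M := C) (by simp) hF.aestronglyMeasurable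
    (Filter.Eventually.of_forall h)

theorem int_d (h : Tr l g) (a b : ℝ) : IntervalIntegrable (deriv g) volume a b := by
  obtain ⟨K, hK, h1⟩ := h.dbdd
  exact ii _ (measurable_deriv g) K h1 a b

theorem int_d2 (h : Tr l g) (a b : ℝ) : IntervalIntegrable (fun x => deriv g x ^ 2) volume a b := by
  obtain ⟨K, hK, h1⟩ := h.dbdd
  refine ii _ ((measurable_deriv g).pow_const 2) (K ^ 2) (fun x => ?_) a b
  rw [abs_pow]; gcongr; exact h1 x

theorem bm (h : Tr l g) (hl : 0 < l) : BM (fun p => g p.2) := by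
  obtain ⟨C, hC, h1⟩ := h.bdd hl
  exact BM.of_snd h.cont.measurable C h1

theorem bmd (h : Tr l g) : BM (fun p => deriv g p.2) := by
  obtain ⟨C, hC, h1⟩ := h.dbdd
  exact BM.of_snd (measurable_deriv g) C h1

theorem osc (h : Tr l g) {a b : ℝ} (hab : a ≤ b) :
    (g b - g a) ^ 2 ≤ (b - a) * ∫ x in a..b, deriv g x ^ 2 := by
  rw [← (h.ac a b).integral_deriv_eq_sub]
  exact cs_int hab (h.int_d a b) (h.int_d2 a b)

/-- Oscillation over the circle. -/
theorem osc_all (h : Tr l g) (hl : 0 < l) (x y : ℝ) :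
    (g x - g y) ^ 2 ≤ l * ∫ θ in (0:ℝ)..l, deriv g θ ^ 2 := by
  have hx := toIcoMod_mem_Ico hl y x
  have h7 := per_int h.per (toIcoDiv hl y x) (toIcoMod hl y x)
  have h8 := toIcoMod_add_toIcoDiv_zsmul hl y x
  rw [zsmul_eq_mul] at h8
  rw [h8] at h7
  rw [h7]
  set z := toIcoMod hl y x
  have h1 := h.osc hx.1
  have hp : Function.Periodic (fun x => deriv g x ^ 2) l := fun x => by simp only [h.dper]
  have h2 : ∫ θ in (0:ℝ)..l, deriv g θ ^ 2 = ∫ θ in y..(y + l), deriv g θ ^ 2 := by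
    rw [hp.intervalIntegral_add_eq y 0, zero_add]
  have h3 : ∫ θ in y..z, deriv g θ ^ 2 ≤ ∫ θ in y..(y + l), deriv g θ ^ 2 :=
    intervalIntegral.integral_mono_interval le_rfl hx.1 hx.2.le
      (Filter.Eventually.of_forall fun _ => sq_nonneg _) (h.int_d2 _ _)
  have h4 : 0 ≤ ∫ θ in y..z, deriv g θ ^ 2 :=
    intervalIntegral.integral_nonneg hx.1 fun _ _ => sq_nonneg _
  rw [h2]
  refine h1.trans ?_
  have : z - y ≤ l := by linarith [hx.2]
  calc (z - y) * ∫ θ in y..z, deriv g θ ^ 2 ≤ l * ∫ θ in y..z, deriv g θ ^ 2 := by gcongr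
    _ ≤ _ := by gcongr

end Tr

theorem wirt_half {l : ℝ} {g : ℝ → ℝ} (hg : Tr l g) {a L k c : ℝ} (hL : 0 ≤ L) (hk : 0 < k)
    (hkL : k * L < Real.pi) (ha : g a = c) (hb : g (a + L) = c) :
    k ^ 2 * ∫ x in a..(a + L), (g x - c) ^ 2 ≤ ∫ x in a..(a + L), deriv g x ^ 2 := by
  set φ : ℝ := (Real.pi - k * L) / 2 with hφ
  let ψ : ℝ → ℝ := fun x => k * (x - a) + φ
  let T : ℝ → ℝ := fun x => k * (Real.cos (ψ x) / Real.sin (ψ x))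
  have hψ : ∀ x ∈ uIcc a (a + L), 0 < Real.sin (ψ x) := by
    intro x hx
    rw [uIcc_of_le (by linarith)] at hx
    have h1 : 0 ≤ k * (x - a) := mul_nonneg hk.le (by linarith [hx.1])
    have h2 : k * (x - a) ≤ k * L := mul_le_mul_of_nonneg_left (by linarith [hx.2]) hk.le
    apply Real.sin_pos_of_pos_of_lt_pi
    · simp only [ψ, hφ]; linarith
    · simp only [ψ, hφ]; linarith
  have dψ : ∀ x, HasDerivAt ψ k x := fun x => by
    have := (((hasDerivAt_id x).sub_const a).const_mul k).add_const φ
    exact this.congr_deriv (by simp)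
  have dT : ∀ x ∈ uIcc a (a + L), HasDerivAt T (-k ^ 2 - T x ^ 2) x := by
    intro x hx
    have hs := (hψ x hx).ne'
    have := (((dψ x).cos).div ((dψ x).sin) hs).const_mul k
    refine this.congr_deriv ?_
    simp only [T]
    field_simp
  have cT : ContinuousOn T (uIcc a (a + L)) := fun x hx => (dT x hx).continuousAt.continuousWithinAt
  have acT : AbsolutelyContinuousOnInterval T a (a + L) :=
    ac_C1 dT (continuousOn_const.sub (cT.pow 2))
  have acf : AbsolutelyContinuousOnInterval (fun x => g x - c) a (a + L) := by
    obtain ⟨K, hK, h1⟩ := hg.lip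
    exact ac_lip hK (fun x y => by simpa using h1 x y) _ _
  have key := ac_ftc (F := fun x => T x * ((g x - c) * (g x - c)))
    (F' := fun x => (-k ^ 2 - T x ^ 2) * ((g x - c) * (g x - c))
      + T x * (deriv g x * (g x - c) + (g x - c) * deriv g x))
    (acT.fun_mul (acf.fun_mul acf)) (by
      filter_upwards [hg.ae_diff] with x hx hx'
      have hd := hx.hasDerivAt.sub_const c
      exact (dT x (uIoc_subset_uIcc hx')).mul (hd.mul hd))
  rw [ha, hb] at key
  simp only [sub_self, mul_zero] at key
  have cg : Continuous fun x => (g x - c) ^ 2 := by have := hg.cont; fun_prop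
  have i1 : IntervalIntegrable (fun x => k ^ 2 * (g x - c) ^ 2) volume a (a + L) :=
    (cg.intervalIntegrable _ _).const_mul _
  have i2 := hg.int_d2 a (a + L)
  have i3 : IntervalIntegrable (fun x => (-k ^ 2 - T x ^ 2) * ((g x - c) * (g x - c))
      + T x * (deriv g x * (g x - c) + (g x - c) * deriv g x)) volume a (a + L) := by
    have cg' : ContinuousOn (fun x => g x - c) (uIcc a (a + L)) := (hg.cont.sub continuous_const).continuousOn
    have j1 : ContinuousOn (fun x => (-k ^ 2 - T x ^ 2) * ((g x - c) * (g x - c))) (uIcc a (a + L)) :=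
      (continuousOn_const.sub (cT.pow 2)).mul (cg'.mul cg')
    have j2 := (((hg.int_d a (a + L)).mul_continuousOn cg').add
      ((hg.int_d a (a + L)).continuousOn_mul cg')).continuousOn_mul cT
    exact j1.intervalIntegrable.add j2
  rw [← intervalIntegral.integral_const_mul]
  have hm := intervalIntegral.integral_mono_on (by linarith) (i1.add i3) i2 (by
    intro x hx
    nlinarith [sq_nonneg (deriv g x - T x * (g x - c))])
  rw [intervalIntegral.integral_add i1 i3, key] at hm
  linarith

/-- The mean of a trace. -/
def mean (l : ℝ) (g : ℝ → ℝ) : ℝ := (∫ θ in (0:ℝ)..l, g θ) / l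

theorem mean_sq {l : ℝ} (hl : 0 < l) {g : ℝ → ℝ} (hg : Continuous g) (c : ℝ) :
    ∫ θ in (0:ℝ)..l, (g θ - c) ^ 2 = (∫ θ in (0:ℝ)..l, g θ ^ 2) - 2 * c * (l * mean l g) + c ^ 2 * l := by
  have e : ∀ θ, (g θ - c) ^ 2 = g θ ^ 2 - (2 * c) * g θ + c ^ 2 := fun θ => by ring
  simp only [e]
  have i1 : IntervalIntegrable (fun θ => g θ ^ 2) volume 0 l := (hg.pow 2).intervalIntegrable _ _
  have i2 : IntervalIntegrable (fun θ => (2 * c) * g θ) volume 0 l := (continuous_const.mul hg).intervalIntegrable _ _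
  rw [intervalIntegral.integral_add (i1.sub i2) (by simp), intervalIntegral.integral_sub i1 i2,
    intervalIntegral.integral_const_mul]
  simp only [intervalIntegral.integral_const, smul_eq_mul, mean]
  field_simp; ring

theorem wirtinger {l : ℝ} (hl : 0 < l) {g : ℝ → ℝ} (hg : Tr l g) {α : ℝ} (hα : 0 < α)
    (hαl : α * l < 2 * Real.pi) :
    α ^ 2 * ∫ θ in (0:ℝ)..l, (g θ - mean l g) ^ 2 ≤ ∫ θ in (0:ℝ)..l, deriv g θ ^ 2 := by
  have hgc := hg.cont
  obtain ⟨a, -, ha⟩ : ∃ a ∈ Icc 0 (l / 2), g a = g (a + l / 2) := by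
    have hc : Continuous fun x => g x - g (x + l / 2) := by fun_prop
    have e : g (l / 2 + l / 2) = g 0 := by rw [add_halves, ← zero_add l, hg.per]
    rcases le_total (g 0 - g (0 + l / 2)) 0 with h | h
    · obtain ⟨a, ha, h0⟩ := intermediate_value_Icc (by positivity : (0:ℝ) ≤ l / 2) hc.continuousOn
        (show (0:ℝ) ∈ Icc _ _ from ⟨h, by simp only [e]; rw [zero_add] at h; linarith⟩)
      exact ⟨a, ha, sub_eq_zero.1 h0⟩
    · obtain ⟨a, ha, h0⟩ := intermediate_value_Icc' (by positivity : (0:ℝ) ≤ l / 2) hc.continuousOn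
        (show (0:ℝ) ∈ Icc _ _ from ⟨by simp only [e]; rw [zero_add] at h; linarith, h⟩)
      exact ⟨a, ha, sub_eq_zero.1 h0⟩
  set c := g a with hcdef
  have h1 := wirt_half hg (a := a) (L := l / 2) (c := c) (by positivity) hα (by linarith) rfl ha.symm
  have h2 := wirt_half hg (a := a + l / 2) (L := l / 2) (c := c) (by positivity) hα (by linarith) ha.symm
    (by rw [add_assoc, add_halves, hg.per])
  have cg : Continuous fun x => (g x - c) ^ 2 := by fun_prop
  have e1 := intervalIntegral.integral_add_adjacent_intervals (a := a) (b := a + l / 2) (c := a + l / 2 + l / 2)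
    (cg.intervalIntegrable (μ := volume) _ _) (cg.intervalIntegrable _ _)
  have e2 := intervalIntegral.integral_add_adjacent_intervals (hg.int_d2 a (a + l / 2))
    (hg.int_d2 (a + l / 2) (a + l / 2 + l / 2))
  have p1 : Function.Periodic (fun x => (g x - c) ^ 2) l := fun x => by simp only [hg.per]
  have p2 : Function.Periodic (fun x => deriv g x ^ 2) l := fun x => by simp only [hg.dper]
  rw [add_assoc, add_halves] at e1 e2 h2
  rw [p1.intervalIntegral_add_eq a 0, zero_add] at e1
  rw [p2.intervalIntegral_add_eq a 0, zero_add] at e2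
  have hm : ∫ θ in (0:ℝ)..l, (g θ - mean l g) ^ 2 ≤ ∫ θ in (0:ℝ)..l, (g θ - c) ^ 2 := by
    rw [mean_sq hl hgc, mean_sq hl hgc]
    nlinarith [sq_nonneg (c - mean l g)]
  have : α ^ 2 * ∫ θ in (0:ℝ)..l, (g θ - mean l g) ^ 2 ≤ α ^ 2 * ∫ θ in (0:ℝ)..l, (g θ - c) ^ 2 := by
    gcongr
  rw [← e1] at this
  rw [← e2]
  linarith

/-! ### Harmonic-type competitor -/

theorem rpow_lip {α : ℝ} (hα : 1 ≤ α) : ∀ s ∈ Icc (0:ℝ) 1, ∀ t ∈ Icc (0:ℝ) 1,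
    |s ^ α - t ^ α| ≤ α * |s - t| := by
  intro s hs t ht
  have := Convex.norm_image_sub_le_of_norm_hasDerivWithin_le (f := fun x : ℝ => x ^ α)
    (f' := fun x => α * x ^ (α - 1)) (C := α) (s := Icc (0:ℝ) 1)
    (fun x hx => (Real.hasDerivAt_rpow_const (Or.inr hα)).hasDerivWithinAt) (by
      intro x hx
      rw [Real.norm_eq_abs, abs_mul, abs_of_nonneg (by linarith : 0 ≤ α),
        abs_of_nonneg (Real.rpow_nonneg hx.1 _)]
      have := Real.rpow_le_one hx.1 hx.2 (by linarith : 0 ≤ α - 1)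
      nlinarith) (convex_Icc 0 1) ht hs
  simpa using this

theorem rpow_le_self' {α s : ℝ} (hα : 1 ≤ α) (hs : s ∈ Icc (0:ℝ) 1) : s ^ α ≤ s := by
  have := Real.rpow_le_rpow_of_exponent_ge' hs.1 hs.2 zero_le_one hα
  simpa using this

theorem I2_prod {l : ℝ} (hl : 0 ≤ l) (f h : ℝ → ℝ) {R : ℝ} (hR : 0 ≤ R) : I2 l (fun p => f p.1 * h p.2) R
    = (∫ s in (0:ℝ)..R, f s) * ∫ θ in (0:ℝ)..l, h θ := by
  unfold I2 Q
  rw [Measure.volume_eq_prod, setIntegral_prod_mul, intervalIntegral.integral_of_le hR,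
    intervalIntegral.integral_of_le hl, integral_Ioc_eq_integral_Ioo, integral_Ioc_eq_integral_Ioo]

theorem I2_fst {l : ℝ} (hl : 0 ≤ l) (f : ℝ → ℝ) {R : ℝ} (hR : 0 ≤ R) : I2 l (fun p => f p.1) R
    = l * (∫ s in (0:ℝ)..R, f s) := by
  have := I2_prod hl f (fun _ => 1) hR
  simp only [mul_one, intervalIntegral.integral_const, smul_eq_mul, sub_zero] at this
  rw [this]; ring

theorem Mn.harm {l lp lm : ℝ} (hl : 0 < l) (hp : 0 ≤ lp) (hm : 0 ≤ lm) {u : ℝ → ℝ → ℝ}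
    (h : Mn l lp lm u) {α : ℝ} (hα : 1 ≤ α) (m : ℝ) :
    En l lp lm u 1 ≤ (α / 2) * (∫ θ in (0:ℝ)..l, (u 1 θ - m) ^ 2)
      + (1 / (2 * α)) * (∫ θ in (0:ℝ)..l, deriv (u 1) θ ^ 2) + max lp lm * l / 2 := by
  have hg := h.gl.tr 1
  set g := u 1 with hgdef
  obtain ⟨K, hK, hgl⟩ := hg.lip
  obtain ⟨C, hC, hgb⟩ := hg.bdd hl
  have hα0 : 0 < α := by linarith
  let w : ℝ → ℝ → ℝ := fun s θ => m + s ^ α * (g θ - m)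
  have hw : RL l w := by
    refine ⟨fun r θ => by simp only [w, hg.per], α * (C + |m|) + K, by positivity, ?_, ?_⟩
    · intro θ s hs s' hs'
      have e : w s θ - w s' θ = (s ^ α - s' ^ α) * (g θ - m) := by simp only [w]; ring
      rw [e, abs_mul]
      have a1 := rpow_lip hα s hs s' hs'
      have a2 : |g θ - m| ≤ C + |m| := (abs_sub _ _).trans (by linarith [hgb θ])
      calc _ ≤ (α * |s - s'|) * (C + |m|) := by gcongr
        _ = α * (C + |m|) * |s - s'| := by ring
        _ ≤ _ := by gcongr; linarith
    · intro s hs θ θ'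
      have e : w s θ - w s θ' = s ^ α * (g θ - g θ') := by simp only [w]; ring
      rw [e, abs_mul, abs_of_nonneg (Real.rpow_nonneg hs.1 _)]
      have hs0 := hs.1
      calc _ ≤ s * (K * |θ - θ'|) := by gcongr; exact rpow_le_self' hα hs; exact hgl θ θ'
        _ = K * s * |θ - θ'| := by ring
        _ ≤ _ := by gcongr; nlinarith [mul_nonneg hα0.le (add_nonneg hC (abs_nonneg m))]
  have h1 := h.le w hw (fun θ => by simp [w, hgdef])
  have mpow : BM (fun p : ℝ × ℝ => p.1 ^ (2 * α - 1)) := by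
    refine BM.of_fst (f := fun s => s ^ (2*α-1)) (by fun_prop) 1 fun s hs => ?_
    rw [abs_of_nonneg (Real.rpow_nonneg hs.1 _)]
    exact Real.rpow_le_one hs.1 hs.2 (by linarith)
  have b1 : BM (fun p : ℝ × ℝ => p.1 ^ (2 * α - 1) * (α ^ 2 * (g p.2 - m) ^ 2 + deriv g p.2 ^ 2)) :=
    mpow.mul ((((hg.bm hl).sub (BM.const m)).pow2.cmul _).add hg.bmd.pow2)
  have b2 : BM (fun p : ℝ × ℝ => max lp lm * p.1) := BM.fst.cmul _
  have h2 := En_le hp hm (l := l) (R := 1) (w := w) le_rfl (b1.add b2) (by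
    refine Filter.Eventually.of_forall fun p hpQ => ?_
    have hp1 : 0 < p.1 := hpQ.1.1
    have d1 : dr w p = α * p.1 ^ (α - 1) * (g p.2 - m) := by
      unfold dr
      simp only [w]
      rw [deriv_const_add, deriv_mul_const_field, Real.deriv_rpow_const]
    have d2 : tn w p = p.1 ^ (α - 1) * deriv g p.2 := by
      unfold tn dt
      simp only [w]
      rw [deriv_const_add, deriv_const_mul_field, deriv_sub_const, Real.rpow_sub_one hp1.ne']
      field_simp
    have d3 : p.1 ^ (2 * α - 1) = (p.1 ^ (α - 1)) ^ 2 * p.1 := by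
      rw [← Real.rpow_natCast, ← Real.rpow_mul hp1.le]
      nth_rewrite 3 [← Real.rpow_one p.1]
      rw [← Real.rpow_add hp1]; congr 1; push_cast; ring
    unfold ed
    rw [gradSq_eq, d1, d2, d3]
    have := ar_le hp hm (w p.1 p.2)
    nlinarith [mul_le_mul_of_nonneg_right this hp1.le])
  rw [I2_add b1 b2 le_rfl, I2_prod hl.le (fun s => s ^ (2 * α - 1)) (fun θ => α ^ 2 * (g θ - m) ^ 2 + deriv g θ ^ 2) zero_le_one,
    I2_fst hl.le (fun s => max lp lm * s) zero_le_one, integral_rpow (Or.inl (by linarith)),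
    intervalIntegral.integral_add _ (hg.int_d2 0 l), intervalIntegral.integral_const_mul,
    intervalIntegral.integral_const_mul, integral_id] at h2
  · have e : (2 * α - 1 + 1) = 2 * α := by ring
    rw [e, Real.zero_rpow (by positivity), Real.one_rpow] at h2
    refine h1.trans (h2.trans (le_of_eq ?_))
    field_simp
    ring
  · have := hg.cont
    exact (by fun_prop : Continuous fun θ => α ^ 2 * (g θ - m) ^ 2).intervalIntegrable _ _

/-! ### Radial reparametrization -/

theorem deriv_comp_rpow (f : ℝ → ℝ) {p s : ℝ} (hp : 1 ≤ p) (hs : 0 < s) :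
    deriv (fun x => f (x ^ p)) s = p * s ^ (p - 1) * deriv f (s ^ p) := by
  have hp0 : 0 < p := by linarith
  have d := Real.hasDerivAt_rpow_const (x := s) (p := p) (Or.inr hp)
  by_cases hf : DifferentiableAt ℝ f (s ^ p)
  · have := (hf.hasDerivAt.comp s d).deriv
    rw [show (fun x => f (x ^ p)) = f ∘ fun x => x ^ p from rfl, this]; ring
  · rw [deriv_zero_of_not_differentiableAt hf, mul_zero]
    apply deriv_zero_of_not_differentiableAt
    intro h
    apply hf
    have hsp : 0 < s ^ p := Real.rpow_pos_of_pos hs p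
    have e1 : (s ^ p) ^ (1 / p) = s := by
      rw [← Real.rpow_mul hs.le, mul_one_div_cancel hp0.ne', Real.rpow_one]
    have d2 : DifferentiableAt ℝ (fun y : ℝ => y ^ (1 / p)) (s ^ p) :=
      (Real.hasDerivAt_rpow_const (Or.inl hsp.ne')).differentiableAt
    have h' : DifferentiableAt ℝ (fun x => f (x ^ p)) ((s ^ p) ^ (1 / p)) := by rwa [e1]
    have h3 := DifferentiableAt.comp (s ^ p) h' d2
    refine h3.congr_of_eventuallyEq ?_
    filter_upwards [lt_mem_nhds hsp] with y hy
    simp only [Function.comp]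
    rw [← Real.rpow_mul hy.le, one_div_mul_cancel hp0.ne', Real.rpow_one]

theorem cov_rpow (A : ℝ → ℝ) {p : ℝ} (hp : 1 ≤ p) :
    ∫ s in (0:ℝ)..1, s ^ (2 * p - 1) * A (s ^ p) = (1 / p) * ∫ s in (0:ℝ)..1, s * A s := by
  have hp0 : 0 < p := by linarith
  have h := integral_comp_rpow_Ioi (fun y => (Iio (1:ℝ)).indicator (fun y => y * A y) y) hp0.ne'
  have e1 : ∀ x ∈ Ioi (0:ℝ), (|p| * x ^ (p - 1)) • (Iio (1:ℝ)).indicator (fun y => y * A y) (x ^ p)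
      = (Iio (1:ℝ)).indicator (fun x => p * (x ^ (2 * p - 1) * A (x ^ p))) x := by
    intro x hx
    have hx0 : 0 < x := hx
    by_cases hx1 : x < 1
    · have : x ^ p < 1 := Real.rpow_lt_one hx0.le hx1 hp0
      rw [indicator_of_mem (by exact this), indicator_of_mem (by exact hx1), abs_of_pos hp0, smul_eq_mul,
        show 2 * p - 1 = (p - 1) + p by ring, Real.rpow_add hx0]
      ring
    · have : ¬ x ^ p < 1 := by
        have := Real.one_le_rpow (not_lt.1 hx1) hp0.le
        linarith
      rw [indicator_of_notMem (by exact this), indicator_of_notMem (by exact hx1), smul_zero]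
  rw [setIntegral_congr_fun measurableSet_Ioi e1] at h
  rw [setIntegral_indicator measurableSet_Iio, setIntegral_indicator measurableSet_Iio,
    Ioi_inter_Iio, ← integral_Ioc_eq_integral_Ioo, ← integral_Ioc_eq_integral_Ioo,
    ← intervalIntegral.integral_of_le zero_le_one, ← intervalIntegral.integral_of_le zero_le_one,
    intervalIntegral.integral_const_mul] at h
  rw [← h]; field_simp

/-- Radial energy -/
def Rad (l : ℝ) (u : ℝ → ℝ → ℝ) (R : ℝ) : ℝ := I2 l (fun p => dr u p ^ 2 * p.1) R
/-- Tangential energy -/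
def Tan (l : ℝ) (u : ℝ → ℝ → ℝ) (R : ℝ) : ℝ := I2 l (fun p => tn u p ^ 2 * p.1) R

theorem Rad_add_Tan {l : ℝ} {u : ℝ → ℝ → ℝ} (h : GLp l u) {R : ℝ} (hR : R ≤ 1) :
    I2 l (fun p => gradSq u p * p.1) R = Rad l u R + Tan l u R := by
  unfold Rad Tan
  rw [← I2_add (h.bm_dr.pow2.mul BM.fst) (h.bm_tn.pow2.mul BM.fst) hR]
  congr 1; ext p; rw [gradSq_eq]; ring

theorem Rad_Tan_le_En {l lp lm : ℝ} (hp : 0 ≤ lp) (hm : 0 ≤ lm) {u : ℝ → ℝ → ℝ} (h : GLp l u) {R : ℝ} (hR : R ≤ 1) :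
    Rad l u R + Tan l u R ≤ En l lp lm u R := by
  rw [← Rad_add_Tan h hR, En_I2]
  refine I2_mono (h.bm_grad.mul BM.fst) ((h.bm_ed lp lm).mul BM.fst) hR fun p hpQ => ?_
  have := ar_nonneg hp hm (u p.1 p.2)
  have h1 : 0 < p.1 := hpQ.1.1
  unfold ed
  nlinarith

theorem En_le_Dir {l lp lm : ℝ} (hl : 0 ≤ l) (hp : 0 ≤ lp) (hm : 0 ≤ lm) {u : ℝ → ℝ → ℝ} (h : GLp l u) {R : ℝ} (hR0 : 0 ≤ R) (hR : R ≤ 1) :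
    En l lp lm u R ≤ I2 l (fun p => gradSq u p * p.1) R + max lp lm * l * R ^ 2 / 2 := by
  have b : BM (fun p : ℝ × ℝ => max lp lm * p.1) := BM.fst.cmul _
  have h1 := En_le (l := l) hp hm hR ((h.bm_grad.mul BM.fst).add b) (w := u) (Filter.Eventually.of_forall fun p hpQ => by
    have := ar_le hp hm (u p.1 p.2)
    have h1 : 0 < p.1 := hpQ.1.1
    unfold ed
    nlinarith)
  rw [I2_add (h.bm_grad.mul BM.fst) b hR, I2_fst hl (fun s => max lp lm * s) hR0,
    intervalIntegral.integral_const_mul, integral_id] at h1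
  linarith

theorem sl_fst_mul (l : ℝ) (f : ℝ → ℝ) (F : ℝ × ℝ → ℝ) (s : ℝ) :
    sl l (fun p => f p.1 * F p) s = f s * sl l F s := by
  unfold sl; simp

theorem Mn.reparam {l lp lm : ℝ} (hl : 0 < l) (hp : 0 ≤ lp) (hm : 0 ≤ lm) {u : ℝ → ℝ → ℝ}
    (h : Mn l lp lm u) {q : ℝ} (hq : 1 < q) :
    Tan l u 1 ≤ q * Rad l u 1 + max lp lm * l * q / (2 * (q - 1)) := by
  have hq0 : 0 < q := by linarith
  obtain ⟨K, hK, hl1, hl2⟩ := h.gl.lip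
  let w : ℝ → ℝ → ℝ := fun s θ => u (s ^ q) θ
  have hw : RL l w := by
    refine ⟨fun r θ => h.gl.per _ _, q * K + K, by positivity, ?_, ?_⟩
    · intro θ s hs s' hs'
      refine (hl1 θ _ _).trans ?_
      have := rpow_lip hq.le s hs s' hs'
      calc K * |s ^ q - s' ^ q| ≤ K * (q * |s - s'|) := by gcongr
        _ ≤ _ := by nlinarith [mul_nonneg hK (abs_nonneg (s - s'))]
    · intro s hs θ θ'
      refine (hl2 _ θ θ').trans ?_
      have := rpow_le_self' hq.le hs
      have h0 := hs.1
      rw [abs_of_nonneg (Real.rpow_nonneg hs.1 _)]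
      calc K * s ^ q * |θ - θ'| ≤ K * s * |θ - θ'| := by gcongr
        _ ≤ _ := by gcongr; nlinarith
  have h1 := h.le w hw (fun θ => by simp [w])
  obtain ⟨M, hM, hM1, hM2, hM3⟩ := h.gl.bddAll
  have hmap : Measurable (fun p : ℝ × ℝ => (p.1 ^ q, p.2)) := by fun_prop
  have mpow : BM (fun p : ℝ × ℝ => p.1 ^ (2 * q - 1)) := by
    refine BM.of_fst (f := fun s => s ^ (2*q-1)) (by fun_prop) 1 fun s hs => ?_
    rw [abs_of_nonneg (Real.rpow_nonneg hs.1 _)]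
    exact Real.rpow_le_one hs.1 hs.2 (by linarith)
  have hcomp : ∀ F : ℝ × ℝ → ℝ, BM F → BM (fun p => F (p.1 ^ q, p.2)) := by
    intro F hF
    obtain ⟨C, hC, hb⟩ := hF.bdd
    exact ⟨hF.meas.comp hmap, C, hC, fun s hs θ => hb _ ⟨Real.rpow_nonneg hs.1 _, Real.rpow_le_one hs.1 hs.2 hq0.le⟩ θ⟩
  have bA := hcomp _ h.gl.bm_dr.pow2
  have bB := hcomp _ h.gl.bm_tn.pow2
  have b1 := (mpow.mul bA).cmul (q ^ 2)
  have b2 := mpow.mul bB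
  have b3 : BM (fun p : ℝ × ℝ => max lp lm * p.1) := BM.fst.cmul _
  have h2 := En_le hp hm (l := l) (R := 1) (w := w) le_rfl ((b1.add b2).add b3) (by
    refine Filter.Eventually.of_forall fun p hpQ => ?_
    have hp1 : 0 < p.1 := hpQ.1.1
    have d1 : dr w p = q * p.1 ^ (q - 1) * dr u (p.1 ^ q, p.2) := by
      unfold dr
      exact deriv_comp_rpow (fun s => u s p.2) hq.le hp1
    have d2 : tn w p = p.1 ^ (q - 1) * tn u (p.1 ^ q, p.2) := by
      unfold tn dt
      simp only [w]
      rw [Real.rpow_sub_one hp1.ne']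
      have := (Real.rpow_pos_of_pos hp1 q).ne'
      field_simp
    have d3 : p.1 ^ (2 * q - 1) = (p.1 ^ (q - 1)) ^ 2 * p.1 := by
      rw [← Real.rpow_natCast, ← Real.rpow_mul hp1.le, ← Real.rpow_add_one hp1.ne']
      congr 1; push_cast; ring
    have d4 := ar_le hp hm (w p.1 p.2)
    unfold ed
    rw [gradSq_eq, d1, d2]
    simp only [d3]
    nlinarith)
  rw [I2_add (b1.add b2) b3 le_rfl, I2_add b1 b2 le_rfl, I2_cmul, I2_fst hl.le (fun s => max lp lm * s) zero_le_one,
    intervalIntegral.integral_const_mul, integral_id, I2_eq (mpow.mul bA) hl.le zero_le_one le_rfl,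
    I2_eq (mpow.mul bB) hl.le zero_le_one le_rfl] at h2
  have eA : ∀ F : ℝ × ℝ → ℝ, BM F → ∫ s in (0:ℝ)..1, sl l (fun p => p.1 ^ (2 * q - 1) * F (p.1 ^ q, p.2)) s
      = (1 / q) * I2 l (fun p => F p * p.1) 1 := by
    intro F hF
    rw [I2_eq (hF.mul BM.fst) hl.le zero_le_one le_rfl]
    have := cov_rpow (sl l F) hq.le
    simp only [sl_fst_mul l (fun s => s ^ (2 * q - 1))]
    have e2 : ∀ s, sl l (fun p => F p * p.1) s = s * sl l F s := fun s => by
      unfold sl; simp [mul_comm]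
    simp only [e2]
    exact this
  rw [eA _ h.gl.bm_dr.pow2, eA _ h.gl.bm_tn.pow2] at h2
  have h3 := Rad_Tan_le_En hp hm h.gl (le_refl (1:ℝ))
  change _ ≤ q ^ 2 * (1 / q * Rad l u 1) + 1 / q * Tan l u 1 + _ at h2
  have h4 : Rad l u 1 + Tan l u 1 ≤ q ^ 2 * (1 / q * Rad l u 1) + 1 / q * Tan l u 1 + l * (max lp lm * ((1 ^ 2 - 0 ^ 2) / 2)) :=
    h3.trans (h1.trans h2)
  have e : q ^ 2 * (1 / q * Rad l u 1) = q * Rad l u 1 := by field_simp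
  rw [e] at h4
  have h5 : (q - 1) * (Tan l u 1 - q * Rad l u 1) ≤ max lp lm * l * q / 2 := by
    have := mul_le_mul_of_nonneg_left h4 hq0.le
    have e3 : q * (1 / q * Tan l u 1) = Tan l u 1 := by field_simp
    nlinarith
  rw [← sub_le_iff_le_add']
  rw [le_div_iff₀ (by linarith)]
  linarith

/-- circle tangential energy -/
def tau (l : ℝ) (u : ℝ → ℝ → ℝ) (s : ℝ) : ℝ := ∫ θ in (0:ℝ)..l, deriv (u s) θ ^ 2

theorem tau_nonneg {l : ℝ} (hl : 0 ≤ l) (u : ℝ → ℝ → ℝ) (s : ℝ) : 0 ≤ tau l u s :=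
  intervalIntegral.integral_nonneg hl fun _ _ => sq_nonneg _

theorem Mn.tan_bound {l lp lm : ℝ} (hl : 0 < l) (hp : 0 ≤ lp) (hm : 0 ≤ lm) {u : ℝ → ℝ → ℝ}
    (h : Mn l lp lm u) {α : ℝ} (hα : 1 < α) (hαl : α * l < 2 * Real.pi) :
    α * (3 + α) / (1 + α) * Tan l u 1 ≤ tau l u 1
      + α * (max lp lm * l / 2 + max lp lm * l / (α - 1)) := by
  have h1 := h.reparam hl hp hm (q := (1 + α) / 2) (by linarith)
  have h2 := h.harm hl hp hm hα.le (mean l (u 1))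
  have h3 := wirtinger hl (h.gl.tr 1) (by linarith : 0 < α) hαl
  have h4 := Rad_Tan_le_En hp hm h.gl (le_refl (1:ℝ))
  change _ ≤ tau l u 1 at h3
  change _ ≤ _ + 1 / (2 * α) * tau l u 1 + _ at h2
  have hα0 : 0 < α := by linarith
  have h5 : α / 2 * (∫ θ in (0:ℝ)..l, (u 1 θ - mean l (u 1)) ^ 2) ≤ 1 / (2 * α) * tau l u 1 := by
    have := mul_le_mul_of_nonneg_left h3 (by positivity : 0 ≤ 1 / (2 * α))
    refine le_trans (le_of_eq ?_) this
    field_simp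
  have h6 : α * (Rad l u 1 + Tan l u 1) ≤ tau l u 1 + α * (max lp lm * l / 2) := by
    have := mul_le_mul_of_nonneg_left (h4.trans (h2.trans (add_le_add_left (add_le_add_left h5 _) _))) hα0.le
    refine this.trans (le_of_eq ?_)
    field_simp; ring
  have h7 : 2 * α / (1 + α) * Tan l u 1 ≤ α * Rad l u 1 + α * (max lp lm * l / (α - 1)) := by
    have := mul_le_mul_of_nonneg_left h1 (by positivity : 0 ≤ 2 * α / (1 + α))
    refine this.trans (le_of_eq ?_)
    have : α - 1 ≠ 0 := by linarith
    have e0 : 2 * ((1 + α) / 2 - 1) = α - 1 := by ring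
    rw [e0]
    field_simp
  have e : α * (3 + α) / (1 + α) * Tan l u 1 = α * Tan l u 1 + 2 * α / (1 + α) * Tan l u 1 := by
    field_simp; ring
  rw [e]; linarith

theorem Tan_sc {l : ℝ} (hl : 0 ≤ l) {u : ℝ → ℝ → ℝ} (h : GLp l u) {r : ℝ} (hr : 0 < r) (hr1 : r ≤ 1) :
    Tan l (sc r u) 1 = Tan l u r / r ^ 2 := by
  unfold Tan
  rw [I2_eq ((h.sc hr).bm_tn.pow2.mul BM.fst) hl zero_le_one le_rfl, I2_eq (h.bm_tn.pow2.mul BM.fst) hl hr.le hr1]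
  have : ∀ s, sl l (fun p => tn (sc r u) p ^ 2 * p.1) s
      = r⁻¹ * sl l (fun p => tn u p ^ 2 * p.1) (r * s) := by
    intro s
    unfold sl
    rw [← intervalIntegral.integral_const_mul]
    congr 1; ext θ
    simp only
    rw [tn_sc u hr]
    field_simp
  simp only [this]
  rw [intervalIntegral.integral_const_mul, intervalIntegral.integral_comp_mul_left _ hr.ne']
  simp; field_simp

theorem tau_sc (l : ℝ) (u : ℝ → ℝ → ℝ) (r s : ℝ) : tau l (sc r u) s = tau l u (r * s) / r ^ 2 := by
  unfold tau
  rw [← intervalIntegral.integral_div]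
  congr 1; ext θ
  have := dt_sc u r s θ
  unfold dt at this
  simp only at this
  change deriv (fun φ => sc r u s φ) θ ^ 2 = _
  rw [this]; ring

/-- Quadratic growth of the tangential energy. -/
theorem Mn.tan_growth {l lp lm : ℝ} (hl : 0 < l) (hl2 : l < 2 * Real.pi) (hp : 0 ≤ lp) (hm : 0 ≤ lm) :
    ∃ C : ℝ, 0 ≤ C ∧ ∀ u, Mn l lp lm u → Tan l u 1 ≤ 1 → ∀ s, 0 < s → s ≤ 1 → Tan l u s ≤ C * s ^ 2 := by
  obtain ⟨α, hα, hα2⟩ := exists_between (show 1 < 2 * Real.pi / l by rw [lt_div_iff₀ hl]; linarith)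
  have hαl : α * l < 2 * Real.pi := by rwa [lt_div_iff₀ hl] at hα2
  set β := α * (3 + α) / (1 + α) with hβ
  have hβ2 : 2 < β := by rw [hβ, lt_div_iff₀ (by linarith)]; nlinarith
  set C1 := α * (max lp lm * l / 2 + max lp lm * l / (α - 1)) with hC1
  have hΛ : 0 ≤ max lp lm := hp.trans (le_max_left _ _)
  have hC1' : 0 ≤ C1 := by
    have : 0 < α - 1 := by linarith
    have : 0 < α := by linarith
    positivity
  refine ⟨1 + C1 / (β - 2), by have : 0 < β - 2 := by linarith
                               positivity, fun u h hT s hs hs1 => ?_⟩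
  have bT := h.gl.bm_tn.pow2.mul BM.fst
  let p : ℝ → ℝ := sl l (fun p => tn u p ^ 2 * p.1)
  have hTan : ∀ r ∈ Icc (0:ℝ) 1, Tan l u r = 0 + ∫ x in (0:ℝ)..r, p x := fun r hr => by
    rw [zero_add]; exact I2_eq bT hl.le hr.1 hr.2
  have hpt : ∀ x, 0 < x → x * p x = tau l u x := by
    intro x hx
    simp only [p, sl, tau]
    rw [← intervalIntegral.integral_const_mul]
    congr 1; ext θ
    simp only [tn, dt]
    field_simp
  have hode : ∀ x, 0 < x → x ≤ 1 → β * Tan l u x ≤ x * p x + C1 * x ^ 2 := by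
    intro x hx hx1
    have := (h.sc hl.le hx hx1).tan_bound hl hp hm hα hαl
    rw [Tan_sc hl.le h.gl hx hx1, tau_sc, mul_one, ← hβ, ← hC1] at this
    rw [hpt x hx]
    have h2 := mul_le_mul_of_nonneg_right this (sq_nonneg x)
    field_simp at h2
    linarith
  have key := ibp (p := p) (φ := fun x => x ^ (-β)) (φ' := fun x => -β * x ^ (-β - 1)) (s := s) (t := 1) 0 hs.le hs1
    (bT.int_sl hl.le (by simp) (by simp)) (fun x hx => Real.hasDerivAt_rpow_const (Or.inl (by linarith [hx.1])))
    (continuousOn_const.mul (ContinuousOn.rpow_const continuousOn_id fun x hx => Or.inl (show x ≠ 0 by linarith [hx.1])))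
  rw [← hTan 1 (by simp), ← hTan s ⟨hs.le, hs1⟩, Real.one_rpow, mul_one] at key
  have hlow : ∫ x in s..1, -C1 * x ^ (1 - β) ≤ ∫ x in s..1, (p x * x ^ (-β) + (0 + ∫ y in (0:ℝ)..x, p y) * (-β * x ^ (-β - 1))) := by
    have hcont : ∀ γ : ℝ, ContinuousOn (fun x : ℝ => x ^ γ) (uIcc s 1) := fun γ => by
      rw [uIcc_of_le hs1]
      exact ContinuousOn.rpow_const continuousOn_id fun x hx => Or.inl (show x ≠ 0 by linarith [hx.1])
    apply intervalIntegral.integral_mono_on hs1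
    · exact (continuousOn_const.mul (hcont _)).intervalIntegrable
    · refine (IntervalIntegrable.mul_continuousOn (bT.int_sl hl.le ⟨hs.le, hs1⟩ (by simp)) (hcont _)).add ?_
      have hi : IntervalIntegrable p volume 0 1 := bT.int_sl hl.le (by simp) (by simp)
      have : ContinuousOn (fun x => ∫ y in (0:ℝ)..x, p y) (uIcc s 1) :=
        (intervalIntegral.continuousOn_primitive_interval' hi (by simp)).mono (by
          rw [uIcc_of_le hs1, uIcc_of_le zero_le_one]; exact Icc_subset_Icc_left hs.le)
      exact ((continuousOn_const.add this).mul (continuousOn_const.mul (hcont _))).intervalIntegrable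
    · intro x hx
      have hx0 : 0 < x := by linarith [hx.1]
      rw [← hTan x ⟨hx0.le, hx.2⟩]
      have e1 : x ^ (-β) = x * x ^ (-β - 1) := by
        rw [Real.rpow_sub_one hx0.ne']; field_simp
      have e2 : x ^ (1 - β) = x ^ 2 * x ^ (-β - 1) := by
        rw [← Real.rpow_natCast, ← Real.rpow_add hx0]; congr 1; push_cast; ring
      have h4 := mul_le_mul_of_nonneg_right (hode x hx0 hx.2) (Real.rpow_nonneg hx0.le (-β - 1))
      rw [e1, e2]
      nlinarith
  rw [← key, intervalIntegral.integral_const_mul, integral_rpow (Or.inr ⟨by intro h; linarith, by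
    rw [uIcc_of_le hs1]; intro h0; linarith [h0.1]⟩), Real.one_rpow] at hlow
  have hb : 0 < β - 2 := by linarith
  have e3 : (1 - β + 1) = -(β - 2) := by ring
  rw [e3] at hlow
  have hsb : 1 ≤ s ^ (-(β - 2)) := Real.one_le_rpow_of_pos_of_le_one_of_nonpos hs hs1 (by linarith)
  have e4 : s ^ (-(β - 2)) = s ^ 2 * s ^ (-β) := by
    rw [← Real.rpow_natCast, ← Real.rpow_add hs]; congr 1; push_cast; ring
  have e5 : -C1 * ((1 - s ^ (-(β - 2))) / -(β - 2)) = -(C1 / (β - 2)) * (s ^ (-(β - 2)) - 1) := by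
    field_simp; ring
  rw [e5] at hlow
  have hposβ : 0 < s ^ (-β) := Real.rpow_pos_of_pos hs _
  have hd : 0 ≤ C1 / (β - 2) := by positivity
  have h6 : Tan l u s * s ^ (-β) ≤ (1 + C1 / (β - 2)) * s ^ 2 * s ^ (-β) := by
    rw [mul_assoc, ← e4]
    nlinarith
  exact le_of_mul_le_mul_right h6 hposβ

theorem BM.ints {F : ℝ × ℝ → ℝ} (hF : BM F) (θ : ℝ) {a b : ℝ} (ha : a ∈ Icc (0:ℝ) 1) (hb : b ∈ Icc (0:ℝ) 1) :
    IntervalIntegrable (fun s => F (s, θ)) volume a b := by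
  obtain ⟨C, hC, h⟩ := hF.bdd
  rw [intervalIntegrable_iff]
  refine Measure.integrableOn_of_bounded (M := C) (by simp)
    (hF.meas.comp measurable_prodMk_right).aestronglyMeasurable ?_
  refine (ae_restrict_iff' measurableSet_uIoc).2 (Filter.Eventually.of_forall fun s hs => ?_)
  exact h s ((uIcc_subset_Icc ha hb) (uIoc_subset_uIcc hs)) θ

theorem I2_eq' {F : ℝ × ℝ → ℝ} (hF : BM F) {l R : ℝ} (hl : 0 ≤ l) (hR0 : 0 ≤ R) (hR : R ≤ 1) :
    I2 l F R = ∫ θ in (0:ℝ)..l, ∫ s in (0:ℝ)..R, F (s, θ) := by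
  unfold I2
  have hi := hF.int (l := l) hR
  unfold Q at *
  rw [Measure.volume_eq_prod] at *
  rw [← setIntegral_prod_swap, setIntegral_prod, intervalIntegral.integral_of_le hl, integral_Ioc_eq_integral_Ioo]
  · congr 1; ext θ
    rw [intervalIntegral.integral_of_le hR0, integral_Ioc_eq_integral_Ioo]
    rfl
  · exact hi.swap

/-! ### Sign-definite case -/

theorem Mn.pos_of_large {l lp lm : ℝ} (hl : 0 < l) (hp : 0 ≤ lp) (hm : 0 ≤ lm) {v : ℝ → ℝ → ℝ}
    (h : Mn l lp lm v) {c : ℝ} (hc0 : 0 < c) (hc : lp < c ^ 2) (hv : ∀ θ, c ≤ v 1 θ) :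
    ∀ s ∈ Icc (0:ℝ) 1, ∀ θ, c ≤ v s θ := by
  refine h.min_principle hl hp hm (c := c) (κ := lp / c ^ 2) (by rw [div_lt_one (by positivity)]; exact hc) hv ?_
  intro x hx
  rw [ar_pos hc0]
  rcases lt_or_ge 0 x with h0 | h0
  · rw [ar_pos h0, sub_self]; positivity
  · have h1 := ar_nonneg hp hm x
    have h2 : c ^ 2 ≤ (c - x) ^ 2 := by nlinarith
    have h3 : lp / c ^ 2 * c ^ 2 ≤ lp / c ^ 2 * (c - x) ^ 2 := by gcongr
    rw [div_mul_cancel₀ _ (by positivity)] at h3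
    linarith

theorem Mn.good_scale {l lp lm : ℝ} (hl : 0 < l) (hl2 : l < 2 * Real.pi) (hp : 0 ≤ lp) (hm : 0 ≤ lm) :
    ∃ K : ℝ, 0 ≤ K ∧ ∀ u, Mn l lp lm u → Tan l u 1 ≤ 1 → ∀ r, 0 < r → r ≤ 1 → ∃ s ∈ Ioo (r / 2) r,
      (∀ θ, |u s θ| ≤ K * s) ∨ (∀ x ∈ Icc 0 s, ∀ θ, 0 < u x θ) ∨ (∀ x ∈ Icc 0 s, ∀ θ, u x θ < 0) := by
  obtain ⟨C, hC, hT⟩ := Mn.tan_growth hl hl2 hp hm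
  set D := Real.sqrt (l * (4 * C)) with hD
  set c := max lp lm + 1 with hc
  have hΛ : 0 ≤ max lp lm := hp.trans (le_max_left _ _)
  have hc1 : 1 ≤ c := by linarith
  have hcp : lp < c ^ 2 := by nlinarith [le_max_left lp lm]
  have hcm : lm < c ^ 2 := by nlinarith [le_max_right lp lm]
  refine ⟨D + c, by positivity, fun u h hT1 r hr hr1 => ?_⟩
  have bT := h.gl.bm_tn.pow2.mul BM.fst
  have hTr := hT u h hT1 r hr hr1
  let p : ℝ → ℝ := sl l (fun p => tn u p ^ 2 * p.1)
  have hTan : Tan l u r = ∫ x in (0:ℝ)..r, p x := I2_eq bT hl.le hr.le hr1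
  have hpi : ∀ a ∈ Icc (0:ℝ) 1, ∀ b ∈ Icc (0:ℝ) 1, IntervalIntegrable p volume a b := fun a ha b hb => bT.int_sl hl.le ha hb
  have m0 : (0:ℝ) ∈ Icc (0:ℝ) 1 := by simp
  have m1 : r / 2 ∈ Icc (0:ℝ) 1 := ⟨by linarith, by linarith⟩
  have m2 : r ∈ Icc (0:ℝ) 1 := ⟨by linarith, by linarith⟩
  have hsum := intervalIntegral.integral_add_adjacent_intervals (hpi 0 m0 _ m1) (hpi _ m1 _ m2)
  have hpos : 0 ≤ ∫ x in (0:ℝ)..(r / 2), p x := intervalIntegral.integral_nonneg (by linarith) fun x hx =>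
    intervalIntegral.integral_nonneg hl.le fun θ _ => mul_nonneg (sq_nonneg _) hx.1
  obtain ⟨s, hs, hps⟩ := exists_le_of_int (M := 2 * C * r) (by linarith : r / 2 < r) (hpi _ m1 _ m2) (by nlinarith)
  refine ⟨s, hs, ?_⟩
  have hs0 : 0 < s := by linarith [hs.1]
  have hs1 : s ≤ 1 := by linarith [hs.2]
  have hpt : s * p s = tau l u s := by
    simp only [p, sl, tau]
    rw [← intervalIntegral.integral_const_mul]
    congr 1; ext θ
    simp only [tn, dt]
    field_simp
  have htau : tau l u s ≤ 4 * C * s ^ 2 := by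
    rw [← hpt]
    calc s * p s ≤ s * (2 * C * r) := by gcongr
      _ ≤ s * (2 * C * (2 * s)) := by gcongr; linarith [hs.1]
      _ = _ := by ring
  have hosc : ∀ x y, u s x - u s y ≤ D * s := by
    intro x y
    have h1 := (h.gl.tr s).osc_all hl x y
    change _ ≤ l * tau l u s at h1
    have h2 : (u s x - u s y) ^ 2 ≤ (D * s) ^ 2 := by
      rw [mul_pow, hD, Real.sq_sqrt (by positivity)]
      nlinarith
    exact (abs_le_of_sq_le_sq' h2 (by positivity)).2
  by_cases hb : ∀ θ, |u s θ| ≤ (D + c) * s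
  · exact Or.inl hb
  right
  push Not at hb
  obtain ⟨θ0, hθ0⟩ := hb
  have hv := h.sc hl.le hs0 hs1
  have hback : ∀ x ∈ Icc 0 s, ∀ θ, x / s ∈ Icc (0:ℝ) 1 ∧ u x θ = s * _root_.sc s u (x / s) θ := by
    intro x hx θ
    refine ⟨⟨div_nonneg hx.1 hs0.le, (div_le_one hs0).2 hx.2⟩, ?_⟩
    unfold _root_.sc
    rw [mul_div_cancel₀ _ hs0.ne', mul_div_cancel₀ _ hs0.ne']
  rcases le_total 0 (u s θ0) with h0 | h0
  · left
    rw [abs_of_nonneg h0] at hθ0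
    have := hv.pos_of_large hl hp hm (c := c) (by linarith) hcp (fun θ => by
      unfold _root_.sc
      rw [mul_one, le_div_iff₀ hs0]
      nlinarith [hosc θ0 θ])
    intro x hx θ
    obtain ⟨h1, h2⟩ := hback x hx θ
    rw [h2]
    exact mul_pos hs0 (by linarith [this _ h1 θ])
  · right
    rw [abs_of_nonpos h0] at hθ0
    have := hv.neg.pos_of_large hl hm hp (c := c) (by linarith) hcm (fun θ => by
      unfold _root_.sc
      rw [mul_one, ← neg_div, le_div_iff₀ hs0]
      nlinarith [hosc θ θ0])
    intro x hx θ
    obtain ⟨h1, h2⟩ := hback x hx θ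
    rw [h2]
    exact mul_neg_of_pos_of_neg hs0 (by linarith [this _ h1 θ])

/-! ### Weiss-type monotonicity -/

/-- Energy of the one-homogeneous extension. -/
def hom (l lp lm : ℝ) (g : ℝ → ℝ) : ℝ := (1 / 2) * ∫ θ in (0:ℝ)..l, (g θ ^ 2 + deriv g θ ^ 2 + ar lp lm (g θ))

def deff (l lp lm : ℝ) (v : ℝ → ℝ → ℝ) : ℝ := hom l lp lm (v 1) - En l lp lm v 1

theorem Tr.int_ar {l lp lm : ℝ} {g : ℝ → ℝ} (h : Tr l g) (a b : ℝ) :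
    IntervalIntegrable (fun θ => ar lp lm (g θ)) volume a b :=
  Tr.ii _ ((ar_meas lp lm).comp h.cont.measurable) (|lp| + |lm|) (fun x => ar_bdd _ _ _) a b

theorem Tr.int_sq {l : ℝ} {g : ℝ → ℝ} (h : Tr l g) (a b : ℝ) :
    IntervalIntegrable (fun θ => g θ ^ 2) volume a b := (h.cont.pow 2).intervalIntegrable a b

theorem Tr.hom_eq {l lp lm : ℝ} {g : ℝ → ℝ} (h : Tr l g) : hom l lp lm g =
    (1 / 2) * ((∫ θ in (0:ℝ)..l, g θ ^ 2) + (∫ θ in (0:ℝ)..l, deriv g θ ^ 2) + ∫ θ in (0:ℝ)..l, ar lp lm (g θ)) := by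
  unfold hom
  rw [intervalIntegral.integral_add ((h.int_sq 0 l).add (h.int_d2 0 l)) (h.int_ar 0 l),
    intervalIntegral.integral_add (h.int_sq 0 l) (h.int_d2 0 l)]

/-- circle L2 norm -/
def Hc (l : ℝ) (u : ℝ → ℝ → ℝ) (s : ℝ) : ℝ := ∫ θ in (0:ℝ)..l, u s θ ^ 2

theorem GLp.Hc_eq {l : ℝ} (hl : 0 ≤ l) {u : ℝ → ℝ → ℝ} (h : GLp l u) {r : ℝ} (hr : r ∈ Icc (0:ℝ) 1) :
    Hc l u r = Hc l u 0 + ∫ s in (0:ℝ)..r, sl l (fun p => 2 * (u p.1 p.2 * dr u p)) s := by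
  have b := (h.bm_u.mul h.bm_dr).cmul 2
  rw [← I2_eq b hl hr.1 hr.2, I2_eq' b hl hr.1 hr.2]
  obtain ⟨K, hK, hl1, hl2⟩ := h.lip
  have e : ∀ θ, ∫ s in (0:ℝ)..r, 2 * (u s θ * dr u (s, θ)) = u r θ ^ 2 - u 0 θ ^ 2 := by
    intro θ
    have acf := ac_lip hK (hl1 θ) 0 r
    have := ac_ftc (F := fun s => u s θ * u s θ) (F' := fun s => 2 * (u s θ * dr u (s, θ)))
      (acf.fun_mul acf) (by
        filter_upwards [ae_diff_lip hK (hl1 θ)] with s hs _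
        refine (hs.hasDerivAt.mul hs.hasDerivAt).congr_deriv ?_
        simp [dr]; ring)
    rw [this]; ring
  simp only [e]
  rw [intervalIntegral.integral_sub ((h.tr r).int_sq 0 l) ((h.tr 0).int_sq 0 l)]
  unfold Hc; ring

theorem GLp.weiss {l lp lm : ℝ} (hl : 0 < l) {u : ℝ → ℝ → ℝ} (h : GLp l u) {s δ : ℝ} (hs : 0 < s) (hs1 : s ≤ 1)
    (hp : 0 ≤ lp) (hm : 0 ≤ lm)
    (hδ : ∀ σ ∈ Icc s 1, δ ≤ deff l lp lm (_root_.sc σ u)) :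
    2 * δ * Real.log (1 / s) ≤ En l lp lm u 1 + Hc l u s / s ^ 2 := by
  have be := (h.bm_ed lp lm).mul BM.fst
  have bh := (h.bm_u.mul h.bm_dr).cmul 2
  let p : ℝ → ℝ := fun x => sl l (fun p => ed lp lm u p * p.1) x - sl l (fun p => 2 * (u p.1 p.2 * dr u p)) x
  have m0 : (0:ℝ) ∈ Icc (0:ℝ) 1 := by simp
  have m1 : (1:ℝ) ∈ Icc (0:ℝ) 1 := by simp
  have hpi : ∀ a ∈ Icc (0:ℝ) 1, ∀ b ∈ Icc (0:ℝ) 1, IntervalIntegrable p volume a b := fun a ha b hb =>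
    (be.int_sl hl.le ha hb).sub (bh.int_sl hl.le ha hb)
  have hP : ∀ r ∈ Icc (0:ℝ) 1, -Hc l u 0 + ∫ x in (0:ℝ)..r, p x = En l lp lm u r - Hc l u r := by
    intro r hr
    rw [intervalIntegral.integral_sub (be.int_sl hl.le m0 hr) (bh.int_sl hl.le m0 hr),
      ← En_slice hl.le h hr.1 hr.2, h.Hc_eq hl.le hr]; ring
  have hder : ∀ x ∈ Icc s 1, HasDerivAt (fun x : ℝ => (x ^ 2)⁻¹) (-2 * (x ^ 3)⁻¹) x := by
    intro x hx
    have hx0 : x ≠ 0 := by linarith [hx.1]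
    refine ((hasDerivAt_pow 2 x).inv (by positivity)).congr_deriv ?_
    field_simp
    push_cast
    ring
  have hc3 : ContinuousOn (fun x : ℝ => -2 * (x ^ 3)⁻¹) (Icc s 1) := by
    refine continuousOn_const.mul (ContinuousOn.inv₀ (by fun_prop) fun x hx => ?_)
    have : 0 < x := by linarith [hx.1]
    positivity
  have hc2 : ContinuousOn (fun x : ℝ => (x ^ 2)⁻¹) (Icc s 1) := by
    refine (ContinuousOn.inv₀ (by fun_prop) fun x hx => ?_)
    have : 0 < x := by linarith [hx.1]
    positivity
  have key := ibp (p := p) (-Hc l u 0) hs.le hs1 (hpi 0 m0 1 m1) hder hc3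
  rw [hP 1 m1, hP s ⟨hs.le, hs1⟩] at key
  have hlow : ∫ x in s..1, (2 * δ) * x⁻¹ ≤ ∫ x in s..1, (p x * (x ^ 2)⁻¹ + (-Hc l u 0 + ∫ y in (0:ℝ)..x, p y) * (-2 * (x ^ 3)⁻¹)) := by
    apply intervalIntegral.integral_mono_on hs1
    · apply ContinuousOn.intervalIntegrable
      rw [uIcc_of_le hs1]
      exact continuousOn_const.mul (ContinuousOn.inv₀ continuousOn_id fun x hx => by
        show x ≠ 0; linarith [hx.1])
    · refine (IntervalIntegrable.mul_continuousOn (hpi _ ⟨hs.le, hs1⟩ _ m1) (by rwa [uIcc_of_le hs1])).add ?_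
      have : ContinuousOn (fun x => ∫ y in (0:ℝ)..x, p y) (uIcc s 1) :=
        (intervalIntegral.continuousOn_primitive_interval' (hpi 0 m0 1 m1) (by simp)).mono (by
          rw [uIcc_of_le hs1, uIcc_of_le zero_le_one]; exact Icc_subset_Icc_left hs.le)
      exact ((continuousOn_const.add this).mul (by rwa [uIcc_of_le hs1])).intervalIntegrable
    · intro x hx
      have hx0 : 0 < x := by linarith [hx.1]
      have hxm : x ∈ Icc (0:ℝ) 1 := ⟨hx0.le, hx.2⟩
      rw [hP x hxm]
      have hd := hδ x hx
      unfold deff at hd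
      rw [En_sc hl.le h hx0 hx.2 zero_le_one le_rfl, mul_one] at hd
      have eh : hom l lp lm (_root_.sc x u 1) = (1 / 2) * (Hc l u x / x ^ 2 + tau l u x / x ^ 2 + ∫ θ in (0:ℝ)..l, ar lp lm (u x θ)) := by
        rw [((h.sc hx0).tr 1).hom_eq]
        have t1 := tau_sc l u x 1
        rw [mul_one] at t1
        unfold tau at t1
        rw [t1]
        congr 3
        · unfold Hc; rw [← intervalIntegral.integral_div]; congr 1; ext θ; unfold _root_.sc; rw [mul_one]; ring
        · ext θ; unfold _root_.sc; rw [mul_one, ar_div hx0]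
      have ep : p x * x = x ^ 2 * (∫ θ in (0:ℝ)..l, (dr u (x, θ) - u x θ / x) ^ 2) - Hc l u x + tau l u x
          + x ^ 2 * ∫ θ in (0:ℝ)..l, ar lp lm (u x θ) := by
        have i1 : IntervalIntegrable (fun θ => (dr u (x, θ) - u x θ / x) ^ 2) volume 0 l := by
          have := (h.bm_dr.sub (h.bm_u.cmul x⁻¹)).pow2.intθ hxm 0 l
          refine this.congr fun θ _ => ?_
          simp only; ring
        have i2 := (h.tr x).int_sq 0 l
        have i3 := (h.tr x).int_d2 0 l
        have i4 := (h.tr x).int_ar (lp := lp) (lm := lm) 0 l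
        have i5 := be.intθ hxm 0 l
        have i6 := bh.intθ hxm 0 l
        simp only [p, sl, Hc, tau]
        rw [← intervalIntegral.integral_sub i5 i6, ← intervalIntegral.integral_mul_const,
          ← intervalIntegral.integral_const_mul, ← intervalIntegral.integral_const_mul,
          ← intervalIntegral.integral_sub (i1.const_mul _) i2, ← intervalIntegral.integral_add ((i1.const_mul _).sub i2) i3,
          ← intervalIntegral.integral_add (((i1.const_mul _).sub i2).add i3) (i4.const_mul _)]
        congr 1; ext θ
        simp only [ed, gradSq_eq, tn, dt]
        field_simp
        ring
      have hsq : 0 ≤ ∫ θ in (0:ℝ)..l, (dr u (x, θ) - u x θ / x) ^ 2 :=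
        intervalIntegral.integral_nonneg hl.le fun _ _ => sq_nonneg _
      have e7 : p x * (x ^ 2)⁻¹ + (En l lp lm u x - Hc l u x) * (-2 * (x ^ 3)⁻¹)
          = (p x * x - 2 * (En l lp lm u x - Hc l u x)) * (x ^ 3)⁻¹ := by field_simp; ring
      rw [e7, ep]
      have e8 : x⁻¹ = x ^ 2 * (x ^ 3)⁻¹ := by field_simp
      rw [e8, ← mul_assoc]
      apply mul_le_mul_of_nonneg_right _ (by positivity)
      rw [eh] at hd
      have := mul_le_mul_of_nonneg_right hd (by positivity : 0 ≤ 2 * x ^ 2)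
      have e9 : (1 / 2 * (Hc l u x / x ^ 2 + tau l u x / x ^ 2 + ∫ θ in (0:ℝ)..l, ar lp lm (u x θ)) - En l lp lm u x / x ^ 2) * (2 * x ^ 2)
        = Hc l u x + tau l u x + x ^ 2 * (∫ θ in (0:ℝ)..l, ar lp lm (u x θ)) - 2 * En l lp lm u x := by field_simp
      rw [e9] at this
      nlinarith [mul_nonneg (sq_nonneg x) hsq]
  rw [← key, intervalIntegral.integral_const_mul, integral_inv_of_pos hs one_pos] at hlow
  have hH1 : 0 ≤ Hc l u 1 := intervalIntegral.integral_nonneg hl.le fun _ _ => sq_nonneg _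
  have hEs := En_nonneg (l := l) hp hm u s
  refine hlow.trans ?_
  have : 0 ≤ En l lp lm u s * (s ^ 2)⁻¹ := by positivity
  simp only [one_pow, inv_one, mul_one]
  rw [div_eq_mul_inv]
  linarith

theorem Mn.H1_bound {l lp lm : ℝ} (hl : 0 < l) (hl2 : l < 2 * Real.pi) (hp : 0 ≤ lp) (hm : 0 ≤ lm) :
    ∃ M : ℝ, 0 ≤ M ∧ ∀ v, Mn l lp lm v → deff l lp lm v ≤ 1 → tau l v 1 ≤ M ∧ ∀ θ, |v 1 θ| ≤ M := by
  obtain ⟨α, hα, hα2⟩ := exists_between (show 1 < 2 * Real.pi / l by rw [lt_div_iff₀ hl]; linarith)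
  have hαl : α * l < 2 * Real.pi := by rwa [lt_div_iff₀ hl] at hα2
  have hα0 : 0 < α := by linarith
  have hΛ : 0 ≤ max lp lm := hp.trans (le_max_left _ _)
  set B := 1 + max lp lm * l / 2 with hB
  have hB0 : 0 ≤ B := by positivity
  set k := (1 - 1 / α) ^ 2 with hk
  have hk0 : 0 < k := by
    have : 1 / α < 1 := by rw [div_lt_one hα0]; exact hα
    have : 0 < 1 - 1 / α := by linarith
    positivity
  set T := 2 * B / k with hT
  have hT0 : 0 ≤ T := by positivity
  refine ⟨T + Real.sqrt (2 * B / l) + Real.sqrt (l * T), by positivity, fun v h hd => ?_⟩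
  have h2 := h.harm hl hp hm hα.le (mean l (v 1))
  have h3 := wirtinger hl (h.gl.tr 1) hα0 hαl
  have hg := h.gl.tr 1
  have h4 := mean_sq hl hg.cont (mean l (v 1))
  unfold deff at hd
  rw [hg.hom_eq] at hd
  have ha : 0 ≤ ∫ θ in (0:ℝ)..l, ar lp lm (v 1 θ) := intervalIntegral.integral_nonneg hl.le fun _ _ => ar_nonneg hp hm _
  change _ ≤ tau l v 1 at h3
  change _ ≤ _ + 1 / (2 * α) * tau l v 1 + _ at h2
  change 1 / 2 * (_ + tau l v 1 + _) - _ ≤ _ at hd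
  set m := mean l (v 1)
  set X := ∫ θ in (0:ℝ)..l, (v 1 θ - m) ^ 2
  set G := ∫ θ in (0:ℝ)..l, v 1 θ ^ 2
  set E := En l lp lm v 1
  have hX : 0 ≤ X := intervalIntegral.integral_nonneg hl.le fun _ _ => sq_nonneg _
  have h5 : 1 / 2 * (X + m ^ 2 * l + tau l v 1) ≤ B + α / 2 * X + 1 / (2 * α) * tau l v 1 := by
    have : G = X + m ^ 2 * l := by linarith
    rw [← this, hB]; linarith
  have h6 : (α - 1) / 2 * X ≤ (α - 1) / (2 * α ^ 2) * tau l v 1 := by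
    have := mul_le_mul_of_nonneg_left h3 (by apply div_nonneg <;> nlinarith : 0 ≤ (α - 1) / (2 * α ^ 2))
    refine le_trans (le_of_eq ?_) this
    field_simp
  have h7 : m ^ 2 * l + k * tau l v 1 ≤ 2 * B := by
    have e : k = 1 - 1 / α - (α - 1) / α ^ 2 := by rw [hk]; field_simp
    have e2 : (α - 1) / (2 * α ^ 2) = ((α - 1) / α ^ 2) / 2 := by field_simp
    have e3 : 1 / (2 * α) = (1 / α) / 2 := by field_simp
    rw [e2] at h6; rw [e3] at h5
    rw [e]; linarith
  have hml : 0 ≤ m ^ 2 * l := by positivity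
  have htn := tau_nonneg hl.le v 1
  have htau : tau l v 1 ≤ T := by rw [hT, le_div_iff₀ hk0]; linarith
  refine ⟨by linarith [Real.sqrt_nonneg (2 * B / l), Real.sqrt_nonneg (l * T)], fun θ => ?_⟩
  obtain ⟨θ0, -, h0⟩ := exists_le_of_int (f := v 1) (M := m) (a := 0) (b := l) hl (hg.cont.intervalIntegrable _ _) (by
    simp only [m, mean]; field_simp; try simp)
  obtain ⟨θ1, -, h1⟩ := exists_le_of_int (f := fun x => - v 1 x) (M := -m) (a := 0) (b := l) hl (hg.cont.neg.intervalIntegrable _ _) (by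
    rw [intervalIntegral.integral_neg]; simp only [m, mean]; field_simp; try simp)
  have hm2 : |m| ≤ Real.sqrt (2 * B / l) := by
    apply Real.abs_le_sqrt
    rw [le_div_iff₀ hl]
    nlinarith [mul_nonneg hk0.le htn]
  have ho : ∀ x y, v 1 x - v 1 y ≤ Real.sqrt (l * T) := by
    intro x y
    have := hg.osc_all hl x y
    change _ ≤ l * tau l v 1 at this
    have h8 : (v 1 x - v 1 y) ^ 2 ≤ l * T := this.trans (by gcongr)
    exact (le_abs_self _).trans (Real.abs_le_sqrt h8)
  have := ho θ θ0
  have := ho θ1 θ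
  have := abs_le.1 hm2
  rw [abs_le]
  constructor <;> linarith

/-! ### Non-degeneracy -/

/-- energy density on the positive phase -/
def pd (lp : ℝ) (u : ℝ → ℝ → ℝ) (p : ℝ × ℝ) : ℝ := if 0 < u p.1 p.2 then (gradSq u p + lp) * p.1 else 0

theorem GLp.bm_pd {l : ℝ} {u : ℝ → ℝ → ℝ} (h : GLp l u) (lp : ℝ) : BM (pd lp u) := by
  have hS : MeasurableSet {p : ℝ × ℝ | 0 < u p.1 p.2} := measurableSet_lt measurable_const h.bm_u.meas
  have := ((h.bm_grad.add (BM.const lp)).mul BM.fst).indicator hS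
  convert this using 1
  ext p
  simp only [pd, indicator, mem_setOf_eq]

theorem pd_nonneg {lp : ℝ} (hp : 0 ≤ lp) (u : ℝ → ℝ → ℝ) {p : ℝ × ℝ} (h : 0 ≤ p.1) : 0 ≤ pd lp u p := by
  unfold pd
  split_ifs
  · exact mul_nonneg (add_nonneg (gradSq_nonneg _ _) hp) h
  · exact le_rfl

/-- Energy of the positive phase. -/
def Fp (l lp : ℝ) (u : ℝ → ℝ → ℝ) (R : ℝ) : ℝ := I2 l (pd lp u) R

theorem Fp_mono {l lp : ℝ} (hp : 0 ≤ lp) {u : ℝ → ℝ → ℝ} (h : GLp l u) {R R' : ℝ} (hR : R ≤ R') (hR' : R' ≤ 1) :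
    Fp l lp u R ≤ Fp l lp u R' :=
  I2_mono_set (h.bm_pd lp) hR hR' fun p hpQ => pd_nonneg hp u hpQ.1.1.le

theorem Fp_sc {l lp : ℝ} (hl : 0 ≤ l) {u : ℝ → ℝ → ℝ} (h : GLp l u) {r R : ℝ} (hr : 0 < r)
    (hr1 : r ≤ 1) (hR0 : 0 ≤ R) (hR : R ≤ 1) :
    Fp l lp (sc r u) R = Fp l lp u (r * R) / r ^ 2 := by
  unfold Fp
  rw [I2_eq ((h.sc hr).bm_pd lp) hl hR0 hR, I2_eq (h.bm_pd lp) hl (by positivity) (by nlinarith)]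
  have : ∀ s, sl l (pd lp (sc r u)) s = r⁻¹ * sl l (pd lp u) (r * s) := by
    intro s
    unfold sl
    rw [← intervalIntegral.integral_const_mul]
    congr 1; ext θ
    unfold pd
    rw [gradSq_sc u hr]
    have : 0 < sc r u s θ ↔ 0 < u (r * s) θ := by unfold sc; exact div_pos_iff_of_pos_right hr
    simp only [this]
    split_ifs
    · field_simp
    · simp
  simp only [this]
  rw [intervalIntegral.integral_const_mul, intervalIntegral.integral_comp_mul_left _ hr.ne']
  simp; field_simp

theorem Fp_le_En {l lp lm : ℝ} (hp : 0 ≤ lp) (hm : 0 ≤ lm) {u : ℝ → ℝ → ℝ} (h : GLp l u) :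
    Fp l lp u 1 ≤ En l lp lm u 1 := by
  rw [En_I2]
  refine I2_mono (h.bm_pd lp) ((h.bm_ed lp lm).mul BM.fst) le_rfl fun p hpQ => ?_
  have hp1 : 0 < p.1 := hpQ.1.1
  unfold pd ed
  split_ifs with h0
  · rw [ar_pos h0]
  · exact mul_nonneg (add_nonneg (gradSq_nonneg _ _) (ar_nonneg hp hm _)) hp1.le

theorem deriv_sq_le_of_touch {f g : ℝ → ℝ} {x g' : ℝ} (hg : HasDerivAt g g' x) (he : f x = g x)
    (hle : ∀ᶠ y in nhds x, f y ≤ g y) : deriv f x ^ 2 ≤ g' ^ 2 := by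
  by_cases hf : DifferentiableAt ℝ f x
  · have hd := hf.hasDerivAt.sub hg
    have hm : IsLocalMax (f - g) x := by
      filter_upwards [hle] with y hy
      simp only [Pi.sub_apply, he]; linarith
    have := hm.hasDerivAt_eq_zero hd
    have : deriv f x = g' := by linarith
    rw [this]
  · rw [deriv_zero_of_not_differentiableAt hf]; simp; positivity

theorem ramp_lip {G a t : ℝ} (hG : 0 ≤ G) (ht : 0 < t) (x y : ℝ) :
    |G * max ((x - a) / t) 0 - G * max ((y - a) / t) 0| ≤ G / t * |x - y| := by
  rw [← mul_sub, abs_mul, abs_of_nonneg hG, div_mul_eq_mul_div, mul_div_assoc]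
  gcongr
  refine (abs_max_sub_max_le_abs _ _ _).trans (le_of_eq ?_)
  rw [← sub_div, abs_div, abs_of_pos ht]; congr 2; ring

theorem GLp.of_rad {l : ℝ} {ψ : ℝ → ℝ} {K : ℝ} (hK : 0 ≤ K) (h : ∀ x y, |ψ x - ψ y| ≤ K * |x - y|) :
    GLp l (fun s _ => ψ s) :=
  ⟨fun _ _ => rfl, K, hK, fun θ s s' => h s s', fun s θ θ' => by simp; positivity⟩

theorem Mn.nd_unit {l lp lm : ℝ} (hl : 0 < l) (hp : 0 < lp) (hm : 0 ≤ lm) {v : ℝ → ℝ → ℝ}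
    (h : Mn l lp lm v) {G t : ℝ} (hG : 0 < G) (ht : 0 < t) (ht1 : t < 1) (hv : ∀ θ, v 1 θ ≤ G) :
    Fp l lp v (1 - t) ≤ G ^ 2 / (t ^ 2 * lp) * Fp l lp v 1 := by
  let ψ : ℝ → ℝ := fun s => G * max ((s - (1 - t)) / t) 0
  have hψ : GLp l (fun s _ => ψ s) := GLp.of_rad (by positivity) (ramp_lip hG.le ht)
  let w : ℝ → ℝ → ℝ := fun s θ => min (v s θ) (ψ s)
  have hw : GLp l w := h.gl.min hψ
  have h1 := h.le w hw.toRL (fun θ => by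
    simp only [w, ψ]
    rw [show (1 - (1 - t)) / t = 1 by field_simp; ring]
    simpa using hv θ)
  have bu := (h.gl.bm_ed lp lm).mul BM.fst
  have bp := h.gl.bm_pd lp
  have hS : MeasurableSet {p : ℝ × ℝ | p.1 < 1 - t} := measurableSet_lt measurable_fst measurable_const
  have bi := bp.indicator hS
  have bc := bp.cmul (G ^ 2 / (t ^ 2 * lp))
  have hne : ∀ᵐ p : ℝ × ℝ, p.1 ≠ 1 - t := by
    have : (volume : Measure (ℝ × ℝ)) {p | ¬ p.1 ≠ 1 - t} = 0 := by
      have e : {p : ℝ × ℝ | ¬ p.1 ≠ 1 - t} = {1 - t} ×ˢ univ := by ext p; simp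
      rw [e, Measure.volume_eq_prod, Measure.prod_prod]; simp
    exact this
  have h2 := En_le hp.le hm (l := l) (R := 1) (w := w) le_rfl ((bu.sub bi).add bc) (by
    filter_upwards [hne] with p hpn hpQ
    have hp1 : 0 < p.1 := hpQ.1.1
    have hpd := pd_nonneg hp.le v hp1.le
    have hgp := gradSq_nonneg v p
    have harp := ar_nonneg hp.le hm (v p.1 p.2)
    have hcoef : 0 ≤ G ^ 2 / (t ^ 2 * lp) := by positivity
    rcases lt_or_gt_of_ne hpn with hlt | hgt
    · rw [indicator_of_mem (by exact hlt)]
      have hψ0 : ∀ s, s < 1 - t → ψ s = 0 := fun s hs => by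
        simp only [ψ]; rw [max_eq_right (div_nonpos_of_nonpos_of_nonneg (by linarith) ht.le), mul_zero]
      have ev : ∀ᶠ q : ℝ × ℝ in nhds p, q.1 < 1 - t := (continuous_fst.tendsto p).eventually_lt_const hlt
      have hwp : w p.1 p.2 = min (v p.1 p.2) 0 := by simp only [w, hψ0 _ hlt]
      have hmax : 0 ≤ v p.1 p.2 → gradSq w p = 0 := by
        intro h0
        apply gradSq_max
        filter_upwards [ev] with q hq
        rw [hwp, min_eq_right h0]
        simp only [w, hψ0 _ hq]
        exact min_le_right _ _
      suffices hs : ed lp lm w p * p.1 ≤ ed lp lm v p * p.1 - pd lp v p by nlinarith [mul_nonneg hcoef hpd]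
      unfold ed pd
      rw [hwp]
      rcases lt_trichotomy (v p.1 p.2) 0 with hv0 | hv0 | hv0
      · rw [if_neg (by linarith), min_eq_left hv0.le]
        have e1 : gradSq w p = gradSq v p := by
          apply gradSq_local
          filter_upwards [ev, h.gl.ev_lt (GLp.const 0) hv0] with q hq hq2
          simp only [w, hψ0 _ hq, min_eq_left hq2.le]
        rw [e1]; linarith
      · rw [hmax hv0.ge, hv0]; simp [ar_zero]; positivity
      · rw [if_pos hv0, hmax hv0.le, min_eq_right hv0.le, ar_zero, ar_pos hv0]; linarith
    · rw [indicator_of_notMem (by simp only [mem_setOf_eq, not_lt]; exact le_of_lt hgt)]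
      have hψp : 0 < ψ p.1 := by
        have : 0 < (p.1 - (1 - t)) / t := div_pos (by linarith) ht
        simp only [ψ]; rw [max_eq_left this.le]; positivity
      rcases lt_or_ge (v p.1 p.2) (ψ p.1) with hlt | hge
      · have e1 : gradSq w p = gradSq v p := by
          apply gradSq_local
          filter_upwards [h.gl.ev_lt hψ hlt] with q hq
          simp only [w, min_eq_left hq.le]
        have e2 : w p.1 p.2 = v p.1 p.2 := min_eq_left hlt.le
        unfold ed
        rw [e1, e2]
        nlinarith [mul_nonneg hcoef hpd]
      · have hv0 : 0 < v p.1 p.2 := by linarith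
        have e2 : w p.1 p.2 = ψ p.1 := min_eq_right hge
        have hd : HasDerivAt ψ (G / t) p.1 := by
          have : HasDerivAt (fun s => G * ((s - (1 - t)) / t)) (G / t) p.1 := by
            refine ((((hasDerivAt_id p.1).sub_const (1 - t)).div_const t).const_mul G).congr_deriv ?_
            ring
          refine this.congr_of_eventuallyEq ?_
          filter_upwards [lt_mem_nhds hgt] with s hs
          simp only [ψ]; rw [max_eq_left (div_nonneg (by linarith) ht.le)]
        have g1 : dr w p ^ 2 ≤ (G / t) ^ 2 := by
          unfold dr
          exact deriv_sq_le_of_touch hd e2 (Filter.Eventually.of_forall fun s => min_le_right _ _)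
        have g2 : tn w p = 0 := by
          unfold tn dt
          have : IsLocalMax (fun φ => w p.1 φ) p.2 := by
            filter_upwards with φ
            rw [e2]; exact min_le_right _ _
          rw [this.deriv_eq_zero, zero_div]
        have e3 : G ^ 2 / (t ^ 2 * lp) * ((gradSq v p + lp) * p.1) = (G ^ 2 / (t ^ 2 * lp) * gradSq v p + (G / t) ^ 2) * p.1 := by
          field_simp
        unfold ed pd
        rw [if_pos hv0, gradSq_eq w, g2, e2, ar_pos hψp, ar_pos hv0, e3]
        have : 0 ≤ G ^ 2 / (t ^ 2 * lp) * gradSq v p := mul_nonneg hcoef hgp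
        nlinarith)
  rw [I2_add (bu.sub bi) bc le_rfl, I2_sub bu bi le_rfl, I2_cmul, ← En_I2] at h2
  have e4 : I2 l ({p : ℝ × ℝ | p.1 < 1 - t}.indicator (pd lp v)) 1 = Fp l lp v (1 - t) := by
    unfold Fp I2
    rw [setIntegral_indicator hS]
    congr 2
    unfold Q
    ext p
    simp only [mem_inter_iff, mem_prod, mem_Ioo, mem_setOf_eq]
    constructor
    · rintro ⟨⟨⟨a, b⟩, c⟩, d⟩; exact ⟨⟨a, d⟩, c⟩
    · rintro ⟨⟨a, b⟩, c⟩; exact ⟨⟨⟨a, by linarith⟩, c⟩, b⟩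
  rw [e4] at h2
  unfold Fp at *
  linarith

theorem Mn.nd_circle {l lp : ℝ} (hl : 0 < l) (hp : 0 < lp) {v : ℝ → ℝ → ℝ}
    (h : GLp l v) {s j : ℝ} (hs : 1 / 2 ≤ s) (hs1 : s ≤ 1) (hj : sl l (pd lp v) s ≤ j) (hj2 : j < lp * l / 2) :
    ∀ θ, v s θ ≤ j / (2 * Real.sqrt lp) := by
  have hs0 : 0 < s := by linarith
  have hsm : s ∈ Icc (0:ℝ) 1 := ⟨hs0.le, hs1⟩
  have bp := h.bm_pd lp
  have hj0 : 0 ≤ sl l (pd lp v) s := intervalIntegral.integral_nonneg hl.le fun θ _ => pd_nonneg hp.le v hs0.le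
  obtain ⟨z, hz⟩ : ∃ z, v s z ≤ 0 := by
    by_contra! hcon
    have : ∫ θ in (0:ℝ)..l, lp * s ≤ sl l (pd lp v) s := by
      apply intervalIntegral.integral_mono_on hl.le (by simp) (bp.intθ hsm 0 l)
      intro θ _
      unfold pd
      rw [if_pos (hcon θ)]
      simp only
      nlinarith [gradSq_nonneg v (s, θ)]
    simp at this
    nlinarith [mul_pos hl hp]
  have hT := h.tr s
  let g : ℝ → ℝ := fun θ => max (v s θ) 0
  have hg : Tr l g := by
    obtain ⟨K, hK, h1⟩ := hT.lip
    refine ⟨fun θ => by simp only [g, hT.per], K, hK, fun x y => ?_⟩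
    exact (abs_max_sub_max_le_abs _ _ _).trans (h1 x y)
  have hlp : 0 < Real.sqrt lp := Real.sqrt_pos.2 hp
  have hder : ∀ θ, 2 * Real.sqrt lp * |deriv g θ| ≤ pd lp v (s, θ) := by
    intro θ
    rcases le_or_gt (v s θ) 0 with h0 | h0
    · have hm : IsLocalMin g θ := by
        filter_upwards with y
        simp only [g, max_eq_right h0]; exact le_max_right _ _
      rw [hm.deriv_eq_zero]; simp
      exact pd_nonneg hp.le v hs0.le
    · have e : g =ᶠ[nhds θ] fun y => v s y := by
        filter_upwards [(hT.cont.tendsto θ).eventually_const_lt h0] with y hy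
        simp only [g, max_eq_left (le_of_lt hy)]
      rw [e.deriv_eq]
      unfold pd
      rw [if_pos h0]
      unfold gradSq
      simp only
      set d := deriv (fun y => v s y) θ
      have e2 : (deriv (fun s => v s θ) s ^ 2 + d ^ 2 / s ^ 2 + lp) * s = deriv (fun s => v s θ) s ^ 2 * s + (|d| - Real.sqrt lp * s) ^ 2 / s + 2 * Real.sqrt lp * |d| := by
        have := Real.sq_sqrt hp.le
        rw [← sq_abs d, ← this]
        rw [Real.sqrt_sq hlp.le]
        field_simp; ring
      rw [e2]
      have : 0 ≤ deriv (fun s => v s θ) s ^ 2 * s + (|d| - Real.sqrt lp * s) ^ 2 / s := by positivity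
      linarith
  intro x
  have hx := toIcoMod_mem_Ico hl z x
  have h7 := per_int hg.per (toIcoDiv hl z x) (toIcoMod hl z x)
  have h8 := toIcoMod_add_toIcoDiv_zsmul hl z x
  rw [zsmul_eq_mul] at h8
  rw [h8] at h7
  refine (le_max_left (v s x) 0).trans ?_
  change g x ≤ _
  rw [h7]
  set y := toIcoMod hl z x
  have hgz : g z = 0 := max_eq_right hz
  have e1 : g y = ∫ θ in z..y, deriv g θ := by
    rw [(hg.ac z y).integral_deriv_eq_sub, hgz, sub_zero]
  have e2 : ∫ θ in z..y, deriv g θ ≤ ∫ θ in z..y, |deriv g θ| :=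
    intervalIntegral.integral_mono_on hx.1 (hg.int_d _ _) (hg.int_d _ _).abs fun θ _ => le_abs_self _
  have e3 : ∫ θ in z..y, |deriv g θ| ≤ ∫ θ in z..(z + l), |deriv g θ| :=
    intervalIntegral.integral_mono_interval le_rfl hx.1 hx.2.le
      (Filter.Eventually.of_forall fun _ => abs_nonneg _) (hg.int_d _ _).abs
  have hper : Function.Periodic (fun x => |deriv g x|) l := fun x => by simp only [hg.dper]
  have e4 : ∫ θ in z..(z + l), |deriv g θ| = ∫ θ in (0:ℝ)..l, |deriv g θ| := by
    rw [hper.intervalIntegral_add_eq z 0, zero_add]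
  have e5 : ∫ θ in (0:ℝ)..l, (2 * Real.sqrt lp) * |deriv g θ| ≤ sl l (pd lp v) s :=
    intervalIntegral.integral_mono_on hl.le ((hg.int_d _ _).abs.const_mul _) (bp.intθ hsm 0 l) fun θ _ => hder θ
  rw [intervalIntegral.integral_const_mul] at e5
  rw [le_div_iff₀ (by positivity)]
  nlinarith

theorem Mn.nd_step {l lp lm : ℝ} (hl : 0 < l) (hp : 0 < lp) (hm : 0 ≤ lm) {v : ℝ → ℝ → ℝ}
    (h : Mn l lp lm v) {Φ t : ℝ} (hΦ0 : 0 < Φ) (ht : 0 < t) (ht1 : t ≤ 1 / 2) (hΦ : Fp l lp v 1 ≤ Φ)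
    (hs : Φ < lp * l * t / 2) : Fp l lp v (1 - 2 * t) ≤ Φ ^ 3 / (t ^ 4 * lp ^ 2) := by
  have bp := h.gl.bm_pd lp
  have hi : ∀ a ∈ Icc (0:ℝ) 1, ∀ b ∈ Icc (0:ℝ) 1, IntervalIntegrable (sl l (pd lp v)) volume a b := fun a ha b hb => bp.int_sl hl.le ha hb
  have m0 : (0:ℝ) ∈ Icc (0:ℝ) 1 := by simp
  have m1 : 1 - t ∈ Icc (0:ℝ) 1 := ⟨by linarith, by linarith⟩
  have m2 : (1:ℝ) ∈ Icc (0:ℝ) 1 := by simp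
  have hF : Fp l lp v 1 = ∫ x in (0:ℝ)..1, sl l (pd lp v) x := I2_eq bp hl.le zero_le_one le_rfl
  have hsum := intervalIntegral.integral_add_adjacent_intervals (hi 0 m0 _ m1) (hi _ m1 _ m2)
  have hpos : 0 ≤ ∫ x in (0:ℝ)..(1 - t), sl l (pd lp v) x := intervalIntegral.integral_nonneg (by linarith) fun x hx =>
    intervalIntegral.integral_nonneg hl.le fun θ _ => pd_nonneg hp.le v hx.1
  obtain ⟨s, hs', hj⟩ := exists_le_of_int (M := Φ / t) (by linarith : 1 - t < 1) (hi _ m1 _ m2) (by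
    have : Φ / t * (1 - (1 - t)) = Φ := by field_simp; ring
    linarith)
  have hs0 : 1 / 2 ≤ s := by linarith [hs'.1]
  have hs1 := hs'.2.le
  have hs00 : 0 < s := by linarith
  have hc := Mn.nd_circle hl hp h.gl hs0 hs1 hj (by rw [div_lt_iff₀ ht]; linarith)
  have hlp : 0 < Real.sqrt lp := Real.sqrt_pos.2 hp
  have hu := (h.sc hl.le hs00 hs1).nd_unit hl hp hm (G := Φ / (t * Real.sqrt lp)) (by positivity) ht (by linarith) (fun θ => by
    unfold _root_.sc
    rw [mul_one, div_le_iff₀ hs00]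
    refine (hc θ).trans ?_
    have : Φ / t / (2 * Real.sqrt lp) = Φ / (t * Real.sqrt lp) * (1 / 2) := by field_simp
    rw [this]; gcongr)
  rw [Fp_sc hl.le h.gl hs00 hs1 (by linarith) (by linarith), Fp_sc hl.le h.gl hs00 hs1 zero_le_one le_rfl, mul_one, ← mul_div_assoc] at hu
  rw [div_le_div_iff_of_pos_right (by positivity)] at hu
  have h1 : Fp l lp v (1 - 2 * t) ≤ Fp l lp v (s * (1 - t)) := Fp_mono hp.le h.gl (by nlinarith [hs'.1]) (by nlinarith)
  have h2 : Fp l lp v s ≤ Φ := (Fp_mono hp.le h.gl hs1 le_rfl).trans hΦ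
  refine h1.trans (hu.trans ?_)
  have e : (Φ / (t * Real.sqrt lp)) ^ 2 / (t ^ 2 * lp) = Φ ^ 2 / (t ^ 4 * lp ^ 2) := by
    rw [div_pow, mul_pow, Real.sq_sqrt hp.le]; field_simp
  rw [e]
  calc Φ ^ 2 / (t ^ 4 * lp ^ 2) * Fp l lp v s ≤ Φ ^ 2 / (t ^ 4 * lp ^ 2) * Φ := by gcongr
    _ = _ := by ring

theorem Mn.nondeg {l lp lm : ℝ} (hl : 0 < l) (hp : 0 < lp) (hm : 0 ≤ lm) :
    ∃ η : ℝ, 0 < η ∧ ∀ v, Mn l lp lm v → En l lp lm v 1 ≤ η → ∀ s ∈ Icc (0:ℝ) (1 / 2), ∀ θ, v s θ ≤ 0 := by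
  set η := min (lp / 2 ^ 10) (lp * l / 2 ^ 7) with hη
  have hη0 : 0 < η := by positivity
  have hη1 : η ≤ lp / 2 ^ 10 := min_le_left _ _
  have hη2 : η ≤ lp * l / 2 ^ 7 := min_le_right _ _
  refine ⟨η, hη0, fun v h hE => ?_⟩
  have hk : ∀ k : ℕ, Fp l lp v (1 / 2 + (1 / 2) ^ (k + 1)) ≤ η * (1 / 4) ^ k := by
    intro k
    induction k with
    | zero => norm_num; exact (Fp_le_En hp.le hm h.gl).trans hE
    | succ k ih =>
      set x : ℝ := (1 / 2) ^ k with hx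
      have hx0 : 0 < x := by positivity
      have hx1 : x ≤ 1 := pow_le_one₀ (by norm_num) (by norm_num)
      have e4 : (1 / 4 : ℝ) ^ k = x ^ 2 := by rw [hx, ← pow_mul, mul_comm, pow_mul]; norm_num
      rw [e4] at ih
      rw [show (1 / 2 : ℝ) ^ (k + 1) = x * (1 / 2) from by rw [pow_succ]] at ih
      rw [show (1 / 2 : ℝ) ^ (k + 1 + 1) = x * (1 / 2) * (1 / 2) from by rw [pow_succ, pow_succ],
        show (1 / 4 : ℝ) ^ (k + 1) = x ^ 2 * (1 / 4) from by rw [pow_succ, e4]]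
      set r := 1 / 2 + x * (1 / 2) with hr
      have hr0 : 1 / 2 ≤ r := by linarith
      have hr1 : r ≤ 1 := by linarith
      have hrp : 0 < r := by linarith
      have hst := (h.sc hl.le hrp hr1).nd_step hl hp hm (Φ := 4 * (η * x ^ 2)) (t := x / 8) (by positivity)
        (by positivity) (by linarith) (by
          rw [Fp_sc hl.le h.gl hrp hr1 zero_le_one le_rfl, mul_one, div_le_iff₀ (by positivity)]
          have : 0 < η * x ^ 2 := by positivity
          nlinarith [mul_le_mul hr0 hr0 (by norm_num) hrp.le]) (by
          have h1 : η * x ^ 2 ≤ η * x := by gcongr; nlinarith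
          have h2 : η * x ≤ lp * l / 2 ^ 7 * x := by gcongr
          have h3 : 0 < lp * l * x := by positivity
          nlinarith)
      rw [Fp_sc hl.le h.gl hrp hr1 (by linarith) (by linarith), div_le_iff₀ (by positivity)] at hst
      have h1 : Fp l lp v (1 / 2 + x * (1 / 2) * (1 / 2)) ≤ Fp l lp v (r * (1 - 2 * (x / 8))) :=
        Fp_mono hp.le h.gl (by rw [hr]; nlinarith) (by nlinarith)
      refine h1.trans (hst.trans ?_)
      have e5 : (4 * (η * x ^ 2)) ^ 3 / ((x / 8) ^ 4 * lp ^ 2) = (2 ^ 18 * η ^ 2 / lp ^ 2) * (η * x ^ 2) := by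
        field_simp; ring
      rw [e5]
      have h6 : 2 ^ 18 * η ^ 2 / lp ^ 2 ≤ 1 / 4 := by
        rw [div_le_iff₀ (by positivity)]
        have : 2 ^ 10 * η ≤ lp := by linarith
        nlinarith
      have h7 : 0 ≤ η * x ^ 2 := by positivity
      have h8 : r ^ 2 ≤ 1 := by nlinarith
      calc 2 ^ 18 * η ^ 2 / lp ^ 2 * (η * x ^ 2) * r ^ 2 ≤ 1 / 4 * (η * x ^ 2) * 1 := by gcongr
        _ = η * (x ^ 2 * (1 / 4)) := by ring
  have hF : Fp l lp v (1 / 2) ≤ 0 := by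
    have ht : Filter.Tendsto (fun k : ℕ => η * (1 / 4 : ℝ) ^ k) Filter.atTop (nhds (η * 0)) :=
      (tendsto_pow_atTop_nhds_zero_of_lt_one (by norm_num) (by norm_num)).const_mul η
    rw [mul_zero] at ht
    refine ge_of_tendsto' ht fun k => ?_
    refine (Fp_mono hp.le h.gl (by simp) ?_).trans (hk k)
    have : (1 / 2 : ℝ) ^ (k + 1) ≤ 1 / 2 := by
      rw [pow_succ]; have := pow_le_one₀ (n := k) (by norm_num : (0:ℝ) ≤ 1 / 2) (by norm_num); linarith
    linarith
  have hw : GLp l (fun s θ => max (v s θ) 0) := h.gl.max (GLp.const 0)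
  obtain ⟨S, hS0, hS⟩ := h.gl.bm_u.bdd
  have hz := zero_of_I2 hl hw (R := 1 / 2) (by norm_num) (by norm_num) (by
    have : I2 l (fun p => max (v p.1 p.2) 0 ^ 2 * p.1) (1 / 2) ≤ I2 l (fun p => S ^ 2 / lp * pd lp v p) (1 / 2) := by
      refine I2_mono (hw.bm_u.pow2.mul BM.fst) ((h.gl.bm_pd lp).cmul _) (by norm_num) fun p hpQ => ?_
      have hp1 : 0 < p.1 := hpQ.1.1
      unfold pd
      split_ifs with h0
      · rw [max_eq_left h0.le]
        have h2 := hS p.1 ⟨hp1.le, by linarith [hpQ.1.2]⟩ p.2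
        have h3 : v p.1 p.2 ^ 2 ≤ S ^ 2 := by rw [← sq_abs]; gcongr
        have h4 : S ^ 2 / lp * ((gradSq v p + lp) * p.1) = S ^ 2 / lp * gradSq v p * p.1 + S ^ 2 * p.1 := by field_simp
        rw [h4]
        have := gradSq_nonneg v p
        have : 0 ≤ S ^ 2 / lp * gradSq v p * p.1 := by positivity
        nlinarith
      · rw [max_eq_right (not_lt.1 h0)]; simp
    refine this.trans ?_
    rw [I2_cmul]
    exact mul_nonpos_of_nonneg_of_nonpos (by positivity) hF)
  intro s hs θ
  have := hz s hs θ
  exact max_eq_right_iff.1 this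

/-! ### T9: Harnack-type dichotomy for one-signed minimizers -/

theorem GLp.mul_bdd {l : ℝ} {u v : ℝ → ℝ → ℝ} (hu : GLp l u) (hv : GLp l v) {A B : ℝ}
    (hA : ∀ s θ, |u s θ| ≤ A) (hB : ∀ s θ, |v s θ| ≤ B) : GLp l (fun s θ => u s θ * v s θ) := by
  obtain ⟨K, hK, h1, h2⟩ := hu.lip
  obtain ⟨M, hM, h3, h4⟩ := hv.lip
  have hA0 : 0 ≤ A := (abs_nonneg _).trans (hA 0 0)
  have hB0 : 0 ≤ B := (abs_nonneg _).trans (hB 0 0)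
  have key : ∀ a a' b b' : ℝ, |a * b - a' * b'| ≤ |a| * |b - b'| + |b'| * |a - a'| := by
    intro a a' b b'
    rw [show a * b - a' * b' = a * (b - b') + b' * (a - a') by ring]
    exact (abs_add_le _ _).trans (by rw [abs_mul, abs_mul])
  refine ⟨fun r θ => by simp only [hu.per, hv.per], A * M + B * K, by positivity, fun θ s s' => ?_, fun s θ θ' => ?_⟩
  · refine (key _ _ _ _).trans ?_
    calc _ ≤ A * (M * |s - s'|) + B * (K * |s - s'|) := by
          gcongr
          · exact hA _ _
          · exact h3 _ _ _
          · exact hB _ _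
          · exact h1 _ _ _
      _ = _ := by ring
  · refine (key _ _ _ _).trans ?_
    calc _ ≤ A * (M * |s| * |θ - θ'|) + B * (K * |s| * |θ - θ'|) := by
          gcongr
          · exact hA _ _
          · exact h4 _ _ _
          · exact hB _ _
          · exact h2 _ _ _
      _ = _ := by ring

theorem GLp.comp_lip {l : ℝ} {u : ℝ → ℝ → ℝ} (hu : GLp l u) {f : ℝ → ℝ} {S : Set ℝ} {C : ℝ} (hC : 0 ≤ C)
    (hf : ∀ x ∈ S, ∀ y ∈ S, |f x - f y| ≤ C * |x - y|) (hS : ∀ s θ, u s θ ∈ S) :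
    GLp l (fun s θ => f (u s θ)) := by
  obtain ⟨K, hK, h1, h2⟩ := hu.lip
  refine ⟨fun r θ => by simp only [hu.per], C * K, by positivity, fun θ s s' => ?_, fun s θ θ' => ?_⟩
  · refine (hf _ (hS _ _) _ (hS _ _)).trans ?_
    rw [mul_assoc]; gcongr; exact h1 _ _ _
  · refine (hf _ (hS _ _) _ (hS _ _)).trans ?_
    rw [mul_assoc, mul_assoc]; gcongr; rw [← mul_assoc]; exact h2 _ _ _

theorem inv_lip {τ : ℝ} (hτ : 0 < τ) : ∀ x ∈ Ici τ, ∀ y ∈ Ici τ, |x⁻¹ - y⁻¹| ≤ (1 / τ ^ 2) * |x - y| := by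
  intro x hx y hy
  have hx' : τ ≤ x := hx
  have hy' : τ ≤ y := hy
  have hx0 : 0 < x := by linarith
  have hy0 : 0 < y := by linarith
  rw [show x⁻¹ - y⁻¹ = (1 / (x * y)) * (y - x) by field_simp, abs_mul, abs_sub_comm y x,
    abs_of_nonneg (by positivity)]
  gcongr
  nlinarith

def chi (s : ℝ) : ℝ := min 1 (max 0 (2 * (1 - s)))

theorem chi_nonneg (s : ℝ) : 0 ≤ chi s := le_min zero_le_one (le_max_left _ _)
theorem chi_le (s : ℝ) : chi s ≤ 1 := min_le_left _ _
theorem chi_one : chi 1 = 0 := by simp [chi]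
theorem chi_eq {s : ℝ} (hs : s ≤ 1 / 2) : chi s = 1 := by
  unfold chi; rw [max_eq_right (by linarith), min_eq_left (by linarith)]
theorem chi_lip (x y : ℝ) : |chi x - chi y| ≤ 2 * |x - y| := by
  unfold chi
  refine (abs_min_sub_min_le_max _ _ _ _).trans ?_
  refine max_le (by simp) ?_
  refine (abs_max_sub_max_le_max _ _ _ _).trans ?_
  refine max_le (by simp) ?_
  rw [show 2 * (1 - x) - 2 * (1 - y) = 2 * (y - x) by ring, abs_mul, abs_sub_comm y x]
  simp

theorem Mn.caccio {l lp : ℝ} (hl : 0 < l) (hp : 0 ≤ lp) {u : ℝ → ℝ → ℝ} (h : Mn l lp 0 u)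
    (hu : ∀ s ∈ Icc (0:ℝ) 1, ∀ θ, u s θ ≤ 0) {τ : ℝ} (hτ : 0 < τ) {W : ℝ → ℝ → ℝ}
    (hW : W = fun s θ => max (-u s θ) 0 + τ) :
    I2 l (fun p => (chi p.1 ^ 2 * gradSq W p * (W p.1 p.2)⁻¹ ^ 2) * p.1) 1 ≤ 8 * l := by
  have gW : GLp l W := by rw [hW]; exact (h.gl.neg.max (GLp.const 0)).add (GLp.const τ)
  have hWτ : ∀ s θ, τ ≤ W s θ := fun s θ => by rw [hW]; simp
  have hW0 : ∀ s θ, 0 < W s θ := fun s θ => hτ.trans_le (hWτ s θ)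
  have hWu : ∀ s ∈ Icc (0:ℝ) 1, ∀ θ, u s θ = τ - W s θ := fun s hs θ => by
    rw [hW]; simp only; rw [max_eq_left (by linarith [hu s hs θ])]; ring
  have gI : GLp l (fun s θ => (W s θ)⁻¹) := gW.comp_lip (by positivity) (inv_lip hτ) (fun s θ => hWτ s θ)
  have gχ : GLp l (fun s _ => chi s) := GLp.of_rad (by norm_num) chi_lip
  have gχ2 : GLp l (fun s _ => chi s * chi s) := gχ.mul_bdd gχ (A := 1) (B := 1)
    (fun s _ => by rw [abs_of_nonneg (chi_nonneg s)]; exact chi_le s)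
    (fun s _ => by rw [abs_of_nonneg (chi_nonneg s)]; exact chi_le s)
  set ξ : ℝ → ℝ → ℝ := fun s θ => (chi s * chi s) * (W s θ)⁻¹ with hξ
  have hξ0 : ∀ s θ, 0 ≤ ξ s θ := fun s θ => by
    have := hW0 s θ; have := chi_nonneg s; simp only [hξ]; positivity
  have gξ : GLp l ξ := gχ2.mul_bdd gI (A := 1) (B := τ⁻¹)
    (fun s _ => by
      rw [abs_of_nonneg (mul_nonneg (chi_nonneg s) (chi_nonneg s))]
      nlinarith [chi_le s, chi_nonneg s])
    (fun s θ => by rw [abs_of_nonneg (inv_nonneg.2 (hW0 s θ).le)]; exact inv_anti₀ hτ (hWτ s θ))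
  obtain ⟨K, hK, hK1, hK2, hK3⟩ := gξ.bddAll
  set F : ℝ × ℝ → ℝ := fun p => chi p.1 ^ 2 * gradSq W p * (W p.1 p.2)⁻¹ ^ 2 with hF
  have bF : BM F := (gχ.bm_u.pow2.mul gW.bm_grad).mul gI.bm_u.pow2
  have key : ∀ t, 0 < t → I2 l (fun p => F p * p.1) 1 ≤ 8 * l + t * (K ^ 2 * l) := by
    intro t ht
    set w : ℝ → ℝ → ℝ := fun s θ => τ - (W s θ + t * ξ s θ) with hw
    have gw : GLp l w := (GLp.const τ).sub (gW.add (gξ.cmul t))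
    have h1 := h.le w gw.toRL (fun θ => by
      simp only [hw, hξ, chi_one]; rw [hWu 1 (by simp)]; ring)
    have e1 : En l lp 0 u 1 = I2 l (fun p => gradSq W p * p.1) 1 := by
      rw [En_I2]
      refine I2_congr fun p hpQ => ?_
      have e : gradSq u p = gradSq W p := by
        rw [gradSq_congr (u := u) (w := fun s θ => - (W s θ - τ)) isOpen_Ioo
          (fun s (hs : s ∈ Ioo (0:ℝ) 1) θ => by rw [hWu s ⟨hs.1.le, hs.2.le⟩ θ]; ring) p hpQ.1,
          gradSq_neg]
        unfold gradSq
        simp only [deriv_sub_const]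
      have e' : ar lp 0 (u p.1 p.2) = 0 := by
        unfold ar; rw [if_neg (not_lt.2 (hu p.1 ⟨hpQ.1.1.le, hpQ.1.2.le⟩ p.2))]; simp
      simp only [ed, e, e', add_zero]
    set Φ : ℝ × ℝ → ℝ := fun p => (gradSq W p + (-t) * F p + (16 * t + 2 * t ^ 2 * K ^ 2)) * p.1 with hΦ
    have bΦ : BM Φ := ((gW.bm_grad.add (bF.cmul _)).add (BM.const _)).mul BM.fst
    have h2 : En l lp 0 w 1 ≤ I2 l Φ 1 := by
      refine En_le hp le_rfl le_rfl bΦ ?_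
      filter_upwards [gW.ae_dr, gW.ae_dt, gχ.ae_dr] with p d1 d2 d3 hpQ
      have hp1 : 0 < p.1 := hpQ.1.1
      have hps : p.1 ∈ Icc (0:ℝ) 1 := ⟨hp1.le, hpQ.1.2.le⟩
      have hWp := hW0 p.1 p.2
      have e' : ar lp 0 (w p.1 p.2) = 0 := by
        unfold ar
        rw [if_neg (not_lt.2 ?_)]
        · simp
        · simp only [hw]
          have := mul_nonneg ht.le (hξ0 p.1 p.2)
          have := hWτ p.1 p.2
          linarith
      set a := dr W p with ha
      set b := tn W p with hb
      set x := deriv chi p.1 with hx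
      have hxb : |x| ≤ 2 := abs_deriv_le (by norm_num) chi_lip _
      have D1 : HasDerivAt (fun s => W s p.2) a p.1 := d1.hasDerivAt
      have D2 : HasDerivAt (fun φ => W p.1 φ) (b * p.1) p.2 := by
        have := d2.hasDerivAt
        refine this.congr_deriv ?_
        rw [hb]; unfold tn dt; field_simp
      have D3 : HasDerivAt chi x p.1 := d3.hasDerivAt
      set c := chi p.1 with hc
      set y := (W p.1 p.2)⁻¹ with hy
      have A1 : HasDerivAt (fun s => ξ s p.2) (2 * c * x * y - c ^ 2 * a * y ^ 2) p.1 := by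
        refine ((D3.mul D3).mul (D1.inv hWp.ne')).congr_deriv ?_
        simp only [hy, Pi.mul_apply, ← hc, Pi.inv_apply]; field_simp; ring
      have B1 : HasDerivAt (fun φ => ξ p.1 φ) ((- (c ^ 2 * b * y ^ 2)) * p.1) p.2 := by
        refine ((D2.inv hWp.ne').const_mul (chi p.1 * chi p.1)).congr_deriv ?_
        simp only [hy, ← hc]; field_simp
      have A2 : dr ξ p = 2 * c * x * y - c ^ 2 * a * y ^ 2 := A1.deriv
      have B2 : tn ξ p = - (c ^ 2 * b * y ^ 2) := by
        unfold tn dt; rw [B1.deriv]; field_simp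
      have A3 : dr w p = -(a + t * dr ξ p) := by
        rw [A2]; exact (((D1.add (A1.const_mul t)).const_sub τ)).deriv
      have B3 : tn w p = -(b + t * tn ξ p) := by
        rw [B2]; unfold tn dt
        have := ((D2.add (B1.const_mul t)).const_sub τ).deriv
        rw [show deriv (fun φ => w p.1 φ) p.2 = -(b * p.1 + t * (-(c ^ 2 * b * y ^ 2) * p.1)) from this]
        field_simp
      simp only [ed, e', add_zero, hΦ, hF]
      refine mul_le_mul_of_nonneg_right ?_ hp1.le
      rw [gradSq_eq, gradSq_eq, A3, B3, ← ha, ← hb]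
      have k1 := hK1 p
      have k3 := hK3 p
      have k1' : dr ξ p ^ 2 ≤ K ^ 2 := by rw [← sq_abs]; gcongr
      have k3' : tn ξ p ^ 2 ≤ K ^ 2 := by rw [← sq_abs]; gcongr
      have hx2 : x ^ 2 ≤ 4 := by rw [← sq_abs]; nlinarith [abs_nonneg x]
      have m : a * dr ξ p + b * tn ξ p ≤ - (1 / 2) * (c ^ 2 * (a ^ 2 + b ^ 2) * y ^ 2) + 8 := by
        rw [A2, B2]
        nlinarith [sq_nonneg (c * a * y - 2 * x), sq_nonneg (c * b * y)]
      have e5 : (-(a + t * dr ξ p)) ^ 2 + (-(b + t * tn ξ p)) ^ 2 =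
        a ^ 2 + b ^ 2 + 2 * t * (a * dr ξ p + b * tn ξ p) + t ^ 2 * (dr ξ p ^ 2 + tn ξ p ^ 2) := by ring
      rw [e5]
      have m1 := mul_le_mul_of_nonneg_left m (by linarith : 0 ≤ 2 * t)
      have m2 := mul_le_mul_of_nonneg_left (add_le_add k1' k3') (sq_nonneg t)
      linarith
    have h3 : I2 l Φ 1 = I2 l (fun p => gradSq W p * p.1) 1 + ((-t) * I2 l (fun p => F p * p.1) 1
        + (16 * t + 2 * t ^ 2 * K ^ 2) * (l / 2)) := by
      have e : Φ = fun p => gradSq W p * p.1 + ((-t) * (F p * p.1) + (16 * t + 2 * t ^ 2 * K ^ 2) * p.1) := by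
        ext p; simp only [hΦ]; ring
      rw [e, I2_add (gW.bm_grad.mul BM.fst) (((bF.mul BM.fst).cmul _).add (BM.fst.cmul _)) le_rfl,
        I2_add ((bF.mul BM.fst).cmul _) (BM.fst.cmul _) le_rfl, I2_cmul, I2_cmul,
        I2_fst hl.le (fun s => s) zero_le_one]
      simp; left; ring
    have h4 : t * I2 l (fun p => F p * p.1) 1 ≤ t * (8 * l + t * (K ^ 2 * l)) := by nlinarith
    exact le_of_mul_le_mul_left h4 ht
  have ht : Filter.Tendsto (fun t : ℝ => 8 * l + t * (K ^ 2 * l)) (nhdsWithin 0 (Ioi 0)) (nhds (8 * l + 0 * (K ^ 2 * l))) := by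
    refine Filter.Tendsto.mono_left ?_ nhdsWithin_le_nhds
    exact (Continuous.tendsto (by fun_prop) 0)
  rw [zero_mul, add_zero] at ht
  refine ge_of_tendsto ht ?_
  filter_upwards [self_mem_nhdsWithin] with t ht using key t ht

theorem Mn.harnack {l lp : ℝ} (hl : 0 < l) (hp : 0 ≤ lp) {u : ℝ → ℝ → ℝ} (h : Mn l lp 0 u)
    (hu : ∀ s ∈ Icc (0:ℝ) 1, ∀ θ, u s θ ≤ 0) {τ : ℝ} (hτ : 0 < τ) :
    ∃ s ∈ Ioo (1 / 4 : ℝ) (1 / 2), ∀ θ θ', (τ - u s θ) ≤ Real.exp (4 * l) * (τ - u s θ') := by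
  set W : ℝ → ℝ → ℝ := fun s θ => max (-u s θ) 0 + τ with hW
  have hc := h.caccio hl hp hu hτ hW
  have gW : GLp l W := (h.gl.neg.max (GLp.const 0)).add (GLp.const τ)
  have hWτ : ∀ s θ, τ ≤ W s θ := fun s θ => by rw [hW]; simp
  have hW0 : ∀ s θ, 0 < W s θ := fun s θ => hτ.trans_le (hWτ s θ)
  have gI : GLp l (fun s θ => (W s θ)⁻¹) := gW.comp_lip (by positivity) (inv_lip hτ) (fun s θ => hWτ s θ)
  have gχ : GLp l (fun s _ => chi s) := GLp.of_rad (by norm_num) chi_lip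
  set F : ℝ × ℝ → ℝ := fun p => (chi p.1 ^ 2 * gradSq W p * (W p.1 p.2)⁻¹ ^ 2) * p.1 with hF
  have bF : BM F := ((gχ.bm_u.pow2.mul gW.bm_grad).mul gI.bm_u.pow2).mul BM.fst
  have hi : ∫ s in (1 / 4 : ℝ)..(1 / 2), sl l F s ≤ 8 * l := by
    refine le_trans ?_ hc
    rw [I2_eq bF hl.le zero_le_one le_rfl]
    refine intervalIntegral.integral_mono_interval (by norm_num) (by norm_num) (by norm_num) ?_
      (bF.int_sl hl.le (by simp) (by simp))
    rw [Filter.EventuallyLE, ae_restrict_iff' measurableSet_Ioc]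
    refine Filter.Eventually.of_forall fun s hs => intervalIntegral.integral_nonneg hl.le fun θ _ => ?_
    have := gradSq_nonneg W (s, θ)
    have := hs.1
    simp only [hF]; positivity
  obtain ⟨s, hs, hsF⟩ := exists_le_of_int (M := 32 * l) (by norm_num : (1 / 4 : ℝ) < 1 / 2)
    (bF.int_sl hl.le (by norm_num) (by norm_num)) (by linarith)
  have hs0 : 0 < s := by linarith [hs.1]
  have hs1 : s ≤ 1 := by linarith [hs.2]
  refine ⟨s, hs, ?_⟩
  obtain ⟨K, hK, hK1, hK2⟩ := gW.lip
  have gL : GLp l (fun s θ => Real.log (W s θ)) := gW.comp_lip (S := Ici τ) (C := 1 / τ) (by positivity) (by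
    intro x hx y hy
    have : ∀ x ∈ Ici τ, ∀ y ∈ Ici τ, Real.log x - Real.log y ≤ 1 / τ * |x - y| := by
      intro x hx y hy
      have hx' : τ ≤ x := hx
      have hy' : τ ≤ y := hy
      have hx0 : 0 < x := by linarith
      have hy0 : 0 < y := by linarith
      rw [← Real.log_div hx0.ne' hy0.ne']
      refine (Real.log_le_sub_one_of_pos (by positivity)).trans ?_
      rw [show x / y - 1 = (1 / y) * (x - y) by field_simp]
      calc _ ≤ 1 / y * |x - y| := by gcongr; exact le_abs_self _
        _ ≤ _ := by gcongr
    rw [abs_sub_le_iff]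
    exact ⟨this x hx y hy, by rw [abs_sub_comm]; exact this y hy x hx⟩) (fun s θ => hWτ s θ)
  have ht := gL.tr s
  have hd : ∫ θ in (0:ℝ)..l, deriv (fun θ => Real.log (W s θ)) θ ^ 2 ≤ 16 * l := by
    have e : ∫ θ in (0:ℝ)..l, deriv (fun θ => Real.log (W s θ)) θ ^ 2 ≤ ∫ θ in (0:ℝ)..l, s * F (s, θ) := by
      refine intervalIntegral.integral_mono_ae hl.le (ht.int_d2 _ _) ((bF.intθ ⟨hs0.le, hs1⟩ _ _).const_mul s) ?_
      filter_upwards [gW.ae_dt_s s] with θ hθ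
      have hWp := hW0 s θ
      have : deriv (fun θ => Real.log (W s θ)) θ = deriv (fun θ => W s θ) θ * (W s θ)⁻¹ := by
        rw [(hθ.hasDerivAt.log hWp.ne').deriv]; rfl
      rw [this]
      simp only [hF, chi_eq hs.2.le, gradSq]
      have e2 : s * (1 ^ 2 * (deriv (fun s => W s θ) s ^ 2 + deriv (fun φ => W s φ) θ ^ 2 / s ^ 2) * (W s θ)⁻¹ ^ 2 * s)
        = s ^ 2 * (deriv (fun s => W s θ) s * (W s θ)⁻¹) ^ 2 + (deriv (fun θ => W s θ) θ * (W s θ)⁻¹) ^ 2 := by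
        field_simp
      rw [e2]
      have : 0 ≤ s ^ 2 * (deriv (fun s => W s θ) s * (W s θ)⁻¹) ^ 2 := by positivity
      linarith
    rw [intervalIntegral.integral_const_mul] at e
    have : ∫ θ in (0:ℝ)..l, F (s, θ) ≤ 32 * l := hsF
    have : s * ∫ θ in (0:ℝ)..l, F (s, θ) ≤ s * (32 * l) := by gcongr
    nlinarith [hs.2]
  intro θ θ'
  have ho := ht.osc_all hl θ θ'
  have ho2 : (Real.log (W s θ) - Real.log (W s θ')) ^ 2 ≤ (4 * l) ^ 2 := by nlinarith
  have ho3 := abs_le.1 (abs_le_of_sq_le_sq ho2 (by positivity))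
  have hWu : ∀ θ, τ - u s θ = W s θ := fun θ => by
    rw [hW]; simp only; rw [max_eq_left (by linarith [hu s ⟨hs0.le, hs1⟩ θ])]; ring
  rw [hWu, hWu]
  have h5 : Real.log (W s θ) ≤ 4 * l + Real.log (W s θ') := by linarith [ho3.2]
  calc W s θ = Real.exp (Real.log (W s θ)) := (Real.exp_log (hW0 _ _)).symm
    _ ≤ Real.exp (4 * l + Real.log (W s θ')) := Real.exp_le_exp.2 h5
    _ = _ := by rw [Real.exp_add, Real.exp_log (hW0 _ _)]

/-- T9. -/
theorem Mn.dichotomy {l lp : ℝ} (hl : 0 < l) (hp : 0 ≤ lp) {u : ℝ → ℝ → ℝ} (h : Mn l lp 0 u)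
    (hu : ∀ s ∈ Icc (0:ℝ) 1, ∀ θ, u s θ ≤ 0) :
    (∀ s ∈ Icc (0:ℝ) (1 / 4), ∀ θ, u s θ < 0) ∨ (∀ s ∈ Icc (0:ℝ) (1 / 4), ∀ θ, u s θ = 0) := by
  by_cases hz : ∃ s ∈ Ioo (1 / 4 : ℝ) (1 / 2), ∀ θ, u s θ < 0
  · left
    obtain ⟨s, hs, hneg⟩ := hz
    have hs0 : 0 < s := by linarith [hs.1]
    have hs1 : s ≤ 1 := by linarith [hs.2]
    obtain ⟨θm, -, hm⟩ := isCompact_Icc.exists_isMaxOn (nonempty_Icc.2 hl.le) (h.gl.cont_t s).continuousOn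
    have hmax : ∀ θ, u s θ ≤ u s θm := by
      intro θ
      have e : u s θ = u s (toIcoMod hl 0 θ) := by
        have := per_int (h.gl.per s) (toIcoDiv hl 0 θ) (toIcoMod hl 0 θ)
        rw [← this]; congr 1
        have := toIcoMod_add_toIcoDiv_zsmul hl 0 θ
        simp
      rw [e]
      have := toIcoMod_mem_Ico hl 0 θ
      exact hm ⟨this.1, by linarith [this.2]⟩
    have hc : 0 < - u s θm / s := div_pos (by linarith [hneg θm]) hs0
    have := ((h.sc hl.le hs0 hs1).neg).pos_of_large hl le_rfl hp hc (by positivity) (fun θ => by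
      unfold _root_.sc; rw [mul_one, ← neg_div]; gcongr; exact hmax θ)
    intro x hx θ
    have h2 := this (x / s) ⟨by have := hx.1; positivity, by rw [div_le_one hs0]; linarith [hx.2, hs.1]⟩ θ
    unfold _root_.sc at h2
    rw [mul_div_cancel₀ _ hs0.ne'] at h2
    have h3 : 0 < -(u x θ / s) := hc.trans_le h2
    have h4 : u x θ / s < 0 := by linarith
    by_contra h5
    exact absurd h4 (not_lt.2 (div_nonneg (not_lt.1 h5) hs0.le))
  · right
    push Not at hz
    intro x hx θ
    refine le_antisymm (hu x ⟨hx.1, by linarith [hx.2]⟩ θ) ?_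
    have key : ∀ τ, 0 < τ → -(Real.exp (4 * l) * τ) ≤ u x θ := by
      intro τ hτ
      obtain ⟨s, hs, hH⟩ := h.harnack hl hp hu hτ
      obtain ⟨θ0, hθ0⟩ := hz s hs
      have hs0 : 0 < s := by linarith [hs.1]
      have hs1 : s ≤ 1 := by linarith [hs.2]
      have h0 : u s θ0 = 0 := le_antisymm (hu s ⟨hs0.le, hs1⟩ θ0) hθ0
      set c := -(Real.exp (4 * l) * τ) / s with hc
      have hc0 : c < 0 := by
        rw [hc]; exact div_neg_of_neg_of_pos (by have := Real.exp_pos (4 * l); nlinarith) hs0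
      have := (h.sc hl.le hs0 hs1).min_principle hl hp le_rfl (c := c) (κ := 0) one_pos (fun θ => by
          unfold _root_.sc; rw [mul_one, hc]; gcongr
          have := hH θ θ0
          rw [h0, sub_zero] at this
          linarith) (fun y hy => by rw [ar_neg hc0, ar_neg (hy.trans hc0)]; simp)
      have h2 := this (x / s) ⟨by have := hx.1; positivity, by rw [div_le_one hs0]; linarith [hx.2, hs.1]⟩ θ
      unfold _root_.sc at h2
      rw [mul_div_cancel₀ _ hs0.ne', hc] at h2
      exact (div_le_div_iff_of_pos_right hs0).1 h2
    by_contra hlt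
    push Not at hlt
    have := key (-u x θ / (2 * Real.exp (4 * l))) (div_pos (by linarith) (by positivity))
    have e : Real.exp (4 * l) * (-u x θ / (2 * Real.exp (4 * l))) = - u x θ / 2 := by
      have := Real.exp_pos (4 * l); field_simp
    rw [e] at this
    linarith

/-! ### T10: profile competitors -/

/-- periodic distance to `0`. -/
def dc (l x : ℝ) : ℝ := ‖(x : AddCircle l)‖

theorem dc_per (l x : ℝ) : dc l (x + l) = dc l x := by
  unfold dc; simp

theorem dc_nonneg (l x : ℝ) : 0 ≤ dc l x := norm_nonneg _

theorem dc_lip (l x y : ℝ) : |dc l x - dc l y| ≤ |x - y| := by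
  unfold dc
  refine (abs_norm_sub_norm_le _ _).trans ?_
  rw [← QuotientAddGroup.mk_sub]
  exact QuotientAddGroup.norm_mk_le_norm

theorem dc_eq {l x : ℝ} (hl : 0 < l) (hx : |x| ≤ l / 2) : dc l x = |x| :=
  (AddCircle.norm_coe_eq_abs_iff l hl.ne').2 (by rwa [abs_of_pos hl])

theorem dc_le {l : ℝ} (hl : 0 < l) (x : ℝ) : dc l x ≤ l / 2 := by
  have := AddCircle.norm_le_half_period l (x := (x : AddCircle l)) hl.ne'
  rwa [abs_of_pos hl] at this

def cosd (l p θ : ℝ) : ℝ := Real.cos (dc l (θ - p))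

theorem cosd_per (l p θ : ℝ) : cosd l p (θ + l) = cosd l p θ := by
  unfold cosd; rw [show θ + l - p = θ - p + l by ring, dc_per]

theorem cosd_lip (l p x y : ℝ) : |cosd l p x - cosd l p y| ≤ 1 * |x - y| := by
  unfold cosd
  refine (Real.abs_cos_sub_cos_le _ _).trans ?_
  refine (dc_lip _ _ _).trans ?_
  rw [one_mul]; apply le_of_eq; congr 1; ring

theorem cosd_tr (l p : ℝ) : Tr l (cosd l p) := ⟨cosd_per l p, 1, zero_le_one, cosd_lip l p⟩

theorem cosd_eq {l : ℝ} (hl : 0 < l) (p : ℝ) {x : ℝ} (hx : |x| ≤ l / 2) : cosd l p (p + x) = Real.cos x := by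
  unfold cosd; rw [add_sub_cancel_left, dc_eq hl hx, Real.cos_abs]

theorem GLp.lin {l : ℝ} {g : ℝ → ℝ} (hg : Tr l g) (hl : 0 < l) : GLp l (fun s θ => s * g θ) := by
  obtain ⟨K, hK, h⟩ := hg.lip
  obtain ⟨C, hC, hb⟩ := hg.bdd hl
  refine ⟨fun r θ => by simp only [hg.per], K + C, by positivity, fun θ s s' => ?_, fun s θ θ' => ?_⟩
  · rw [← sub_mul, abs_mul, mul_comm]; gcongr; linarith [hb θ]
  · rw [← mul_sub, abs_mul]
    calc |s| * |g θ - g θ'| ≤ |s| * (K * |θ - θ'|) := by gcongr; exact h _ _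
      _ = K * |s| * |θ - θ'| := by ring
      _ ≤ _ := by gcongr; linarith

def prof (l p A : ℝ) (ψ : ℝ → ℝ) (s θ : ℝ) : ℝ := A * max (s * cosd l p θ + ψ s) 0

theorem prof_z {l : ℝ} (hl : 0 < l) (p : ℝ) {ψ : ℝ → ℝ} {K : ℝ} (hK : 0 ≤ K) (hψ : ∀ x y, |ψ x - ψ y| ≤ K * |x - y|) :
    GLp l (fun s θ => s * cosd l p θ + ψ s) :=
  (GLp.lin (cosd_tr l p) hl).add (GLp.of_rad hK hψ)

theorem prof_gl {l : ℝ} (hl : 0 < l) (p A : ℝ) {ψ : ℝ → ℝ} {K : ℝ} (hK : 0 ≤ K) (hψ : ∀ x y, |ψ x - ψ y| ≤ K * |x - y|) :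
    GLp l (prof l p A ψ) := ((prof_z hl p hK hψ).max (GLp.const 0)).cmul A

theorem GLp.ed_per {l : ℝ} {u : ℝ → ℝ → ℝ} (h : GLp l u) (lp lm s θ : ℝ) : ed lp lm u (s, θ + l) = ed lp lm u (s, θ) := by
  have e1 : (fun x => u x (θ + l)) = fun x => u x θ := funext fun x => h.per x θ
  have e2 := (h.tr s).dper θ
  unfold ed gradSq
  simp only [h.per]
  have e3 : deriv (fun φ => u s φ) (θ + l) = deriv (fun φ => u s φ) θ := e2
  rw [e3]

theorem GLp.sl_shift {l : ℝ} {u : ℝ → ℝ → ℝ} (h : GLp l u) (lp lm p s : ℝ) :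
    sl l (ed lp lm u) s = ∫ x in (-(l / 2))..(l / 2), ed lp lm u (s, p + x) := by
  unfold sl
  have hp : Function.Periodic (fun θ => ed lp lm u (s, θ)) l := fun θ => h.ed_per lp lm s θ
  have := hp.intervalIntegral_add_eq 0 (p - l / 2)
  rw [zero_add] at this
  rw [this, intervalIntegral.integral_comp_add_left (fun θ => ed lp lm u (s, θ)) p]
  congr 1 <;> ring

theorem prof_ed {l lp lm : ℝ} (hl : 0 < l) {p A : ℝ} (hA : 0 < A) {ψ : ℝ → ℝ} {K : ℝ} (hK : 0 ≤ K)
    (hψ : ∀ x y, |ψ x - ψ y| ≤ K * |x - y|) {ρ ψ' x : ℝ} (hρ : 0 < ρ) (hd : HasDerivAt ψ ψ' ρ)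
    (hx : x ∈ Ioo (-(l / 2)) (l / 2)) :
    ed lp lm (prof l p A ψ) (ρ, p + x) =
      if 0 < ρ * Real.cos x + ψ ρ then A ^ 2 * (1 + 2 * ψ' * Real.cos x + ψ' ^ 2) + lp else 0 := by
  have gz := prof_z hl p hK hψ
  have hxl : |x| ≤ l / 2 := abs_le.2 ⟨hx.1.le, hx.2.le⟩
  have hcx := cosd_eq hl p hxl
  split_ifs with h
  · have hpos : 0 < prof l p A ψ ρ (p + x) := by
      unfold prof; rw [hcx, max_eq_left h.le]; positivity
    have hev : ∀ᶠ q in nhds (ρ, p + x), prof l p A ψ q.1 q.2 = (fun s θ => A * (s * cosd l p θ + ψ s)) q.1 q.2 := by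
      have := (GLp.const (l := l) 0).ev_lt gz (p := (ρ, p + x)) (by simp only; rw [hcx]; exact h)
      filter_upwards [this] with q hq
      simp only [prof]; rw [max_eq_left hq.le]
    unfold ed
    rw [gradSq_local (w := fun s θ => A * (s * cosd l p θ + ψ s)) hev, ar_pos hpos]
    unfold gradSq
    have d1 : HasDerivAt (fun s => A * (s * cosd l p (p + x) + ψ s)) (A * (Real.cos x + ψ')) ρ := by
      refine ((((hasDerivAt_id ρ).mul_const _).add hd).const_mul A).congr_deriv ?_
      rw [hcx]; simp
    have d2 : HasDerivAt (fun φ => A * (ρ * cosd l p φ + ψ ρ)) (A * (ρ * (- Real.sin x))) (p + x) := by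
      have e : (fun φ => A * (ρ * cosd l p φ + ψ ρ)) =ᶠ[nhds (p + x)] fun φ => A * (ρ * Real.cos (φ - p) + ψ ρ) := by
        have : Ioo (p - l / 2) (p + l / 2) ∈ nhds (p + x) := Ioo_mem_nhds (by linarith [hx.1]) (by linarith [hx.2])
        filter_upwards [this] with φ hφ
        have := cosd_eq hl p (x := φ - p) (abs_le.2 ⟨by linarith [hφ.1], by linarith [hφ.2]⟩)
        rw [add_sub_cancel] at this
        rw [this]
      refine HasDerivAt.congr_of_eventuallyEq ?_ e
      have h1 : HasDerivAt (fun φ => φ - p) 1 (p + x) := (hasDerivAt_id _).sub_const p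
      have h2 := h1.cos
      rw [add_sub_cancel_left] at h2
      refine (((h2.const_mul ρ).add_const (ψ ρ)).const_mul A).congr_deriv (by ring)
    simp only
    rw [d1.deriv, d2.deriv]
    have := Real.sin_sq_add_cos_sq x
    have e : (A * (ρ * -Real.sin x)) ^ 2 / ρ ^ 2 = A ^ 2 * Real.sin x ^ 2 := by field_simp
    rw [e]; linear_combination A ^ 2 * this
  · have h0 : prof l p A ψ ρ (p + x) = 0 := by
      unfold prof; rw [hcx, max_eq_right (not_lt.1 h), mul_zero]
    unfold ed
    rw [gradSq_min (Filter.Eventually.of_forall fun q => ?_)]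
    · simp only; rw [h0, ar_zero, add_zero]
    · rw [h0]; unfold prof; positivity

theorem prof_slice {l lp lm : ℝ} (hl : 0 < l) (hl2 : l < 2 * Real.pi) (hp : 0 ≤ lp) {p A : ℝ} (hA : 0 < A) {ψ : ℝ → ℝ} {K : ℝ} (hK : 0 ≤ K)
    (hψ : ∀ x y, |ψ x - ψ y| ≤ K * |x - y|) {ρ ψ' : ℝ} (hρ : 0 < ρ) (hρ1 : ρ ≤ 1) (hd : HasDerivAt ψ ψ' ρ) :
    sl l (ed lp lm (prof l p A ψ)) ρ ≤ (A ^ 2 * (1 + ψ' ^ 2) + lp) * (Real.pi + 2 * Real.arcsin (ψ ρ / ρ))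
      + 4 * A ^ 2 * ψ' * Real.sqrt (1 - (ψ ρ / ρ) ^ 2) := by
  have gu := prof_gl hl p A hK hψ
  rw [gu.sl_shift lp lm p ρ]
  set c := ψ ρ / ρ with hc
  set θm := Real.pi / 2 + Real.arcsin c with hθm
  have hθ0 : 0 ≤ θm := by linarith [Real.neg_pi_div_two_le_arcsin c]
  have hθ1 : θm ≤ Real.pi := by linarith [Real.arcsin_le_pi_div_two c]
  set F : ℝ → ℝ := fun x => A ^ 2 * (1 + 2 * ψ' * Real.cos x + ψ' ^ 2) + lp with hF
  have hFc : Continuous F := by rw [hF]; fun_prop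
  have hF0 : ∀ x, 0 ≤ F x := fun x => by
    have : 0 ≤ 1 + 2 * ψ' * Real.cos x + ψ' ^ 2 := by
      have := Real.sin_sq_add_cos_sq x
      nlinarith [sq_nonneg (ψ' + Real.cos x), sq_nonneg (Real.sin x)]
    simp only [hF]; positivity
  have h1 : ∫ x in (-(l / 2))..(l / 2), ed lp lm (prof l p A ψ) (ρ, p + x) ≤ ∫ x in (-θm)..θm, F x := by
    rw [intervalIntegral.integral_of_le (by linarith), integral_Ioc_eq_integral_Ioo,
      intervalIntegral.integral_of_le (by linarith), integral_Ioc_eq_integral_Ioo]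
    have hi : ∀ a b : ℝ, IntegrableOn F (Ioo a b) := fun a b =>
      (hFc.integrableOn_Icc).mono_set Ioo_subset_Icc_self
    have i1 : IntegrableOn (fun x => ed lp lm (prof l p A ψ) (ρ, p + x)) (Ioo (-(l / 2)) (l / 2)) := by
      have := ((gu.bm_ed lp lm).intθ ⟨hρ.le, hρ1⟩ (p + -(l / 2)) (p + l / 2)).comp_add_left p
      rw [add_sub_cancel_left, add_sub_cancel_left, intervalIntegrable_iff_integrableOn_Ioo_of_le (by linarith)] at this
      exact this
    calc ∫ x in Ioo (-(l / 2)) (l / 2), ed lp lm (prof l p A ψ) (ρ, p + x)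
        ≤ ∫ x in Ioo (-(l / 2)) (l / 2), (Ioo (-θm) θm).indicator F x := by
          refine setIntegral_mono_on i1 ((hi _ _).indicator measurableSet_Ioo) measurableSet_Ioo fun x hx => ?_
          rw [prof_ed hl hA hK hψ hρ hd hx]
          split_ifs with h
          · rw [indicator_of_mem]
            rw [mem_Ioo, ← abs_lt]
            by_contra hcon
            push Not at hcon
            have hxpi : |x| ≤ Real.pi := (abs_lt.2 hx).le.trans (by linarith)
            have h2 : Real.cos |x| ≤ Real.cos θm := Real.cos_le_cos_of_nonneg_of_le_pi hθ0 hxpi hcon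
            have h3 : -c < Real.cos x := by
              rw [hc, neg_lt, lt_div_iff₀ hρ]; linarith
            rw [Real.cos_abs, hθm, add_comm, Real.cos_add_pi_div_two] at h2
            by_cases c1 : c ≤ 1
            · by_cases c2 : -1 ≤ c
              · rw [Real.sin_arcsin c2 c1] at h2; linarith
              · linarith [Real.cos_le_one x]
            · rw [hθm, Real.arcsin_of_one_le (by linarith)] at hcon
              linarith [abs_lt.2 hx]
          · exact indicator_nonneg (fun x _ => hF0 x) x
      _ = ∫ x in Ioo (-(l / 2)) (l / 2) ∩ Ioo (-θm) θm, F x := setIntegral_indicator measurableSet_Ioo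
      _ ≤ ∫ x in Ioo (-θm) θm, F x := setIntegral_mono_set (hi _ _)
          (Filter.Eventually.of_forall fun x => hF0 x) (Filter.Eventually.of_forall inter_subset_right)
  refine h1.trans (le_of_eq ?_)
  have e : F = fun x => (A ^ 2 * (1 + ψ' ^ 2) + lp) + (2 * A ^ 2 * ψ') * Real.cos x := by ext x; simp only [hF]; ring
  rw [e, intervalIntegral.integral_add (by simp) (by apply Continuous.intervalIntegrable; fun_prop),
    intervalIntegral.integral_const_mul, integral_cos, intervalIntegral.integral_const, Real.sin_neg,
    hθm, add_comm (Real.pi / 2), Real.sin_add_pi_div_two, Real.cos_arcsin]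
  simp only [smul_eq_mul]; ring

theorem prof_slice_flat {l lp lm : ℝ} (hl : 0 < l) (hp : 0 ≤ lp) {p A : ℝ} (hA : 0 < A) {ψ : ℝ → ℝ} {K : ℝ} (hK : 0 ≤ K)
    (hψ : ∀ x y, |ψ x - ψ y| ≤ K * |x - y|) {ρ : ℝ} (hρ : 0 < ρ) (hρ1 : ρ ≤ 1) (hd : HasDerivAt ψ 0 ρ) :
    sl l (ed lp lm (prof l p A ψ)) ρ ≤ (A ^ 2 + lp) * l := by
  have gu := prof_gl hl p A hK hψ
  rw [gu.sl_shift lp lm p ρ]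
  have i1 := ((gu.bm_ed lp lm).intθ ⟨hρ.le, hρ1⟩ (p + -(l / 2)) (p + l / 2)).comp_add_left p
  rw [add_sub_cancel_left, add_sub_cancel_left] at i1
  have : ∫ x in (-(l / 2))..(l / 2), ed lp lm (prof l p A ψ) (ρ, p + x) ≤ ∫ x in (-(l / 2))..(l / 2), (A ^ 2 + lp) := by
    refine intervalIntegral.integral_mono_on_of_le_Ioo (by linarith) i1 (by simp) fun x hx => ?_
    rw [prof_ed hl hA hK hψ hρ hd hx]
    split_ifs with h
    · apply le_of_eq; ring
    · positivity
  refine this.trans (le_of_eq ?_)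
  rw [intervalIntegral.integral_const, smul_eq_mul]; ring

theorem prof_En {l lp lm : ℝ} (hl : 0 < l) {p A : ℝ} {ψ : ℝ → ℝ} {K : ℝ} (hK : 0 ≤ K)
    (hψ : ∀ x y, |ψ x - ψ y| ≤ K * |x - y|) :
    En l lp lm (prof l p A ψ) 1 = ∫ s in (0:ℝ)..1, s * sl l (ed lp lm (prof l p A ψ)) s := by
  have gu := prof_gl hl p A hK hψ
  rw [En_slice hl.le gu zero_le_one le_rfl]
  congr 1; ext s
  rw [← sl_fst_mul l (fun s => s)]
  congr 1; ext q; ring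

/-! ### The truncated cosine profile is not a minimizer -/

theorem prof_int {l lp lm : ℝ} (hl : 0 < l) (hp : 0 ≤ lp) (hm : 0 ≤ lm) {p A : ℝ} {ψ : ℝ → ℝ} {K : ℝ} (hK : 0 ≤ K)
    (hψ : ∀ x y, |ψ x - ψ y| ≤ K * |x - y|) {a b : ℝ} (ha : a ∈ Icc (0:ℝ) 1) (hb : b ∈ Icc (0:ℝ) 1) :
    IntervalIntegrable (fun s => s * sl l (ed lp lm (prof l p A ψ)) s) volume a b := by
  have gu := prof_gl hl p A hK hψ
  exact ((gu.bm_ed lp lm).int_sl hl.le ha hb).continuousOn_mul continuousOn_id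

theorem arcsin_le_self {c : ℝ} (h1 : -1 ≤ c) (h0 : c ≤ 0) : Real.arcsin c ≤ c := by
  have hpi := Real.pi_gt_three
  refine (Real.arcsin_le_iff_le_sin ⟨h1, by linarith⟩ ⟨by linarith, by linarith⟩).2 ?_
  have := Real.sin_le (x := -c) (by linarith)
  rw [Real.sin_neg] at this; linarith

theorem t10_alg {t s a lp : ℝ} (ht0 : 0 < t) (ht1 : t ≤ 1 / 30) (hs0 : 0 < s) (hs1 : s < 1) (ha0 : 0 < a) (hp : 0 ≤ lp) :
    s * ((a * (1 + (-t * (1 - 2 * s)) ^ 2) + lp) * (Real.pi + 2 * Real.arcsin (-t * (1 - s)))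
      + 4 * a * (-t * (1 - 2 * s)) * Real.sqrt (1 - (-t * (1 - s)) ^ 2))
    ≤ s * ((a + lp) * (Real.pi - 2 * t * (1 - s)) - 4 * a * t * (1 - 2 * s)) + (Real.pi + 4 * t) * a * t ^ 2 := by
  have hpi := Real.pi_gt_three
  obtain ⟨c, hcd⟩ : ∃ c, c = -t * (1 - s) := ⟨_, rfl⟩
  obtain ⟨d, hdd⟩ : ∃ d, d = -t * (1 - 2 * s) := ⟨_, rfl⟩
  rw [← hcd, ← hdd]
  have hc0 : c ≤ 0 := by rw [hcd]; nlinarith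
  have hct : -t ≤ c := by rw [hcd]; nlinarith
  have ha := arcsin_le_self (c := c) (by linarith) hc0
  have ha2 := Real.neg_pi_div_two_le_arcsin c
  generalize Real.arcsin c = α at *
  have hc2 : c ^ 2 ≤ t ^ 2 := sq_le_sq' hct (by linarith)
  have ht2 : t ^ 2 ≤ 1 := by nlinarith
  have hc20 := sq_nonneg c
  have hq1 : Real.sqrt (1 - c ^ 2) ≤ 1 := Real.sqrt_le_one.2 (by linarith)
  have hq0 : 1 - c ^ 2 ≤ Real.sqrt (1 - c ^ 2) := by
    apply Real.le_sqrt_of_sq_le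
    rw [sq]; exact mul_le_of_le_one_left (by linarith) (by linarith)
  generalize Real.sqrt (1 - c ^ 2) = q at *
  have hd1 : d ≤ t := by rw [hdd]; nlinarith
  have hd2 : -t ≤ d := by rw [hdd]; nlinarith
  have hdd2 : d ^ 2 ≤ t ^ 2 := sq_le_sq' hd2 hd1
  have hdq : d * q ≤ d + t * t ^ 2 := by
    have h1 : -d * (1 - q) ≤ t * t ^ 2 :=
      mul_le_mul (by linarith) (by linarith) (by linarith) ht0.le
    linarith
  have hf : (a * (1 + d ^ 2) + lp) * (Real.pi + 2 * α) ≤ (a + lp) * (Real.pi + 2 * c) + a * t ^ 2 * Real.pi := by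
    have e1 : (a + lp) * (Real.pi + 2 * α) ≤ (a + lp) * (Real.pi + 2 * c) := by gcongr
    have e2 : a * d ^ 2 * (Real.pi + 2 * α) ≤ a * t ^ 2 * Real.pi := by
      apply mul_le_mul (by gcongr) (by linarith) (by linarith) (by positivity)
    linarith
  have hg : 4 * a * d * q ≤ 4 * a * (d + t * t ^ 2) := by
    rw [mul_assoc]; gcongr
  refine (mul_le_mul_of_nonneg_left (add_le_add hf hg) hs0.le).trans ?_
  have hex : s * ((Real.pi + 4 * t) * a * t ^ 2) ≤ 1 * ((Real.pi + 4 * t) * a * t ^ 2) := by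
    gcongr
  have : s * ((a + lp) * (Real.pi + 2 * c) + a * t ^ 2 * Real.pi + 4 * a * (d + t * t ^ 2))
    = s * ((a + lp) * (Real.pi - 2 * t * (1 - s)) - 4 * a * t * (1 - 2 * s)) + s * ((Real.pi + 4 * t) * a * t ^ 2) := by
    rw [hcd, hdd]; ring
  linarith

theorem t10_i {l lp lm : ℝ} (hl : 0 < l) (hl2 : l < 2 * Real.pi) (hp : 0 ≤ lp) (hm : 0 ≤ lm) (p : ℝ) {A : ℝ} (hA : 0 < A)
    (hA2 : A ^ 2 < lp) :
    ∃ w0, GLp l w0 ∧ (∀ θ, w0 1 θ = A * max (cosd l p θ) 0) ∧ En l lp lm w0 1 < (A ^ 2 + lp) * Real.pi / 2 := by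
  have hA0 : 0 < A ^ 2 := by positivity
  set t := (lp - A ^ 2) / (30 * (A ^ 2 + lp)) with ht
  have hB : 0 < A ^ 2 + lp := by linarith
  have ht0 : 0 < t := div_pos (by linarith) (by linarith)
  have ht1 : t ≤ 1 / 30 := by
    rw [ht, div_le_div_iff₀ (by linarith) (by norm_num)]; linarith
  set ψ : ℝ → ℝ := fun s => -t * (cl s * (1 - cl s)) with hψd
  have hψ : ∀ x y, |ψ x - ψ y| ≤ t * |x - y| := by
    intro x y
    have e : ψ x - ψ y = t * ((cl x - cl y) * (cl x + cl y - 1)) := by simp only [hψd]; ring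
    rw [e, abs_mul, abs_of_pos ht0, abs_mul]
    have h1 := cl_lip x y
    have hx := cl_mem x
    have hy := cl_mem y
    have h2 : |cl x + cl y - 1| ≤ 1 := abs_le.2 ⟨by linarith [hx.1, hy.1], by linarith [hx.2, hy.2]⟩
    have := mul_le_mul h1 h2 (abs_nonneg _) (abs_nonneg _)
    rw [mul_one] at this
    gcongr
  refine ⟨prof l p A ψ, prof_gl hl p A ht0.le hψ, fun θ => ?_, ?_⟩
  · have : ψ 1 = 0 := by simp only [hψd]; rw [cl_of_mem ⟨zero_le_one, le_rfl⟩]; ring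
    unfold prof; rw [this, one_mul, add_zero]
  · rw [prof_En hl ht0.le hψ]
    have hpi := Real.pi_gt_three
    have hpi4 := Real.pi_le_four
    set Φ : ℝ → ℝ := fun s => s * ((A ^ 2 + lp) * (Real.pi - 2 * t * (1 - s)) - 4 * A ^ 2 * t * (1 - 2 * s))
      + (Real.pi + 4 * t) * A ^ 2 * t ^ 2 with hΦ
    have hΦc : Continuous Φ := by simp only [hΦ]; fun_prop
    have hΦi : ∫ s in (0:ℝ)..1, Φ s = (A ^ 2 + lp) * Real.pi / 2 - t * (lp - A ^ 2) / 3 + (Real.pi + 4 * t) * A ^ 2 * t ^ 2 := by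
      have hd : ∀ s ∈ uIcc (0:ℝ) 1, HasDerivAt (fun s : ℝ => (A ^ 2 + lp) * (Real.pi * s ^ 2 / 2 - 2 * t * (s ^ 2 / 2 - s ^ 3 / 3))
          - 4 * A ^ 2 * t * (s ^ 2 / 2 - 2 * s ^ 3 / 3) + (Real.pi + 4 * t) * A ^ 2 * t ^ 2 * s) (Φ s) s := by
        intro s _
        have h2 : HasDerivAt (fun s : ℝ => s ^ 2) (2 * s) s := by simpa using hasDerivAt_pow 2 s
        have h3 : HasDerivAt (fun s : ℝ => s ^ 3) (3 * s ^ 2) s := by simpa using hasDerivAt_pow 3 s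
        have e1 := ((h2.const_mul Real.pi).div_const 2).sub (((h2.div_const 2).sub (h3.div_const 3)).const_mul (2 * t))
        have e2 := ((h2.div_const 2).sub ((h3.const_mul 2).div_const 3)).const_mul (4 * A ^ 2 * t)
        have e3 := (hasDerivAt_id s).const_mul ((Real.pi + 4 * t) * A ^ 2 * t ^ 2)
        refine (((e1.const_mul (A ^ 2 + lp)).sub e2).add e3).congr_deriv ?_
        simp only [hΦ]; ring
      rw [intervalIntegral.integral_eq_sub_of_hasDerivAt hd (hΦc.intervalIntegrable _ _)]
      ring
    have hle : ∫ s in (0:ℝ)..1, s * sl l (ed lp lm (prof l p A ψ)) s ≤ ∫ s in (0:ℝ)..1, Φ s := by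
      refine intervalIntegral.integral_mono_on_of_le_Ioo zero_le_one
        (prof_int hl hp hm ht0.le hψ ⟨le_rfl, zero_le_one⟩ ⟨zero_le_one, le_rfl⟩) (hΦc.intervalIntegrable _ _) ?_
      intro s hs
      have hd : HasDerivAt ψ (-t * (1 - 2 * s)) s := by
        have e : ψ =ᶠ[nhds s] fun s => -t * (s * (1 - s)) := by
          filter_upwards [Ioo_mem_nhds hs.1 hs.2] with x hx
          simp only [hψd]; rw [cl_of_mem ⟨hx.1.le, hx.2.le⟩]
        refine HasDerivAt.congr_of_eventuallyEq ?_ e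
        refine (((hasDerivAt_id s).mul ((hasDerivAt_id s).const_sub 1)).const_mul (-t)).congr_deriv ?_
        simp only [id]; ring
      have h := prof_slice (lm := lm) hl hl2 hp (p := p) hA ht0.le hψ hs.1 hs.2.le hd
      have hc : ψ s / s = -t * (1 - s) := by
        simp only [hψd]; rw [cl_of_mem ⟨hs.1.le, hs.2.le⟩]; have := hs.1.ne'; field_simp
      rw [hc] at h
      refine (mul_le_mul_of_nonneg_left h hs.1.le).trans ?_
      exact t10_alg ht0 ht1 hs.1 hs.2 hA0 hp
    refine hle.trans_lt ?_
    rw [hΦi]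
    have h1 : (Real.pi + 4 * t) * A ^ 2 * t ≤ 5 * (A ^ 2 + lp) * t := by
      have : (Real.pi + 4 * t) * A ^ 2 ≤ 5 * (A ^ 2 + lp) := by
        apply mul_le_mul _ (by linarith) (by positivity) (by norm_num)
        linarith
      gcongr
    have h2 : 5 * (A ^ 2 + lp) * t = (lp - A ^ 2) / 6 := by rw [ht]; field_simp; ring
    have h3 : (Real.pi + 4 * t) * A ^ 2 * t ^ 2 ≤ t * ((lp - A ^ 2) / 6) := by
      rw [← h2]; nlinarith
    nlinarith

theorem log_lip {t a b : ℝ} (ht : 0 < t) (ha : t ≤ a) (hb : t ≤ b) : |Real.log a - Real.log b| ≤ |a - b| / t := by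
  have key : ∀ a b : ℝ, t ≤ a → t ≤ b → Real.log a - Real.log b ≤ |a - b| / t := by
    intro a b ha hb
    rw [← Real.log_div (by linarith) (by linarith)]
    have hb0 : 0 < b := by linarith
    refine (Real.log_le_sub_one_of_pos (div_pos (by linarith) hb0)).trans ?_
    have : a / b - 1 = (a - b) / b := by field_simp
    rw [this]
    exact (div_le_div_of_nonneg_right (le_abs_self _) hb0.le).trans (div_le_div_of_nonneg_left (abs_nonneg _) ht hb)
  refine abs_le.2 ⟨?_, key a b ha hb⟩
  have := key b a hb ha
  rw [abs_sub_comm] at this; linarith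

theorem t10_ii {l lp lm : ℝ} (hl : 0 < l) (hlpi : Real.pi ≤ l) (hl2 : l < 2 * Real.pi) (hp : 0 ≤ lp) (hm : 0 ≤ lm) (p : ℝ) {A : ℝ} (hA : 0 < A)
    (hA2 : lp ≤ A ^ 2) :
    ∃ w0, GLp l w0 ∧ (∀ θ, w0 1 θ = A * max (cosd l p θ) 0) ∧ En l lp lm w0 1 < (A ^ 2 + lp) * Real.pi / 2 := by
  have hA0 : 0 < A ^ 2 := by positivity
  have hpi := Real.pi_pos
  obtain ⟨L, hL0, hL⟩ : ∃ L : ℝ, 0 < L ∧ 2 * Real.pi / L < 2 * Real.pi - l := by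
    refine ⟨2 * Real.pi / (2 * Real.pi - l) + 1, by have : 0 < 2 * Real.pi - l := by linarith
                                                    positivity, ?_⟩
    have h : 0 < 2 * Real.pi - l := by linarith
    rw [div_lt_iff₀ (by positivity), mul_add, mul_div_cancel₀ _ h.ne']; linarith
  set t := Real.exp (-L) with ht
  have ht0 : 0 < t := Real.exp_pos _
  have ht1 : t < 1 := by rw [ht]; rw [← Real.exp_zero]; exact Real.exp_lt_exp.2 (by linarith)
  have htl : Real.log t = -L := Real.log_exp _
  set ψ : ℝ → ℝ := fun s => t * (-Real.log (max t (min s 1)) / L) with hψd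
  have hψ : ∀ x y, |ψ x - ψ y| ≤ (1 / L) * |x - y| := by
    intro x y
    have e : ψ x - ψ y = t / L * (-(Real.log (max t (min x 1)) - Real.log (max t (min y 1)))) := by simp only [hψd]; ring
    rw [e, abs_mul, abs_of_pos (by positivity), abs_neg]
    have h1 := log_lip ht0 (le_max_left t (min x 1)) (le_max_left t (min y 1))
    have h2 : |max t (min x 1) - max t (min y 1)| ≤ |x - y| := by
      refine (abs_max_sub_max_le_max _ _ _ _).trans ?_
      rw [sub_self, abs_zero, max_eq_right (abs_nonneg _)]
      refine (abs_min_sub_min_le_max _ _ _ _).trans ?_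
      rw [sub_self, abs_zero, max_eq_left (abs_nonneg _)]
    calc t / L * |Real.log (max t (min x 1)) - Real.log (max t (min y 1))| ≤ t / L * (|x - y| / t) := by
          gcongr; exact h1.trans (by gcongr)
      _ = 1 / L * |x - y| := by field_simp
  have hK : 0 ≤ 1 / L := by positivity
  have hψe : ∀ s, t ≤ s → s ≤ 1 → ψ s = -(t / L) * Real.log s := by
    intro s h1 h2
    simp only [hψd]; rw [min_eq_left h2, max_eq_right h1]; ring
  refine ⟨prof l p A ψ, prof_gl hl p A hK hψ, fun θ => ?_, ?_⟩
  · have : ψ 1 = 0 := by rw [hψe 1 ht1.le le_rfl, Real.log_one, mul_zero]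
    unfold prof; rw [this, one_mul, add_zero]
  rw [prof_En hl hK hψ]
  have m0 : (0:ℝ) ∈ Icc (0:ℝ) 1 := ⟨le_rfl, zero_le_one⟩
  have m1 : (1:ℝ) ∈ Icc (0:ℝ) 1 := ⟨zero_le_one, le_rfl⟩
  have mt : t ∈ Icc (0:ℝ) 1 := ⟨ht0.le, ht1.le⟩
  rw [← intervalIntegral.integral_add_adjacent_intervals (prof_int hl hp hm hK hψ m0 mt) (prof_int hl hp hm hK hψ mt m1)]
  have hin : ∫ s in (0:ℝ)..t, s * sl l (ed lp lm (prof l p A ψ)) s ≤ (A ^ 2 + lp) * l * (t ^ 2 / 2) := by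
    have : ∫ s in (0:ℝ)..t, s * ((A ^ 2 + lp) * l) = (A ^ 2 + lp) * l * (t ^ 2 / 2) := by
      rw [intervalIntegral.integral_mul_const, integral_id]; ring
    rw [← this]
    refine intervalIntegral.integral_mono_on_of_le_Ioo ht0.le (prof_int hl hp hm hK hψ m0 mt)
      (Continuous.intervalIntegrable (by fun_prop) _ _) ?_
    intro s hs
    have hd : HasDerivAt ψ 0 s := by
      have e : ψ =ᶠ[nhds s] fun _ => t * (-Real.log t / L) := by
        filter_upwards [Iio_mem_nhds hs.2] with x hx
        simp only [hψd]; rw [max_eq_left ((min_le_left _ _).trans (le_of_lt hx))]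
      exact (hasDerivAt_const s _).congr_of_eventuallyEq e
    exact mul_le_mul_of_nonneg_left (prof_slice_flat hl hp hA hK hψ hs.1 (hs.2.le.trans ht1.le) hd) hs.1.le
  -- outer part
  set f : ℝ → ℝ := fun s => -(t / L) * Real.log s with hf
  set f' : ℝ → ℝ := fun s => -(t / L) / s with hf'
  set H : ℝ → ℝ := fun s => s ^ 2 * Real.arcsin (f s / s) + s * f s * Real.sqrt (1 - (f s / s) ^ 2) with hH
  set H' : ℝ → ℝ := fun s => 2 * s * Real.arcsin (f s / s) + 2 * s * f' s * Real.sqrt (1 - (f s / s) ^ 2) with hH'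
  have hfd : ∀ s, 0 < s → HasDerivAt f (f' s) s := by
    intro s hs
    refine ((Real.hasDerivAt_log hs.ne').const_mul (-(t / L))).congr_deriv ?_
    simp only [hf']; ring
  have hcd : ∀ s, 0 < s → HasDerivAt (fun s => f s / s) ((f' s * s - f s) / s ^ 2) s := by
    intro s hs
    exact ((hfd s hs).div (hasDerivAt_id s) hs.ne').congr_deriv (by simp)
  have hcc : ContinuousOn (fun s => f s / s) (Icc t 1) := fun s hs => (hcd s (ht0.trans_le hs.1)).continuousAt.continuousWithinAt
  have hfc : ContinuousOn f (Icc t 1) := fun s hs => (hfd s (ht0.trans_le hs.1)).continuousAt.continuousWithinAt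
  have hf'c : ContinuousOn f' (Icc t 1) := by
    apply ContinuousOn.div continuousOn_const continuousOn_id
    intro s hs; exact (ht0.trans_le hs.1).ne'
  have hac : ContinuousOn (fun s => Real.arcsin (f s / s)) (Icc t 1) := Real.continuous_arcsin.comp_continuousOn hcc
  have hqc : ContinuousOn (fun s => Real.sqrt (1 - (f s / s) ^ 2)) (Icc t 1) :=
    Real.continuous_sqrt.comp_continuousOn (continuousOn_const.sub (hcc.pow 2))
  have hHc : ContinuousOn H (Icc t 1) := ((continuousOn_id.pow 2).mul hac).add ((continuousOn_id.mul hfc).mul hqc)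
  have hH'c : ContinuousOn H' (Icc t 1) :=
    ((continuousOn_const.mul continuousOn_id).mul hac).add (((continuousOn_const.mul continuousOn_id).mul hf'c).mul hqc)
  have hcr : ∀ s ∈ Ioo t 1, 0 < f s / s ∧ f s / s < 1 := by
    intro s hs
    have hs0 : 0 < s := ht0.trans hs.1
    have hlog : Real.log s < 0 := Real.log_neg hs0 hs.2
    have hlog2 : -L < Real.log s := by rw [← htl]; exact Real.log_lt_log ht0 hs.1
    have h1 : 0 < f s := by
      simp only [hf]; have : 0 < t / L := by positivity
      nlinarith
    refine ⟨div_pos h1 hs0, (div_lt_one hs0).2 ?_⟩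
    have : f s < t := by
      simp only [hf]
      have : -(t / L) * Real.log s = t * (-Real.log s / L) := by ring
      rw [this]
      have : -Real.log s / L < 1 := (div_lt_one hL0).2 (by linarith)
      nlinarith
    linarith [hs.1]
  have hHd : ∀ s ∈ Ioo t 1, HasDerivAt H (H' s) s := by
    intro s hs
    have hs0 : 0 < s := ht0.trans hs.1
    obtain ⟨c0, c1⟩ := hcr s hs
    have hc := hcd s hs0
    have hq : 0 < 1 - (f s / s) ^ 2 := by nlinarith
    have h1 := HasDerivAt.comp (h₂ := Real.arcsin) (h := fun s => f s / s) s (Real.hasDerivAt_arcsin (x := f s / s) (by linarith) (by linarith)) hc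
    have h2 := ((hc.pow 2).const_sub 1).sqrt hq.ne'
    have h3 : HasDerivAt (fun s : ℝ => s ^ 2) (2 * s) s := by simpa using hasDerivAt_pow 2 s
    refine ((h3.mul h1).add (((hasDerivAt_id s).mul (hfd s hs0)).mul h2)).congr_deriv ?_
    simp only [hH', Function.comp, id, Pi.mul_apply, Pi.pow_apply]
    have hfs : f s = (f s / s) * s := by field_simp
    set c := f s / s with hcdef
    rw [hfs]
    set q := Real.sqrt (1 - c ^ 2) with hqd
    have hq2 : q ^ 2 = 1 - c ^ 2 := Real.sq_sqrt hq.le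
    have hq0 : q ≠ 0 := (Real.sqrt_pos.2 hq).ne'
    field_simp
    have : c ^ 2 = 1 - q ^ 2 := by linarith
    ring_nf
    have e3 : c ^ 3 = c * (1 - q ^ 2) := by rw [← this]; ring
    simp only [this, e3]; ring
  have hHi : ∫ s in t..1, H' s = -(Real.pi * t ^ 2 / 2) := by
    rw [intervalIntegral.integral_eq_sub_of_hasDerivAt_of_le ht1.le hHc hHd
      (ContinuousOn.intervalIntegrable (by rwa [uIcc_of_le ht1.le]))]
    have e1 : f 1 = 0 := by simp [hf]
    have e2 : f t / t = 1 := by simp only [hf]; rw [htl]; field_simp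
    simp only [hH]
    rw [e1, e2]; simp; ring
  set Φ : ℝ → ℝ := fun s => s * ((A ^ 2 + lp) * Real.pi) + 2 * A ^ 2 * H' s + 2 * Real.pi * A ^ 2 * t ^ 2 / L ^ 2 * s⁻¹ with hΦ
  have i1 : IntervalIntegrable (fun s : ℝ => s * ((A ^ 2 + lp) * Real.pi)) volume t 1 := Continuous.intervalIntegrable (by fun_prop) _ _
  have i2 : IntervalIntegrable (fun s : ℝ => 2 * A ^ 2 * H' s) volume t 1 :=
    (ContinuousOn.intervalIntegrable (by rwa [uIcc_of_le ht1.le])).const_mul _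
  have hnz : ∀ s ∈ uIcc t 1, s ≠ 0 := by
    intro s hs; rw [uIcc_of_le ht1.le] at hs; exact (ht0.trans_le hs.1).ne'
  have i3 : IntervalIntegrable (fun s : ℝ => 2 * Real.pi * A ^ 2 * t ^ 2 / L ^ 2 * s⁻¹) volume t 1 :=
    (ContinuousOn.intervalIntegrable (continuousOn_id.inv₀ hnz)).const_mul _
  have hΦi : ∫ s in t..1, Φ s = (A ^ 2 + lp) * Real.pi * (1 - t ^ 2) / 2 - A ^ 2 * Real.pi * t ^ 2 + 2 * Real.pi * A ^ 2 * t ^ 2 / L := by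
    simp only [hΦ]
    rw [intervalIntegral.integral_add (i1.add i2) i3, intervalIntegral.integral_add i1 i2,
      intervalIntegral.integral_mul_const, integral_id, intervalIntegral.integral_const_mul, hHi,
      intervalIntegral.integral_const_mul, integral_inv_of_pos ht0 one_pos, one_div, Real.log_inv, htl]
    field_simp
    ring
  have hout : ∫ s in t..1, s * sl l (ed lp lm (prof l p A ψ)) s ≤ ∫ s in t..1, Φ s := by
    refine intervalIntegral.integral_mono_on_of_le_Ioo ht1.le (prof_int hl hp hm hK hψ mt m1) ((i1.add i2).add i3) ?_
    intro s hs
    have hs0 : 0 < s := ht0.trans hs.1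
    have hd : HasDerivAt ψ (f' s) s := by
      refine (hfd s hs0).congr_of_eventuallyEq ?_
      filter_upwards [Ioo_mem_nhds hs.1 hs.2] with x hx
      exact hψe x hx.1.le hx.2.le
    have h := prof_slice (lm := lm) hl hl2 hp (p := p) hA hK hψ hs0 hs.2.le hd
    rw [hψe s hs.1.le hs.2.le] at h
    change _ ≤ (A ^ 2 * (1 + f' s ^ 2) + lp) * (Real.pi + 2 * Real.arcsin (f s / s)) + 4 * A ^ 2 * f' s * Real.sqrt (1 - (f s / s) ^ 2) at h
    obtain ⟨c0, c1⟩ := hcr s hs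
    have ha0 : 0 ≤ Real.arcsin (f s / s) := Real.arcsin_nonneg.2 c0.le
    have ha1 := Real.arcsin_le_pi_div_two (f s / s)
    refine (mul_le_mul_of_nonneg_left h hs0.le).trans ?_
    simp only [hΦ, hH']
    set α := Real.arcsin (f s / s)
    set q := Real.sqrt (1 - (f s / s) ^ 2)
    have e1 : lp * (s * α) ≤ A ^ 2 * (s * α) := by gcongr
    have e2 : s * (f' s ^ 2) = t ^ 2 / L ^ 2 * s⁻¹ := by simp only [hf']; field_simp
    have e3 : A ^ 2 * (t ^ 2 / L ^ 2 * s⁻¹) * (Real.pi + 2 * α) ≤ A ^ 2 * (t ^ 2 / L ^ 2 * s⁻¹) * (2 * Real.pi) := by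
      gcongr; linarith
    have e4 : s * ((A ^ 2 * (1 + f' s ^ 2) + lp) * (Real.pi + 2 * α) + 4 * A ^ 2 * f' s * q)
      = s * ((A ^ 2 + lp) * Real.pi) + 2 * A ^ 2 * (s * α) + 2 * (lp * (s * α)) + A ^ 2 * (s * f' s ^ 2) * (Real.pi + 2 * α) + 4 * A ^ 2 * s * f' s * q := by ring
    rw [e4, e2]
    have e5 : 2 * Real.pi * A ^ 2 * t ^ 2 / L ^ 2 * s⁻¹ = A ^ 2 * (t ^ 2 / L ^ 2 * s⁻¹) * (2 * Real.pi) := by ring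
    rw [e5]
    nlinarith
  have htot := add_le_add hin (hout.trans_eq hΦi)
  refine htot.trans_lt ?_
  have k1 : lp * (t ^ 2 * (l - Real.pi)) ≤ A ^ 2 * (t ^ 2 * (l - Real.pi)) := by
    have : 0 ≤ l - Real.pi := by linarith
    gcongr
  have k2 : A ^ 2 * t ^ 2 * (2 * Real.pi / L) < A ^ 2 * t ^ 2 * (2 * Real.pi - l) := by
    have : 0 < A ^ 2 * t ^ 2 := by positivity
    gcongr
  have k3 : 2 * Real.pi * A ^ 2 * t ^ 2 / L = A ^ 2 * t ^ 2 * (2 * Real.pi / L) := by ring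
  rw [k3]
  nlinarith

theorem t10 {l lp lm : ℝ} (hl : 0 < l) (hlpi : Real.pi ≤ l) (hl2 : l < 2 * Real.pi) (hp : 0 ≤ lp) (hm : 0 ≤ lm) (p : ℝ) {A : ℝ} (hA : 0 < A) :
    ∃ w0, GLp l w0 ∧ (∀ θ, w0 1 θ = A * max (cosd l p θ) 0) ∧ En l lp lm w0 1 < (A ^ 2 + lp) * Real.pi / 2 := by
  rcases lt_or_ge (A ^ 2) lp with h | h
  · exact t10_i hl hl2 hp hm p hA h
  · exact t10_ii hl hlpi hl2 hp hm p hA h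

/-! ### Classification of blow-up traces -/

/-- Three-point relation characterising solutions of `g'' = -g` off the zero set. -/
def Trig (l : ℝ) (g : ℝ → ℝ) : Prop :=
  ∀ p h : ℝ, 0 < h → 2 * h ≤ l → (∀ θ ∈ Icc (p - h) (p + h), g θ ≠ 0) → g (p + h) + g (p - h) = 2 * Real.cos h * g p

theorem Trig.open {l : ℝ} {g : ℝ → ℝ} (hg : Continuous g) (hT : Trig l g) {p h : ℝ} (hh : 0 < h) (hl : 2 * h ≤ l)
    (hn : ∀ θ ∈ Ioo (p - h) (p + h), g θ ≠ 0) : g (p + h) + g (p - h) = 2 * Real.cos h * g p := by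
  have hc : IsClosed {x | g (p + x) + g (p - x) = 2 * Real.cos x * g p} :=
    isClosed_eq (by fun_prop) (by fun_prop)
  have hs : Ioo 0 h ⊆ {x | g (p + x) + g (p - x) = 2 * Real.cos x * g p} := by
    intro x hx
    exact hT p x hx.1 (by linarith [hx.2]) fun θ hθ => hn θ ⟨by linarith [hθ.1, hx.2], by linarith [hθ.2, hx.2]⟩
  have := hc.closure_subset_iff.2 hs
  rw [closure_Ioo hh.ne] at this
  exact this ⟨hh.le, le_rfl⟩

theorem Trig.comp {l : ℝ} {g : ℝ → ℝ} (hl : 0 < l) (hl2 : l < 2 * Real.pi) (hg : Continuous g) (hper : ∀ θ, g (θ + l) = g θ)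
    (hT : Trig l g) {q z w : ℝ} (hq : g q ≠ 0) (hz : g z = 0) (hzq : z ≤ q) (hw : g w = 0) (hqw : q ≤ w) :
    ∃ a, z ≤ a ∧ a + Real.pi ≤ w ∧ a < q ∧ q < a + Real.pi ∧ g a = 0 ∧ g (a + Real.pi) = 0 ∧ (∀ θ ∈ Ioo a (a + Real.pi), g θ ≠ 0)
      ∧ Real.pi ≤ l := by
  have hZ : IsClosed {x | g x = 0} := isClosed_eq hg continuous_const
  set S := {x | g x = 0} ∩ Iic q
  set T := {x | g x = 0} ∩ Ici q
  have hSne : S.Nonempty := ⟨z, hz, hzq⟩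
  have hTne : T.Nonempty := ⟨w, hw, hqw⟩
  have hSb : BddAbove S := ⟨q, fun x hx => hx.2⟩
  have hTb : BddBelow T := ⟨q, fun x hx => hx.2⟩
  have ha := (hZ.inter isClosed_Iic).csSup_mem hSne hSb
  have hb := (hZ.inter isClosed_Ici).csInf_mem hTne hTb
  change sSup S ∈ S at ha
  change sInf T ∈ T at hb
  have ha' : ∀ x, g x = 0 → x ≤ q → x ≤ sSup S := fun x h1 h2 => le_csSup hSb ⟨h1, h2⟩
  have hb' : ∀ x, g x = 0 → q ≤ x → sInf T ≤ x := fun x h1 h2 => csInf_le hTb ⟨h1, h2⟩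
  generalize sSup S = a at *
  generalize sInf T = b at *
  obtain ⟨ga, haq⟩ := ha
  obtain ⟨gb, hbq⟩ := hb
  have ga : g a = 0 := ga
  have gb : g b = 0 := gb
  have haq : a ≤ q := haq
  have hbq : q ≤ b := hbq
  have haq' : a < q := lt_of_le_of_ne haq (by rintro rfl; exact hq ga)
  have hbq' : q < b := lt_of_le_of_ne hbq (by rintro rfl; exact hq gb)
  have hal : q ≤ a + l := by
    by_contra h
    have := ha' (a + l) (by rw [hper]; exact ga) (not_le.1 h).le
    linarith
  have hba : b ≤ a + l := hb' _ (by rw [hper]; exact ga) hal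
  have hn : ∀ θ ∈ Ioo a b, g θ ≠ 0 := by
    intro θ hθ h0
    rcases le_total θ q with h | h
    · exact absurd (ha' θ h0 h) (not_le.2 hθ.1)
    · exact absurd (hb' θ h0 h) (not_le.2 hθ.2)
  have key := hT.open hg (p := (a + b) / 2) (h := (b - a) / 2) (by linarith) (by linarith) (by
    intro θ hθ; exact hn θ ⟨by linarith [hθ.1], by linarith [hθ.2]⟩)
  rw [show (a + b) / 2 + (b - a) / 2 = b by ring, show (a + b) / 2 - (b - a) / 2 = a by ring, ga, gb] at key
  have hm : g ((a + b) / 2) ≠ 0 := hn _ ⟨by linarith, by linarith⟩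
  have hcos : Real.cos ((b - a) / 2) = 0 := by
    have : Real.cos ((b - a) / 2) * g ((a + b) / 2) = 0 := by linarith
    exact (mul_eq_zero.1 this).resolve_right hm
  have hpi : (b - a) / 2 = Real.pi / 2 := by
    rw [← Real.arccos_cos (x := (b - a) / 2) (by linarith) (by linarith), hcos, Real.arccos_zero]
  have hbe : b = a + Real.pi := by linarith
  subst hbe
  exact ⟨a, ha' z hz hzq, hb' w hw hqw, haq', hbq', ga, gb, hn, by linarith⟩

theorem trig_zero {e : ℝ → ℝ} (he : Continuous e) {α β : ℝ} (hab : β = α + Real.pi / 2) (h0 : e α = 0) (h1 : e β = 0)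
    (h : ∀ x h, 0 < h → α ≤ x - h → x + h ≤ β → e (x + h) + e (x - h) = 2 * Real.cos h * e x) :
    ∀ x ∈ Icc α β, e x = 0 := by
  have hpi := Real.pi_pos
  obtain ⟨x, hx, hmax⟩ := isCompact_Icc.exists_isMaxOn (s := Icc α β) (f := fun x => |e x|) ⟨α, le_rfl, by linarith⟩ (by fun_prop)
  have hmax : ∀ y ∈ Icc α β, |e y| ≤ |e x| := fun y hy => hmax hy
  by_cases hx0 : e x = 0
  · intro y hy
    have := hmax y hy
    rw [hx0, abs_zero] at this
    exact abs_eq_zero.1 (le_antisymm this (abs_nonneg _))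
  exfalso
  have hxα : α < x := lt_of_le_of_ne hx.1 (by rintro rfl; exact hx0 h0)
  have hxβ : x < β := lt_of_le_of_ne hx.2 (by rintro rfl; exact hx0 h1)
  have fin : ∀ k, 0 < k → k ≤ Real.pi / 4 → 2 * Real.cos k * |e x| ≤ |e x| → False := by
    intro k hk hk4 hle
    have hc : Real.cos (Real.pi / 3) < Real.cos k :=
      Real.cos_lt_cos_of_nonneg_of_le_pi (by linarith) (by linarith) (by linarith)
    rw [Real.cos_pi_div_three] at hc
    have := abs_pos.2 hx0
    nlinarith
  rcases le_total (x - α) (β - x) with hc | hc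
  · have k := h x (x - α) (by linarith) (by linarith) (by linarith)
    rw [sub_sub_cancel, h0, add_zero] at k
    have hm := hmax (x + (x - α)) ⟨by linarith, by linarith⟩
    have hcos : 0 ≤ Real.cos (x - α) := Real.cos_nonneg_of_mem_Icc ⟨by linarith, by linarith⟩
    rw [k, abs_mul, abs_of_nonneg (by positivity)] at hm
    exact fin (x - α) (by linarith) (by linarith) hm
  · have k := h x (β - x) (by linarith) (by linarith) (by linarith)
    rw [add_sub_cancel, h1, zero_add] at k
    have hm := hmax (x - (β - x)) ⟨by linarith, by linarith⟩
    have hcos : 0 ≤ Real.cos (β - x) := Real.cos_nonneg_of_mem_Icc ⟨by linarith, by linarith⟩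
    rw [k, abs_mul, abs_of_nonneg (by positivity)] at hm
    exact fin (β - x) (by linarith) (by linarith) hm

theorem Trig.classify {l : ℝ} {g : ℝ → ℝ} (hl : 0 < l) (hl2 : l < 2 * Real.pi) (hg : Continuous g) (hper : ∀ θ, g (θ + l) = g θ)
    (hT : Trig l g) : (∀ θ, g θ = 0) ∨ ∃ p A, A ≠ 0 ∧ Real.pi ≤ l ∧ ∀ θ, g θ = A * max (cosd l p θ) 0 := by
  have hpi := Real.pi_pos
  by_cases hnz : ∀ θ, g θ = 0
  · exact Or.inl hnz
  right
  push Not at hnz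
  obtain ⟨q, hq⟩ := hnz
  -- there is a zero
  have hex : ∃ z, g z = 0 := by
    by_contra hne
    push Not at hne
    have h1 : ∀ p, g (p + l / 2) = Real.cos (l / 2) * g p := by
      intro p
      have k := hT p (l / 2) (by linarith) (by linarith) (fun θ _ => hne θ)
      have : g (p - l / 2) = g (p + l / 2) := by rw [← hper (p - l / 2)]; congr 1; ring
      rw [this] at k; linarith
    have h2 := h1 (q + l / 2)
    rw [h1 q, show q + l / 2 + l / 2 = q + l by ring, hper] at h2
    have h3 : Real.cos (l / 2) ^ 2 = 1 := by
      have : (Real.cos (l / 2) ^ 2 - 1) * g q = 0 := by linear_combination -h2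
      linarith [(mul_eq_zero.1 this).resolve_right hq]
    have h4 : 0 < Real.sin (l / 2) := Real.sin_pos_of_pos_of_lt_pi (by linarith) (by linarith)
    have := Real.sin_sq_add_cos_sq (l / 2)
    nlinarith
  obtain ⟨z, hz⟩ := hex
  have hzk : ∀ k : ℤ, g (z + k * l) = 0 := fun k => by rw [per_int hper]; exact hz
  obtain ⟨a, -, -, haq, hqb, ga, gb, hn, hlpi⟩ := hT.comp hl hl2 hg hper hq (hzk ⌊(q - z) / l⌋) (by
      have := Int.floor_le ((q - z) / l)
      rw [le_div_iff₀ hl] at this; linarith) (hzk ⌈(q - z) / l⌉) (by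
      have := Int.le_ceil ((q - z) / l)
      rw [div_le_iff₀ hl] at this; linarith)
  set p := a + Real.pi / 2 with hp
  set A := g p with hA
  have hrel : ∀ x h, 0 < h → a ≤ x - h → x + h ≤ a + Real.pi →
      (g (x + h) - A * Real.cos (x + h - p)) + (g (x - h) - A * Real.cos (x - h - p)) = 2 * Real.cos h * (g x - A * Real.cos (x - p)) := by
    intro x h hh h1 h2
    have k := hT.open hg (p := x) hh (by linarith) (fun θ hθ => hn θ ⟨by linarith [hθ.1], by linarith [hθ.2]⟩)
    have c1 : Real.cos (x + h - p) = Real.cos (x - p) * Real.cos h - Real.sin (x - p) * Real.sin h := by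
      rw [← Real.cos_add]; congr 1; ring
    have c2 : Real.cos (x - h - p) = Real.cos (x - p) * Real.cos h + Real.sin (x - p) * Real.sin h := by
      rw [← Real.cos_sub]; congr 1; ring
    rw [c1, c2]; linear_combination k
  have ea : g a - A * Real.cos (a - p) = 0 := by
    rw [ga, show a - p = -(Real.pi / 2) by rw [hp]; ring, Real.cos_neg, Real.cos_pi_div_two]; ring
  have ep : g p - A * Real.cos (p - p) = 0 := by rw [sub_self, Real.cos_zero, hA]; ring
  have eb : g (a + Real.pi) - A * Real.cos (a + Real.pi - p) = 0 := by
    rw [gb, show a + Real.pi - p = Real.pi / 2 by rw [hp]; ring, Real.cos_pi_div_two]; ring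
  have hec : Continuous fun x => g x - A * Real.cos (x - p) := by fun_prop
  have E1 := trig_zero hec (α := a) (β := p) hp ea ep (fun x h hh h1 h2 => hrel x h hh h1 (by linarith))
  have E2 := trig_zero hec (α := p) (β := a + Real.pi) (by rw [hp]; ring) ep eb (fun x h hh h1 h2 => hrel x h hh (by linarith) h2)
  have hin : ∀ θ ∈ Icc a (a + Real.pi), g θ = A * Real.cos (θ - p) := by
    intro θ hθ
    rcases le_total θ p with h | h
    · linarith [E1 θ ⟨hθ.1, h⟩]
    · linarith [E2 θ ⟨h, hθ.2⟩]
  have gal : g (a + l) = 0 := by rw [hper]; exact ga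
  have hout : ∀ θ ∈ Icc (a + Real.pi) (a + l), g θ = 0 := by
    intro θ hθ
    by_contra h
    obtain ⟨a', h1, h2, -⟩ := hT.comp hl hl2 hg hper h gb hθ.1 gal hθ.2
    linarith
  refine ⟨p, A, hn p ⟨by linarith, by linarith⟩, hlpi, fun θ => ?_⟩
  have red : ∀ x, |x| ≤ l / 2 → g (p + x) = A * max (cosd l p (p + x)) 0 := by
    intro x hx
    rw [cosd_eq hl p hx]
    obtain ⟨x1, x2⟩ := abs_le.1 hx
    rcases le_or_gt |x| (Real.pi / 2) with h | h
    · obtain ⟨y1, y2⟩ := abs_le.1 h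
      rw [hin (p + x) ⟨by linarith, by linarith⟩, add_sub_cancel_left, max_eq_left (Real.cos_nonneg_of_mem_Icc ⟨by linarith, by linarith⟩)]
    · have hc : Real.cos x ≤ 0 := by
        rw [← Real.cos_abs]
        exact Real.cos_nonpos_of_pi_div_two_le_of_le h.le (by linarith)
      rw [max_eq_right hc, mul_zero]
      rcases lt_abs.1 h with h | h
      · exact hout _ ⟨by linarith, by linarith⟩
      · rw [← hper]; exact hout _ ⟨by linarith, by linarith⟩
  have hr := abs_sub_round ((θ - p) / l)
  set k := round ((θ - p) / l)
  have hx : |θ - p - k * l| ≤ l / 2 := by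
    have : θ - p - k * l = ((θ - p) / l - k) * l := by field_simp
    rw [this, abs_mul, abs_of_pos hl]; nlinarith
  have := red _ hx
  rw [show p + (θ - p - k * l) = θ + ((-k : ℤ) : ℝ) * l by push_cast; ring, per_int hper, per_int (cosd_per l p)] at this
  exact this

/-! ### First variation of almost homogeneous minimizers -/

theorem Tr.ae_snd {l : ℝ} {g : ℝ → ℝ} (h : Tr l g) : ∀ᵐ p : ℝ × ℝ, DifferentiableAt ℝ g p.2 :=
  (Measure.quasiMeasurePreserving_snd (μ := (volume : Measure ℝ)) (ν := (volume : Measure ℝ))).ae h.ae_diff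

theorem ae_ne' (b : ℝ) : ∀ᵐ x : ℝ, x ≠ b := by simp [ae_iff, measure_singleton]

theorem dc_red {l : ℝ} (hl : 0 < l) (x : ℝ) : ∃ j : ℤ, |x + j * l| = dc l x ∧ |x + j * l| ≤ l / 2 := by
  have hr := abs_sub_round (x / l)
  have hx : |x + ((-round (x / l) : ℤ) : ℝ) * l| ≤ l / 2 := by
    have : x + ((-round (x / l) : ℤ) : ℝ) * l = (x / l - round (x / l)) * l := by push_cast; field_simp; ring
    rw [this, abs_mul, abs_of_pos hl]; nlinarith
  refine ⟨_, ?_, hx⟩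
  rw [← dc_eq hl hx, per_int (dc_per l)]

def psi (l p k θ : ℝ) : ℝ := Real.sin (max (k - dc l (θ - p)) 0)

theorem psi_tr (l p k : ℝ) : Tr l (psi l p k) := by
  refine ⟨fun θ => ?_, 1, zero_le_one, fun x y => ?_⟩
  · unfold psi; rw [show θ + l - p = θ - p + l by ring, dc_per]
  · unfold psi
    refine (Real.abs_sin_sub_sin_le _ _).trans ?_
    refine (abs_max_sub_max_le_max _ _ _ _).trans ?_
    rw [sub_self, abs_zero, max_eq_left (abs_nonneg _), show k - dc l (x - p) - (k - dc l (y - p)) = -(dc l (x - p) - dc l (y - p)) by ring, abs_neg]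
    refine (dc_lip _ _ _).trans ?_
    rw [one_mul]; apply le_of_eq; congr 1; ring

theorem psi_d (l p k x : ℝ) : |deriv (psi l p k) x| ≤ 1 := by
  apply abs_deriv_le zero_le_one
  intro x y
  unfold psi
  refine (Real.abs_sin_sub_sin_le _ _).trans ?_
  refine (abs_max_sub_max_le_max _ _ _ _).trans ?_
  rw [sub_self, abs_zero, max_eq_left (abs_nonneg _), show k - dc l (x - p) - (k - dc l (y - p)) = -(dc l (x - p) - dc l (y - p)) by ring, abs_neg]
  refine (dc_lip _ _ _).trans ?_
  rw [one_mul]; apply le_of_eq; congr 1; ring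

theorem psi_b (l p k x : ℝ) : |psi l p k x| ≤ 1 := Real.abs_sin_le_one _

theorem psi_e {l : ℝ} (hl : 0 < l) (p k : ℝ) {θ : ℝ} (hx : |θ - p| ≤ l / 2) : psi l p k θ = Real.sin (max (k - |θ - p|) 0) := by
  unfold psi; rw [dc_eq hl hx]

theorem psi_supp {l p k θ : ℝ} (h : psi l p k θ ≠ 0) : dc l (θ - p) < k := by
  by_contra hc
  apply h
  unfold psi; rw [max_eq_right (by linarith), Real.sin_zero]

theorem Tr.X_eq {l : ℝ} (hl : 0 < l) {G : ℝ → ℝ} (hG : Tr l G) {p k : ℝ} (hk : 0 < k) (hkl : 2 * k ≤ l) :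
    ∫ θ in (0:ℝ)..l, (deriv G θ * deriv (psi l p k) θ - G θ * psi l p k θ)
      = 2 * Real.cos k * G p - G (p + k) - G (p - k) := by
  have hψ := psi_tr l p k
  set F : ℝ → ℝ := fun θ => deriv G θ * deriv (psi l p k) θ - G θ * psi l p k θ with hF
  have hbm : BM (fun q : ℝ × ℝ => F q.2) := (hG.bmd.mul hψ.bmd).sub ((hG.bm hl).mul (hψ.bm hl))
  have hi : ∀ a b, IntervalIntegrable F volume a b := fun a b => hbm.intθ (s := 0) ⟨le_rfl, zero_le_one⟩ a b
  have hper : Function.Periodic F l := by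
    intro x; simp only [hF]; rw [hG.dper, hψ.dper, hG.per, hψ.per]
  have hshift : ∫ θ in (0:ℝ)..l, F θ = ∫ θ in (p - l / 2)..(p + l / 2), F θ := by
    have := hper.intervalIntegral_add_eq 0 (p - l / 2)
    rw [zero_add, show p - l / 2 + l = p + l / 2 by ring] at this
    exact this
  rw [hshift, ← intervalIntegral.integral_add_adjacent_intervals (hi (p - l / 2) (p - k)) (hi (p - k) _),
    ← intervalIntegral.integral_add_adjacent_intervals (hi (p - k) p) (hi p _),
    ← intervalIntegral.integral_add_adjacent_intervals (hi p (p + k)) (hi (p + k) _)]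
  have zero : ∀ a b, a ≤ b → (∀ x ∈ Ioo a b, k < |x - p| ∧ |x - p| < l / 2) → ∫ θ in a..b, F θ = 0 := by
    intro a b hab hx
    have := ac_ftc (F := fun _ => (0:ℝ)) (F' := F) (a := a) (b := b) (ac_lip le_rfl (by simp) a b) (by
      filter_upwards [ae_ne' b] with x hxb hxm
      rw [uIoc_of_le hab] at hxm
      obtain ⟨x1, x2⟩ := hx x ⟨hxm.1, lt_of_le_of_ne hxm.2 hxb⟩
      have e : psi l p k =ᶠ[nhds x] fun _ => 0 := by
        have c : Continuous fun x : ℝ => |x - p| := by fun_prop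
        filter_upwards [c.tendsto x |>.eventually (lt_mem_nhds x1), c.tendsto x |>.eventually (gt_mem_nhds x2)] with y y1 y2
        rw [psi_e hl p k y2.le, max_eq_right (by linarith), Real.sin_zero]
      have : F x = 0 := by
        simp only [hF]; rw [e.deriv_eq, e.eq_of_nhds]; simp
      rw [this]; exact hasDerivAt_const x 0)
    rw [this]; simp
  have z1 := zero (p - l / 2) (p - k) (by linarith) (fun x hx => by
    rw [abs_of_neg (by linarith [hx.2])]; exact ⟨by linarith [hx.2], by linarith [hx.1]⟩)
  have z2 := zero (p + k) (p + l / 2) (by linarith) (fun x hx => by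
    rw [abs_of_pos (by linarith [hx.1])]; exact ⟨by linarith [hx.1], by linarith [hx.2]⟩)
  have hcos : ∀ (c : ℝ) (x y : ℝ), |Real.cos (x - c) - Real.cos (y - c)| ≤ 1 * |x - y| := by
    intro c x y
    refine (Real.abs_cos_sub_cos_le _ _).trans ?_
    rw [one_mul]; apply le_of_eq; congr 1; ring
  have hcd : ∀ c x, HasDerivAt (fun x => Real.cos (x - c)) (-Real.sin (x - c)) x := by
    intro c x
    exact (((hasDerivAt_id x).sub_const c).cos).congr_deriv (by simp)
  have m1 : ∫ θ in p..(p + k), F θ = -(G (p + k)) + G p * Real.cos k := by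
    have := ac_ftc (F := fun θ => (-1) * (G θ * Real.cos (θ - (p + k)))) (F' := F) (a := p) (b := p + k)
      ((ac_lip (K := 0) le_rfl (by simp) p (p + k)).fun_mul ((hG.ac _ _).fun_mul (ac_lip zero_le_one (hcos (p + k)) _ _))) (by
      filter_upwards [ae_ne' (p + k), hG.ae_diff] with x hxb hxd hxm
      rw [uIoc_of_le (by linarith)] at hxm
      have x1 := hxm.1
      have x2 := lt_of_le_of_ne hxm.2 hxb
      have e : psi l p k =ᶠ[nhds x] fun y => Real.sin (p + k - y) := by
        filter_upwards [Ioo_mem_nhds x1 x2] with y hy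
        have ay : |y - p| = y - p := abs_of_pos (by linarith [hy.1])
        rw [psi_e hl p k (by rw [ay]; linarith [hy.2]), ay, max_eq_left (by linarith [hy.2])]; congr 1; ring
      have ds : HasDerivAt (fun y => Real.sin (p + k - y)) (-Real.cos (p + k - x)) x :=
        (((hasDerivAt_id x).const_sub (p + k)).sin).congr_deriv (by simp)
      refine ((hxd.hasDerivAt.mul (hcd (p + k) x)).const_mul (-1)).congr_deriv ?_
      simp only [hF]; rw [e.deriv_eq, e.eq_of_nhds, ds.deriv, show x - (p + k) = -(p + k - x) by ring, Real.cos_neg, Real.sin_neg]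
      ring)
    rw [this, sub_self, Real.cos_zero, show p - (p + k) = -k by ring, Real.cos_neg]; ring
  have m2 : ∫ θ in (p - k)..p, F θ = -(G (p - k)) + G p * Real.cos k := by
    have := ac_ftc (F := fun θ => G θ * Real.cos (θ - (p - k))) (F' := F) (a := p - k) (b := p)
      ((hG.ac _ _).fun_mul (ac_lip zero_le_one (hcos (p - k)) _ _)) (by
      filter_upwards [ae_ne' p, hG.ae_diff] with x hxb hxd hxm
      rw [uIoc_of_le (by linarith)] at hxm
      have x1 := hxm.1
      have x2 := lt_of_le_of_ne hxm.2 hxb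
      have e : psi l p k =ᶠ[nhds x] fun y => Real.sin (y - (p - k)) := by
        filter_upwards [Ioo_mem_nhds x1 x2] with y hy
        have ay : |y - p| = p - y := by rw [abs_of_neg (by linarith [hy.2])]; ring
        rw [psi_e hl p k (by rw [ay]; linarith [hy.1]), ay, max_eq_left (by linarith [hy.1])]; congr 1; ring
      have ds : HasDerivAt (fun y => Real.sin (y - (p - k))) (Real.cos (x - (p - k))) x :=
        (((hasDerivAt_id x).sub_const (p - k)).sin).congr_deriv (by simp)
      refine (hxd.hasDerivAt.mul (hcd (p - k) x)).congr_deriv ?_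
      simp only [hF]; rw [e.deriv_eq, e.eq_of_nhds, ds.deriv]
      ring)
    rw [this, sub_self, Real.cos_zero, show p - (p - k) = k by ring]; ring
  rw [z1, z2, m1, m2]; ring

theorem ar_same {lp lm a b : ℝ} (ha : 0 < b → 0 < a) (hb : b < 0 → a < 0) (h0 : b ≠ 0) : ar lp lm a = ar lp lm b := by
  rcases lt_or_gt_of_ne h0 with h | h
  · rw [ar_neg h, ar_neg (hb h)]
  · rw [ar_pos h, ar_pos (ha h)]

theorem ar_scale {lp lm s b : ℝ} (hs : 0 < s) : ar lp lm (s * b) = ar lp lm b := by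
  rcases lt_trichotomy b 0 with h | h | h
  · rw [ar_neg h, ar_neg (mul_neg_of_pos_of_neg hs h)]
  · rw [h, mul_zero]
  · rw [ar_pos h, ar_pos (mul_pos hs h)]

theorem Mn.var {l lp lm : ℝ} (hl : 0 < l) (hp : 0 ≤ lp) (hm : 0 ≤ lm) {v : ℝ → ℝ → ℝ} (h : Mn l lp lm v)
    {p k m : ℝ} (hk : 0 < k) (hkl : 2 * k ≤ l) (hm0 : 0 ≤ m) (hmm : ∀ θ ∈ Icc (p - k) (p + k), m < |v 1 θ|) {τ : ℝ} (hτ : |τ| ≤ m) :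
    -deff l lp lm v ≤ τ / 3 * (2 * Real.cos k * v 1 p - v 1 (p + k) - v 1 (p - k)) + τ ^ 2 * l := by
  have hG := h.gl.tr 1
  have hψ := psi_tr l p k
  rw [← hG.X_eq hl hk hkl]
  unfold deff
  generalize hGe : v 1 = G at *
  generalize hψe : psi l p k = ψ at *
  have hψb : ∀ x, |ψ x| ≤ 1 := fun x => by rw [← hψe]; exact psi_b l p k x
  have hψd : ∀ x, |deriv ψ x| ≤ 1 := fun x => by rw [← hψe]; exact psi_d l p k x
  have hsupp : ∀ θ, ψ θ ≠ 0 → m < |G θ| := by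
    intro θ hθ
    rw [← hψe] at hθ
    have := psi_supp hθ
    obtain ⟨j, hj, -⟩ := dc_red hl (θ - p)
    rw [← hj] at this
    obtain ⟨y1, y2⟩ := abs_lt.1 this
    rw [← per_int hG.per j θ]
    exact hmm _ ⟨by linarith, by linarith⟩
  obtain ⟨K, hK, hgl⟩ := hG.lip
  obtain ⟨K', hK', hψl⟩ := hψ.lip
  obtain ⟨C, hC, hgb⟩ := hG.bdd hl
  let w : ℝ → ℝ → ℝ := fun s θ => s * (G θ + τ * ((1 - s) * ψ θ))
  have hw : RL l w := by
    refine ⟨fun r θ => by simp only [w, hG.per, hψ.per], C + |τ| + (K + |τ| * K'), by positivity, ?_, ?_⟩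
    · intro θ s hs s' hs'
      have e : w s θ - w s' θ = (s - s') * (G θ + τ * ((1 - s - s') * ψ θ)) := by simp only [w]; ring
      rw [e, abs_mul, mul_comm]
      have a2 : |G θ + τ * ((1 - s - s') * ψ θ)| ≤ C + |τ| * (1 * 1) := by
        refine (abs_add_le _ _).trans (add_le_add (hgb θ) ?_)
        rw [abs_mul, abs_mul]
        gcongr
        · exact abs_le.2 ⟨by linarith [hs.2, hs'.2], by linarith [hs.1, hs'.1]⟩
        · exact hψb θ
      gcongr
      refine a2.trans ?_
      have : 0 ≤ K + |τ| * K' := by positivity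
      linarith
    · intro s hs θ θ'
      have e : w s θ - w s θ' = s * ((G θ - G θ') + τ * ((1 - s) * (ψ θ - ψ θ'))) := by simp only [w]; ring
      have hs0 := hs.1
      rw [e, abs_mul, abs_of_nonneg hs0]
      have a2 : |(G θ - G θ') + τ * ((1 - s) * (ψ θ - ψ θ'))| ≤ K * |θ - θ'| + |τ| * (1 * (K' * |θ - θ'|)) := by
        refine (abs_add_le _ _).trans (add_le_add (hgl _ _) ?_)
        rw [abs_mul, abs_mul]
        gcongr
        · exact abs_le.2 ⟨by linarith [hs.2], by linarith [hs.1]⟩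
        · exact hψl _ _
      calc _ ≤ s * (K * |θ - θ'| + |τ| * (1 * (K' * |θ - θ'|))) := by gcongr
        _ = (K + |τ| * K') * s * |θ - θ'| := by ring
        _ ≤ _ := mul_le_mul_of_nonneg_right (mul_le_mul_of_nonneg_right (by linarith [abs_nonneg τ]) hs0) (abs_nonneg _)
  have h1 := h.le w hw (fun θ => by simp [w, hGe])
  have bG := hG.bm hl
  have bψ := hψ.bm hl
  have bar : BM (fun q : ℝ × ℝ => ar lp lm (G q.2)) :=
    BM.of_snd ((ar_meas lp lm).comp hG.cont.measurable) (|lp| + |lm|) fun x => ar_bdd _ _ _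
  have f2 : BM (fun q : ℝ × ℝ => 2 * q.1 * (1 - 2 * q.1)) :=
    (BM.fst.cmul 2).mul ((BM.const 1).sub (BM.fst.cmul 2))
  have f3 : BM (fun q : ℝ × ℝ => 2 * q.1 * (1 - q.1)) :=
    (BM.fst.cmul 2).mul ((BM.const 1).sub BM.fst)
  have b1 : BM (fun q : ℝ × ℝ => q.1 * (G q.2 ^ 2 + deriv G q.2 ^ 2 + ar lp lm (G q.2))) :=
    BM.fst.mul ((bG.pow2.add hG.bmd.pow2).add bar)
  have b2 : BM (fun q : ℝ × ℝ => (2 * q.1 * (1 - 2 * q.1)) * (τ * (G q.2 * ψ q.2))) := f2.mul ((bG.mul bψ).cmul τ)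
  have b3 : BM (fun q : ℝ × ℝ => (2 * q.1 * (1 - q.1)) * (τ * (deriv G q.2 * deriv ψ q.2))) := f3.mul ((hG.bmd.mul hψ.bmd).cmul τ)
  have b4 : BM (fun q : ℝ × ℝ => 2 * τ ^ 2 * q.1) := BM.fst.cmul _
  have h2 := En_le hp hm (l := l) (R := 1) (w := w) le_rfl (((b1.add b2).add b3).add b4) (by
    filter_upwards [hG.ae_snd, hψ.ae_snd] with q hq1 hq2 hqQ
    have s0 : 0 < q.1 := hqQ.1.1
    have s1 : q.1 < 1 := hqQ.1.2
    have d1 : dr w q = G q.2 + τ * ((1 - 2 * q.1) * ψ q.2) := by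
      unfold dr
      have : HasDerivAt (fun s => w s q.2) (G q.2 + τ * ((1 - 2 * q.1) * ψ q.2)) q.1 := by
        refine ((hasDerivAt_id q.1).mul ((((((hasDerivAt_id q.1).const_sub 1).mul_const (ψ q.2)).const_mul τ).const_add (G q.2)))).congr_deriv ?_
        simp only [id]; ring
      exact this.deriv
    have d2 : tn w q = deriv G q.2 + τ * ((1 - q.1) * deriv ψ q.2) := by
      unfold tn dt
      have : HasDerivAt (fun φ => w q.1 φ) (q.1 * (deriv G q.2 + τ * ((1 - q.1) * deriv ψ q.2))) q.2 :=
        (hq1.hasDerivAt.add ((hq2.hasDerivAt.const_mul (1 - q.1)).const_mul τ)).const_mul q.1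
      rw [this.deriv]; field_simp
    have d3 : ar lp lm (w q.1 q.2) = ar lp lm (G q.2) := by
      simp only [w]
      rw [ar_scale s0]
      by_cases hz : ψ q.2 = 0
      · rw [hz]; simp
      have hgm := hsupp _ hz
      have hb : |τ * ((1 - q.1) * ψ q.2)| ≤ m := by
        rw [abs_mul, abs_mul]
        calc _ ≤ m * (1 * 1) := by
              gcongr
              · exact abs_le.2 ⟨by linarith, by linarith⟩
              · exact hψb _
          _ = m := by ring
      obtain ⟨z1, z2⟩ := abs_le.1 hb
      refine ar_same (fun h => ?_) (fun h => ?_) (by rintro h; rw [h, abs_zero] at hgm; linarith)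
      · rw [abs_of_pos h] at hgm; linarith
      · rw [abs_of_neg h] at hgm; linarith
    unfold ed
    rw [gradSq_eq, d1, d2, d3]
    have e1 : ((1 - 2 * q.1) * ψ q.2) ^ 2 ≤ 1 := by
      rw [← sq_abs, abs_mul]
      have : |1 - 2 * q.1| * |ψ q.2| ≤ 1 * 1 := by
        gcongr
        · exact abs_le.2 ⟨by linarith, by linarith⟩
        · exact hψb _
      nlinarith [mul_nonneg (abs_nonneg (1 - 2 * q.1)) (abs_nonneg (ψ q.2))]
    have e2 : ((1 - q.1) * deriv ψ q.2) ^ 2 ≤ 1 := by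
      rw [← sq_abs, abs_mul]
      have : |1 - q.1| * |deriv ψ q.2| ≤ 1 * 1 := by
        gcongr
        · exact abs_le.2 ⟨by linarith, by linarith⟩
        · exact hψd _
      nlinarith [mul_nonneg (abs_nonneg (1 - q.1)) (abs_nonneg (deriv ψ q.2))]
    have e3 : τ ^ 2 * q.1 * (((1 - 2 * q.1) * ψ q.2) ^ 2 + ((1 - q.1) * deriv ψ q.2) ^ 2) ≤ τ ^ 2 * q.1 * 2 := by
      gcongr; linarith
    nlinarith)
  rw [I2_add ((b1.add b2).add b3) b4 le_rfl, I2_add (b1.add b2) b3 le_rfl, I2_add b1 b2 le_rfl,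
    I2_prod hl.le (fun s => s) (fun θ => G θ ^ 2 + deriv G θ ^ 2 + ar lp lm (G θ)) zero_le_one,
    I2_prod hl.le (fun s => 2 * s * (1 - 2 * s)) (fun θ => τ * (G θ * ψ θ)) zero_le_one,
    I2_prod hl.le (fun s => 2 * s * (1 - s)) (fun θ => τ * (deriv G θ * deriv ψ θ)) zero_le_one,
    I2_fst hl.le (fun s => 2 * τ ^ 2 * s) zero_le_one, intervalIntegral.integral_const_mul, intervalIntegral.integral_const_mul,
    intervalIntegral.integral_const_mul, integral_id] at h2
  have i2 : ∫ s in (0:ℝ)..1, 2 * s * (1 - 2 * s) = -(1 / 3) := by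
    have : ∀ s ∈ uIcc (0:ℝ) 1, HasDerivAt (fun s : ℝ => s ^ 2 - 4 / 3 * s ^ 3) (2 * s * (1 - 2 * s)) s := fun s _ => by
      refine ((hasDerivAt_pow 2 s).sub ((hasDerivAt_pow 3 s).const_mul (4 / 3))).congr_deriv ?_
      push_cast; ring
    rw [intervalIntegral.integral_eq_sub_of_hasDerivAt this (Continuous.intervalIntegrable (by fun_prop) _ _)]; norm_num
  have i3 : ∫ s in (0:ℝ)..1, 2 * s * (1 - s) = 1 / 3 := by
    have : ∀ s ∈ uIcc (0:ℝ) 1, HasDerivAt (fun s : ℝ => s ^ 2 - 2 / 3 * s ^ 3) (2 * s * (1 - s)) s := fun s _ => by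
      refine ((hasDerivAt_pow 2 s).sub ((hasDerivAt_pow 3 s).const_mul (2 / 3))).congr_deriv ?_
      push_cast; ring
    rw [intervalIntegral.integral_eq_sub_of_hasDerivAt this (Continuous.intervalIntegrable (by fun_prop) _ _)]; norm_num
  rw [i2, i3] at h2
  rw [intervalIntegral.integral_sub ((hG.bmd.mul hψ.bmd).intθ (s := 0) ⟨le_rfl, zero_le_one⟩ 0 l)
    ((bG.mul bψ).intθ (s := 0) ⟨le_rfl, zero_le_one⟩ 0 l)]
  unfold hom
  simp only at h2 ⊢
  linarith

/-! ### Interpolation with a fixed competitor -/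

theorem int_chi {t : ℝ} (ht0 : 0 < t) (ht1 : t ≤ 1 / 2) :
    ∫ s in (0:ℝ)..1, (Ioi (1 - t)).indicator (fun _ => (1:ℝ)) s = t := by
  rw [intervalIntegral.integral_of_le zero_le_one, setIntegral_indicator measurableSet_Ioi]
  have : Ioc (0:ℝ) 1 ∩ Ioi (1 - t) = Ioc (1 - t) 1 := by
    ext x; simp only [mem_inter_iff, mem_Ioc, mem_Ioi]
    constructor
    · rintro ⟨⟨a, b⟩, c⟩; exact ⟨c, b⟩
    · rintro ⟨a, b⟩; exact ⟨⟨by linarith, b⟩, a⟩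
  rw [this]
  simp only [integral_const, smul_eq_mul, mul_one, measureReal_restrict_apply_univ, Real.volume_real_Ioc]
  rw [max_eq_left (by linarith)]; ring

set_option maxHeartbeats 1000000 in
theorem Mn.interp {l lp lm : ℝ} (hl : 0 < l) (hp : 0 ≤ lp) (hm : 0 ≤ lm) {w0 : ℝ → ℝ → ℝ} (h0 : GLp l w0) {M : ℝ} (hM : 0 ≤ M) :
    ∃ C : ℝ, 0 ≤ C ∧ ∀ v, Mn l lp lm v → tau l v 1 ≤ M → ∀ ε : ℝ, 0 ≤ ε → (∀ θ, |v 1 θ - w0 1 θ| ≤ ε) →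
      ∀ t : ℝ, 0 < t → t ≤ 1 / 2 → En l lp lm v 1 ≤ En l lp lm w0 1 + C * t + C * (ε ^ 2 / t) := by
  obtain ⟨K, hK, k1, k2⟩ := h0.lip
  have hΛ : 0 ≤ max lp lm := hp.trans (le_max_left _ _)
  refine ⟨(20 * K ^ 2 + max lp lm) * l + 16 * M + 2 * l, by positivity, ?_⟩
  intro v h hτ ε hε hd t ht0 ht1
  have hG := h.gl.tr 1
  have hW := h0.tr 1
  unfold tau at hτ
  generalize hGe : v 1 = G at *
  obtain ⟨L, hL, hgl⟩ := hG.lip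
  have hwl : ∀ x y, |w0 1 x - w0 1 y| ≤ K * |x - y| := fun x y => by simpa using k2 1 x y
  let ζ : ℝ → ℝ := fun s => max ((s - (1 - t)) / t) 0
  have hζl : ∀ s s', |ζ s - ζ s'| ≤ 1 / t * |s - s'| := by
    intro s s'
    refine (abs_max_sub_max_le_max _ _ _ _).trans ?_
    rw [sub_self, abs_zero, max_eq_left (abs_nonneg _), show (s - (1 - t)) / t - (s' - (1 - t)) / t = 1 / t * (s - s') by ring,
      abs_mul, abs_of_pos (by positivity)]
  have hζ0 : ∀ s, 0 ≤ ζ s := fun s => le_max_right _ _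
  have hζs : ∀ s ∈ Icc (0:ℝ) 1, ζ s ≤ s := by
    intro s hs
    refine max_le ?_ hs.1
    rw [div_le_iff₀ ht0]; nlinarith [hs.1, hs.2]
  let w : ℝ → ℝ → ℝ := fun s θ => w0 s θ + ζ s * (G θ - w0 1 θ)
  have hw : RL l w := by
    refine ⟨fun r θ => by simp only [w, hG.per, h0.per], K + 1 / t * ε + (L + K), by positivity, ?_, ?_⟩
    · intro θ s hs s' hs'
      have e : w s θ - w s' θ = (w0 s θ - w0 s' θ) + (ζ s - ζ s') * (G θ - w0 1 θ) := by simp only [w]; ring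
      rw [e]
      refine (abs_add_le _ _).trans ?_
      rw [abs_mul]
      calc _ ≤ K * |s - s'| + (1 / t * |s - s'|) * ε := by
            gcongr
            · exact k1 _ _ _
            · exact hζl _ _
            · exact hd θ
        _ = (K + 1 / t * ε) * |s - s'| := by ring
        _ ≤ _ := mul_le_mul_of_nonneg_right (by linarith) (abs_nonneg _)
    · intro s hs θ θ'
      have e : w s θ - w s θ' = (w0 s θ - w0 s θ') + ζ s * ((G θ - G θ') - (w0 1 θ - w0 1 θ')) := by simp only [w]; ring
      have hs0 := hs.1
      rw [e]
      refine (abs_add_le _ _).trans ?_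
      rw [abs_mul, abs_of_nonneg (hζ0 s)]
      have a1 := k2 s θ θ'
      rw [abs_of_nonneg hs0] at a1
      calc _ ≤ K * s * |θ - θ'| + s * (L * |θ - θ'| + K * |θ - θ'|) := by
            gcongr
            · exact hζs s hs
            · exact (abs_sub _ _).trans (add_le_add (hgl _ _) (hwl _ _))
        _ = (K + (L + K)) * s * |θ - θ'| := by ring
        _ ≤ _ := mul_le_mul_of_nonneg_right (mul_le_mul_of_nonneg_right (by
              have : 0 ≤ 1 / t * ε := by positivity
              linarith) hs0) (abs_nonneg _)
  have hζ1 : ζ 1 = 1 := by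
    simp only [ζ]; rw [show (1 - (1 - t)) / t = 1 by field_simp; ring]; simp
  have h1 := h.le w hw (fun θ => by simp only [w]; rw [hζ1, hGe]; ring)
  set χ : ℝ → ℝ := (Ioi (1 - t)).indicator (fun _ => (1:ℝ)) with hχ
  set B := 20 * K ^ 2 + max lp lm + 2 * (ε ^ 2 / t ^ 2) with hB
  have hB0 : 0 ≤ B := by positivity
  have bχ : BM (fun q : ℝ × ℝ => χ q.1) := by
    refine BM.of_fst (f := χ) (measurable_const.indicator measurableSet_Ioi) 1 fun s _ => ?_
    simp only [hχ, indicator]; split_ifs <;> simp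
  have b1 : BM (fun q : ℝ × ℝ => ed lp lm w0 q * q.1) := (h0.bm_ed lp lm).mul BM.fst
  have b2 : BM (fun q : ℝ × ℝ => χ q.1 * (B + 16 * deriv G q.2 ^ 2)) := bχ.mul ((BM.const B).add (hG.bmd.pow2.cmul 16))
  have aef : ∀ᵐ q : ℝ × ℝ, q.1 ≠ 1 - t :=
    (Measure.quasiMeasurePreserving_fst (μ := (volume : Measure ℝ)) (ν := (volume : Measure ℝ))).ae (ae_ne' (1 - t))
  have h2 := En_le hp hm (l := l) (R := 1) (w := w) le_rfl (b1.add b2) (by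
    filter_upwards [hG.ae_snd, hW.ae_snd, h0.ae_dr, h0.ae_dt, aef] with q hq1 hq2 hq3 hq4 hq5 hqQ
    have s0 : 0 < q.1 := hqQ.1.1
    have s1 : q.1 < 1 := hqQ.1.2
    rcases lt_or_gt_of_ne hq5 with hlt | hgt
    · have e : χ q.1 = 0 := by simp only [hχ]; rw [indicator_of_notMem]; simp; linarith
      have hz : ∀ s < 1 - t, ζ s = 0 := fun s hs => by
        simp only [ζ]; apply max_eq_right; apply div_nonpos_of_nonpos_of_nonneg <;> linarith
      have hev : ∀ᶠ r in nhds q, w r.1 r.2 = w0 r.1 r.2 := by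
        have : ∀ᶠ r : ℝ × ℝ in nhds q, r.1 < 1 - t := (continuous_fst.tendsto q).eventually (gt_mem_nhds hlt)
        filter_upwards [this] with r hr
        simp only [w]; rw [hz _ hr]; ring
      unfold ed
      rw [gradSq_local hev, hev.self_of_nhds, e, zero_mul, add_zero]
    · have e : χ q.1 = 1 := by simp only [hχ]; rw [indicator_of_mem]; exact hgt
      have hζd : HasDerivAt ζ (1 / t) q.1 := by
        have : ζ =ᶠ[nhds q.1] fun s => (s - (1 - t)) / t := by
          filter_upwards [lt_mem_nhds hgt] with s hs
          simp only [ζ]; apply max_eq_left; apply div_nonneg <;> linarith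
        exact (((hasDerivAt_id q.1).sub_const (1 - t)).div_const t).congr_of_eventuallyEq this
      have d1 : dr w q = dr w0 q + 1 / t * (G q.2 - w0 1 q.2) := by
        unfold dr
        exact (hq3.hasDerivAt.add (hζd.mul_const (G q.2 - w0 1 q.2))).deriv
      have d2 : dt w q = dt w0 q + ζ q.1 * (deriv G q.2 - deriv (w0 1) q.2) := by
        unfold dt
        exact (hq4.hasDerivAt.add ((hq1.hasDerivAt.sub hq2.hasDerivAt).const_mul (ζ q.1))).deriv
      have n1 : |dr w0 q| ≤ K := abs_deriv_le hK (k1 q.2) q.1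
      have n2 : |dt w0 q| ≤ K * q.1 := by
        apply abs_deriv_le (by positivity)
        intro x y; have := k2 q.1 x y; rwa [abs_of_pos s0] at this
      have n3 : |deriv (w0 1) q.2| ≤ K := abs_deriv_le hK hwl q.2
      have n4 := hd q.2
      have n5 := hζs q.1 ⟨s0.le, s1.le⟩
      have m1 : dr w q ^ 2 ≤ 2 * K ^ 2 + 2 * (ε ^ 2 / t ^ 2) := by
        rw [d1]
        have a1 : dr w0 q ^ 2 ≤ K ^ 2 := sq_le_sq' (by linarith [(abs_le.1 n1).1]) (abs_le.1 n1).2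
        have a2 : (1 / t * (G q.2 - w0 1 q.2)) ^ 2 ≤ ε ^ 2 / t ^ 2 := by
          have : (G q.2 - w0 1 q.2) ^ 2 ≤ ε ^ 2 := sq_le_sq' (by linarith [(abs_le.1 n4).1]) (abs_le.1 n4).2
          rw [show (1 / t * (G q.2 - w0 1 q.2)) ^ 2 = (G q.2 - w0 1 q.2) ^ 2 / t ^ 2 by ring]
          gcongr
        refine add_sq_le.trans ?_; linarith
      have m2 : tn w q ^ 2 ≤ 18 * K ^ 2 + 16 * deriv G q.2 ^ 2 := by
        have e1 : tn w q = dt w0 q / q.1 + (ζ q.1 / q.1) * (deriv G q.2 - deriv (w0 1) q.2) := by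
          unfold tn; rw [d2]; ring
        have a1 : |dt w0 q / q.1| ≤ K := by
          rw [abs_div, abs_of_pos s0, div_le_iff₀ s0]; exact n2
        have a1' : (dt w0 q / q.1) ^ 2 ≤ K ^ 2 := sq_le_sq' (by linarith [(abs_le.1 a1).1]) (abs_le.1 a1).2
        have z0 : 0 ≤ ζ q.1 / q.1 := div_nonneg (hζ0 _) s0.le
        have z1 : ζ q.1 / q.1 ≤ 1 := by rw [div_le_one s0]; exact n5
        have a3 : deriv (w0 1) q.2 ^ 2 ≤ K ^ 2 := sq_le_sq' (by linarith [(abs_le.1 n3).1]) (abs_le.1 n3).2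
        have a4 : (deriv G q.2 - deriv (w0 1) q.2) ^ 2 ≤ 2 * deriv G q.2 ^ 2 + 2 * K ^ 2 := by
          have := add_sq_le (a := deriv G q.2) (b := -deriv (w0 1) q.2)
          rw [← sub_eq_add_neg, neg_sq] at this
          linarith
        have a5 : ((ζ q.1 / q.1) * (deriv G q.2 - deriv (w0 1) q.2)) ^ 2 ≤ 1 * (deriv G q.2 - deriv (w0 1) q.2) ^ 2 := by
          rw [mul_pow]; exact mul_le_mul_of_nonneg_right (pow_le_one₀ z0 z1) (sq_nonneg _)
        rw [e1]
        have a6 := sq_nonneg (deriv G q.2)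
        have a7 := sq_nonneg K
        refine add_sq_le.trans ?_; linarith
      have m3 := ar_le hp hm (w q.1 q.2)
      have m4 : 0 ≤ ed lp lm w0 q * q.1 := mul_nonneg (add_nonneg (gradSq_nonneg _ _) (ar_nonneg hp hm _)) s0.le
      have m5 : ed lp lm w q ≤ B + 16 * deriv G q.2 ^ 2 := by
        unfold ed; rw [gradSq_eq]; linarith
      have m6 : 0 ≤ B + 16 * deriv G q.2 ^ 2 := by positivity
      rw [e, one_mul]
      have : ed lp lm w q * q.1 ≤ (B + 16 * deriv G q.2 ^ 2) * 1 := mul_le_mul m5 s1.le s0.le m6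
      linarith)
  rw [I2_add b1 b2 le_rfl, I2_prod hl.le χ (fun θ => B + 16 * deriv G θ ^ 2) zero_le_one, int_chi ht0 ht1, ← En_I2,
    intervalIntegral.integral_add (by simp) ((hG.int_d2 0 l).const_mul 16), intervalIntegral.integral_const_mul] at h2
  simp only [intervalIntegral.integral_const, smul_eq_mul, sub_zero] at h2
  refine h1.trans (h2.trans ?_)
  have f1 : t * (l * B + 16 * ∫ x in (0:ℝ)..l, deriv G x ^ 2) ≤ t * (l * B + 16 * M) := by gcongr
  have f2 : t * (l * B + 16 * M) = ((20 * K ^ 2 + max lp lm) * l + 16 * M) * t + 2 * l * (ε ^ 2 / t) := by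
    rw [hB]; field_simp; ring
  have f3 : 0 ≤ 2 * l * t := by positivity
  have f4 : 0 ≤ ((20 * K ^ 2 + max lp lm) * l + 16 * M) * (ε ^ 2 / t) := by positivity
  linarith

/-! ### Lower semicontinuity of the homogeneous energy -/

theorem Tr.hom_lower {l lp lm : ℝ} (hl : 0 < l) (hlpi : Real.pi ≤ l) (hp : 0 ≤ lp) (hm : 0 ≤ lm) {G : ℝ → ℝ} (hG : Tr l G)
    {p A ε κ : ℝ} (hA : 0 < A) (hε : 0 ≤ ε) (hκ0 : 0 < κ) (hκ1 : κ < Real.pi / 2)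
    (hd : ∀ θ ∈ Icc (p - Real.pi / 2) (p + Real.pi / 2), |G θ - A * Real.cos (θ - p)| ≤ ε) (hκ : ε < A * Real.sin κ) :
    (A ^ 2 * Real.pi + lp * (Real.pi - 2 * κ) - 20 * A * ε) / 2 ≤ hom l lp lm G := by
  have hpi := Real.pi_pos
  set F : ℝ → ℝ := fun θ => G θ ^ 2 + deriv G θ ^ 2 + ar lp lm (G θ) with hF
  have hFi : ∀ a b, IntervalIntegrable F volume a b := fun a b => ((hG.int_sq a b).add (hG.int_d2 a b)).add (hG.int_ar a b)
  have hper : Function.Periodic F l := by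
    intro x; simp only [hF]; rw [hG.dper, hG.per]
  have hF0 : ∀ x, 0 ≤ F x := fun x => by
    have := ar_nonneg hp hm (G x)
    simp only [hF]; positivity
  have hshift : ∫ θ in (0:ℝ)..l, F θ = ∫ θ in (p - l / 2)..(p + l / 2), F θ := by
    have := hper.intervalIntegral_add_eq 0 (p - l / 2)
    rw [zero_add, show p - l / 2 + l = p + l / 2 by ring] at this
    exact this
  have mono : ∀ (f : ℝ → ℝ) (a b c d : ℝ), c ≤ a → a ≤ b → b ≤ d → (∀ x, 0 ≤ f x) → IntervalIntegrable f volume c d →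
      ∫ θ in a..b, f θ ≤ ∫ θ in c..d, f θ := by
    intro f a b c d h1 h2 h3 h4 h5
    exact intervalIntegral.integral_mono_interval h1 h2 h3 (Filter.Eventually.of_forall h4) h5
  have s1 : ∫ θ in (p - Real.pi / 2)..(p + Real.pi / 2), F θ ≤ ∫ θ in (0:ℝ)..l, F θ := by
    rw [hshift]; exact mono F _ _ _ _ (by linarith) (by linarith) (by linarith) hF0 (hFi _ _)
  set a := p - Real.pi / 2 with ha
  set b := p + Real.pi / 2 with hb
  have s2 : ∫ θ in a..b, F θ = (∫ θ in a..b, (G θ ^ 2 + deriv G θ ^ 2)) + ∫ θ in a..b, ar lp lm (G θ) :=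
    intervalIntegral.integral_add ((hG.int_sq a b).add (hG.int_d2 a b)) (hG.int_ar a b)
  have s3 : lp * (Real.pi - 2 * κ) ≤ ∫ θ in a..b, ar lp lm (G θ) := by
    refine le_trans (le_of_eq ?_) (mono _ (a + κ) (b - κ) a b (by linarith) (by linarith) (by linarith) (fun x => ar_nonneg hp hm _) (hG.int_ar _ _))
    have : ∫ θ in (a + κ)..(b - κ), ar lp lm (G θ) = ∫ θ in (a + κ)..(b - κ), lp := by
      apply intervalIntegral.integral_congr
      intro x hx
      rw [uIcc_of_le (by linarith)] at hx
      have h1 := (abs_le.1 (hd x ⟨by linarith [hx.1], by linarith [hx.2]⟩)).1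
      have h2 : Real.sin κ ≤ Real.cos (x - p) := by
        rw [← Real.cos_pi_div_two_sub, ← Real.cos_abs (x - p)]
        apply Real.cos_le_cos_of_nonneg_of_le_pi (abs_nonneg _) (by linarith)
        exact abs_le.2 ⟨by linarith [hx.1], by linarith [hx.2]⟩
      have h3 : A * Real.sin κ ≤ A * Real.cos (x - p) := by gcongr
      exact ar_pos (by linarith)
    rw [this]; simp only [intervalIntegral.integral_const, smul_eq_mul]; rw [ha, hb]; ring
  -- main part
  set c : ℝ → ℝ := fun θ => A * Real.cos (θ - p) with hc
  set c' : ℝ → ℝ := fun θ => -(A * Real.sin (θ - p)) with hc'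
  have dc1 : ∀ x, HasDerivAt c (c' x) x := fun x => by
    refine ((((hasDerivAt_id x).sub_const p).cos).const_mul A).congr_deriv ?_
    simp only [hc', id]; ring
  have dc2 : ∀ x, HasDerivAt c' (-c x) x := fun x => by
    refine ((((hasDerivAt_id x).sub_const p).sin).const_mul A).neg.congr_deriv ?_
    simp only [hc, id]; ring
  have cc : Continuous c := by simp only [hc]; fun_prop
  have cc' : Continuous c' := by simp only [hc']; fun_prop
  have acc : AbsolutelyContinuousOnInterval c a b := ac_C1 (fun x _ => dc1 x) cc'.continuousOn
  have acc' : AbsolutelyContinuousOnInterval c' a b := ac_C1 (fun x _ => dc2 x) cc.neg.continuousOn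
  have ftc := ac_ftc (F := fun θ => (G θ - c θ) * c' θ) (F' := fun θ => (deriv G θ - c' θ) * c' θ + (G θ - c θ) * (-c θ)) (a := a) (b := b)
    (((hG.ac a b).fun_sub acc).fun_mul acc') (by
      filter_upwards [hG.ae_diff] with x hx _
      exact (hx.hasDerivAt.sub (dc1 x)).mul (dc2 x))
  have iF' : IntervalIntegrable (fun θ => (deriv G θ - c' θ) * c' θ + (G θ - c θ) * (-c θ)) volume a b := by
    have := hG.cont
    refine IntervalIntegrable.add ?_ (Continuous.intervalIntegrable (by fun_prop) _ _)
    exact ((hG.int_d a b).sub (cc'.intervalIntegrable a b)).mul_continuousOn cc'.continuousOn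
  have s4 : ∫ θ in a..b, ((A ^ 2 - 4 * (A * ε)) + 2 * ((deriv G θ - c' θ) * c' θ + (G θ - c θ) * (-c θ))) ≤ ∫ θ in a..b, (G θ ^ 2 + deriv G θ ^ 2) := by
    refine intervalIntegral.integral_mono_on (by linarith) ((by simp : IntervalIntegrable (fun _ => A ^ 2 - 4 * (A * ε)) volume a b).add (iF'.const_mul 2)) ((hG.int_sq a b).add (hG.int_d2 a b)) ?_
    intro x hx
    have e0 : c x ^ 2 + c' x ^ 2 = A ^ 2 := by
      simp only [hc, hc']; linear_combination A ^ 2 * Real.sin_sq_add_cos_sq (x - p)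
    have h1 := hd x hx
    have c0 : 0 ≤ c x := mul_nonneg hA.le (Real.cos_nonneg_of_mem_Icc ⟨by linarith [hx.1], by linarith [hx.2]⟩)
    have c1 : c x ≤ A := by
      simp only [hc]; exact mul_le_of_le_one_right hA.le (Real.cos_le_one _)
    have h2 : -(A * ε) ≤ (G x - c x) * c x := by
      have := (abs_le.1 h1).1
      change -ε ≤ G x - c x at this
      nlinarith
    nlinarith [sq_nonneg (G x - c x), sq_nonneg (deriv G x - c' x)]
  rw [intervalIntegral.integral_add (by simp) (iF'.const_mul 2), intervalIntegral.integral_const_mul, ftc] at s4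
  simp only [intervalIntegral.integral_const, smul_eq_mul] at s4
  have ca : c' a = A := by simp only [hc', ha]; rw [show p - Real.pi / 2 - p = -(Real.pi / 2) by ring, Real.sin_neg, Real.sin_pi_div_two]; ring
  have cb : c' b = -A := by simp only [hc', hb]; rw [show p + Real.pi / 2 - p = Real.pi / 2 by ring, Real.sin_pi_div_two]; ring
  rw [ca, cb] at s4
  have da := (abs_le.1 (hd a ⟨le_rfl, by linarith⟩)).2
  have db := (abs_le.1 (hd b ⟨by linarith, le_rfl⟩)).2
  change G a - c a ≤ ε at da
  change G b - c b ≤ ε at db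
  have e1 : (G a - c a) * A ≤ ε * A := by gcongr
  have e2 : (G b - c b) * A ≤ ε * A := by gcongr
  have e3 : b - a = Real.pi := by rw [ha, hb]; ring
  rw [e3] at s4
  have e4 : Real.pi * (A * ε) ≤ 4 * (A * ε) := by have := Real.pi_le_four; gcongr
  unfold hom
  change _ ≤ 1 / 2 * ∫ θ in (0:ℝ)..l, F θ
  linarith

/-! ### Compactness of traces -/

theorem Tr.holder {l M : ℝ} (hl : 0 < l) {g : ℝ → ℝ} (hg : Tr l g) (hM : ∫ θ in (0:ℝ)..l, deriv g θ ^ 2 ≤ M) (x y : ℝ) :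
    (g x - g y) ^ 2 ≤ M * |x - y| := by
  wlog hxy : y ≤ x generalizing x y
  · have := this y x (by linarith)
    rw [abs_sub_comm]; linarith [show (g x - g y) ^ 2 = (g y - g x) ^ 2 by ring]
  have hM0 : 0 ≤ M := (intervalIntegral.integral_nonneg hl.le fun _ _ => sq_nonneg _).trans hM
  rw [abs_of_nonneg (by linarith)]
  rcases le_total (x - y) l with h | h
  · refine (hg.osc hxy).trans ?_
    have h1 : ∫ θ in y..x, deriv g θ ^ 2 ≤ ∫ θ in y..(y + l), deriv g θ ^ 2 :=
      intervalIntegral.integral_mono_interval le_rfl hxy (by linarith) (Filter.Eventually.of_forall fun _ => sq_nonneg _) (hg.int_d2 _ _)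
    have hper : Function.Periodic (fun θ => deriv g θ ^ 2) l := fun θ => by simp only [hg.dper]
    have h2 := hper.intervalIntegral_add_eq y 0
    rw [zero_add] at h2
    rw [mul_comm]
    exact mul_le_mul_of_nonneg_right (by linarith) (by linarith)
  · refine (hg.osc_all hl x y).trans ?_
    rw [mul_comm]
    exact mul_le_mul hM h hl.le hM0

theorem Tr.limit {l M : ℝ} (hl : 0 < l) (hM : 0 ≤ M) {g : ℕ → ℝ → ℝ} (hg : ∀ k, Tr l (g k))
    (hd : ∀ k, ∫ θ in (0:ℝ)..l, deriv (g k) θ ^ 2 ≤ M) (hb : ∀ k θ, |g k θ| ≤ M) :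
    ∃ G : ℝ → ℝ, Continuous G ∧ (∀ θ, G (θ + l) = G θ) ∧
      ∀ ε > 0, ∀ᶠ k in (Filter.hyperfilter ℕ : Filter ℕ), ∀ θ, |g k θ - G θ| ≤ ε := by
  have hlim : ∀ θ, ∃ y, Filter.Tendsto (fun k => g k θ) (Filter.hyperfilter ℕ : Filter ℕ) (nhds y) := by
    intro θ
    have hc : IsCompact (Icc (-M) M) := isCompact_Icc
    obtain ⟨y, _, hy⟩ := hc.ultrafilter_le_nhds ((Filter.hyperfilter ℕ).map fun k => g k θ) (by
      rw [Filter.le_principal_iff]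
      exact Filter.Eventually.of_forall (f := (Filter.hyperfilter ℕ : Filter ℕ)) fun k => abs_le.1 (hb k θ))
    exact ⟨y, hy⟩
  choose G hG using hlim
  have hho : ∀ x y, (G x - G y) ^ 2 ≤ M * |x - y| := fun x y =>
    le_of_tendsto (((hG x).sub (hG y)).pow 2) (Filter.Eventually.of_forall fun k => (hg k).holder hl (hd k) x y)
  have close : ∀ (f : ℝ → ℝ), (∀ x y, (f x - f y) ^ 2 ≤ M * |x - y|) → ∀ ε > 0, ∀ x y, |x - y| < ε ^ 2 / (M + 1) → |f x - f y| ≤ ε := by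
    intro f hf ε hε x y hxy
    rw [lt_div_iff₀ (by linarith)] at hxy
    have := hf x y
    have h2 : M * |x - y| ≤ |x - y| * (M + 1) := by nlinarith [abs_nonneg (x - y)]
    exact abs_le_of_sq_le_sq (by linarith) hε.le
  have hper : ∀ θ, G (θ + l) = G θ := fun θ => by
    refine tendsto_nhds_unique (hG (θ + l)) ?_
    simp only [(hg _).per]; exact hG θ
  refine ⟨G, ?_, hper, ?_⟩
  · rw [Metric.continuous_iff]
    intro b ε hε
    refine ⟨(ε / 2) ^ 2 / (M + 1), by positivity, fun a ha => ?_⟩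
    rw [Real.dist_eq] at ha ⊢
    linarith [close G hho (ε / 2) (by linarith) a b ha]
  · intro ε hε
    have he : 0 < (ε / 3) ^ 2 / (M + 1) := by positivity
    obtain ⟨t, _, ht, hcov⟩ := (isCompact_Icc (a := (0:ℝ)) (b := l)).finite_cover_balls he
    have hev : ∀ᶠ k in (Filter.hyperfilter ℕ : Filter ℕ), ∀ x ∈ t, |g k x - G x| ≤ ε / 3 := by
      rw [Filter.eventually_all_finite ht]
      intro x _
      have := Metric.tendsto_nhds.1 (hG x) (ε / 3) (by linarith)
      filter_upwards [this] with k hk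
      rw [Real.dist_eq] at hk; exact hk.le
    filter_upwards [hev] with k hk θ
    set φ := θ + ((-⌊θ / l⌋ : ℤ) : ℝ) * l with hφ
    have hφm : φ ∈ Icc 0 l := by
      have h1 := Int.floor_le (θ / l)
      have h2 := Int.lt_floor_add_one (θ / l)
      rw [le_div_iff₀ hl] at h1
      rw [div_lt_iff₀ hl] at h2
      rw [hφ]; push_cast
      constructor <;> nlinarith
    obtain ⟨x, hx, hxb⟩ := mem_iUnion₂.1 (hcov hφm)
    rw [Metric.mem_ball, Real.dist_eq] at hxb
    have e1 : g k φ = g k θ := per_int (hg k).per _ _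
    have e2 : G φ = G θ := per_int hper _ _
    rw [← e1, ← e2]
    have a1 := abs_le.1 (close _ (fun x y => (hg k).holder hl (hd k) x y) (ε / 3) (by linarith) φ x hxb)
    have a2 := abs_le.1 (close _ hho (ε / 3) (by linarith) φ x hxb)
    have a3 := abs_le.1 (hk x hx)
    exact abs_le.2 ⟨by linarith [a1.1, a2.2, a3.1], by linarith [a1.2, a2.1, a3.2]⟩

/-- Limits of almost homogeneous minimizers have trigonometric traces. -/
theorem Mn.trig_limit {l lp lm : ℝ} (hl : 0 < l) (hp : 0 ≤ lp) (hm : 0 ≤ lm) {v : ℕ → ℝ → ℝ → ℝ}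
    (hv : ∀ k, Mn l lp lm (v k)) (hδ : ∀ δ > 0, ∀ᶠ k in (Filter.hyperfilter ℕ : Filter ℕ), deff l lp lm (v k) ≤ δ)
    {G : ℝ → ℝ} (hGc : Continuous G)
    (hG : ∀ ε > 0, ∀ᶠ k in (Filter.hyperfilter ℕ : Filter ℕ), ∀ θ, |v k 1 θ - G θ| ≤ ε) : Trig l G := by
  intro p h hh hhl hne
  obtain ⟨x0, hx0, hmin⟩ := (isCompact_Icc (a := p - h) (b := p + h)).exists_isMinOn ⟨p, by constructor <;> linarith⟩ (hGc.abs).continuousOn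
  set m := |G x0| / 3 with hmdef
  have hm0 : 0 < m := by have := abs_pos.2 (hne x0 hx0); positivity
  have hmm : ∀ θ ∈ Icc (p - h) (p + h), 3 * m ≤ |G θ| := fun θ hθ => by
    have := hmin hθ; simp only [mem_setOf_eq] at this; linarith
  set X : ℝ := 2 * Real.cos h * G p - G (p + h) - G (p - h) with hX
  have key : ∀ τ : ℝ, |τ| ≤ m → 0 ≤ τ / 3 * X + τ ^ 2 * l := by
    intro τ hτ
    apply le_of_forall_pos_le_add
    intro e he
    have hε : 0 < min m (e / (2 * (m + 1) * 2)) := lt_min hm0 (by positivity)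
    obtain ⟨k, h1, h2⟩ := ((hG _ hε).and (hδ (e / 2) (by linarith))).exists
    have hvar := (hv k).var hl hp hm hh hhl hm0.le (p := p) (fun θ hθ => by
      have a1 := hmm θ hθ
      have a2 := (h1 θ).trans (min_le_left _ _)
      have a3 := abs_sub_abs_le_abs_sub (G θ) (v k 1 θ)
      rw [abs_sub_comm] at a3
      linarith) hτ
    have b : ∀ θ, |v k 1 θ - G θ| ≤ e / (2 * (m + 1) * 2) := fun θ => (h1 θ).trans (min_le_right _ _)
    set q := e / (2 * (m + 1) * 2) with hq
    have hq0 : 0 ≤ q := by positivity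
    have c1 : |2 * Real.cos h * (v k 1 p - G p)| ≤ 2 * q := by
      rw [abs_mul, abs_mul, abs_two]
      have := Real.abs_cos_le_one h
      have := b p
      nlinarith [abs_nonneg (v k 1 p - G p), abs_nonneg (Real.cos h)]
    have c2 : |(2 * Real.cos h * v k 1 p - v k 1 (p + h) - v k 1 (p - h)) - X| ≤ 4 * q := by
      rw [hX]
      have c3 := abs_le.1 c1
      have c4 := abs_le.1 (b (p + h))
      have c5 := abs_le.1 (b (p - h))
      exact abs_le.2 ⟨by linarith [c3.1, c4.2, c5.2], by linarith [c3.2, c4.1, c5.1]⟩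
    set Y := 2 * Real.cos h * v k 1 p - v k 1 (p + h) - v k 1 (p - h) with hY
    have c6 : |τ / 3 * (Y - X)| ≤ e / 2 := by
      rw [abs_mul, abs_div, abs_of_pos (by norm_num : (0:ℝ) < 3)]
      have : |τ| / 3 * |Y - X| ≤ m / 3 * (4 * q) := by gcongr
      have e3 : (m + 1) * (4 * q) = e := by rw [hq]; field_simp; ring
      nlinarith
    have c7 := (abs_le.1 c6).2
    have c8 : τ / 3 * (Y - X) = τ / 3 * Y - τ / 3 * X := by ring
    linarith
  have hX0 : X = 0 := by
    by_contra hXne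
    have hXp := abs_pos.2 hXne
    set s := min m (|X| / (6 * l)) with hs
    have hs0 : 0 < s := lt_min hm0 (by positivity)
    have hsm : s ≤ m := min_le_left _ _
    have hsx : s * (6 * l) ≤ |X| := (le_div_iff₀ (by positivity)).1 (min_le_right _ _)
    have k1 := key s (by rwa [abs_of_pos hs0])
    have k2 := key (-s) (by rwa [abs_neg, abs_of_pos hs0])
    rcases abs_cases X with ⟨e, _⟩ | ⟨e, _⟩ <;> rw [e] at hsx hXp
    · nlinarith [mul_pos hs0 hXp]
    · nlinarith [mul_pos hs0 hXp]
  linarith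

/-! ### Small defect forces small energy -/

theorem Mn.limsup {l lp lm M : ℝ} (hl : 0 < l) (hp : 0 ≤ lp) (hm : 0 ≤ lm) (hM : 0 ≤ M) {v : ℕ → ℝ → ℝ → ℝ}
    (hv : ∀ k, Mn l lp lm (v k)) (ht : ∀ k, tau l (v k) 1 ≤ M) {w0 : ℝ → ℝ → ℝ} (h0 : GLp l w0)
    (hG : ∀ ε > 0, ∀ᶠ k in (Filter.hyperfilter ℕ : Filter ℕ), ∀ θ, |v k 1 θ - w0 1 θ| ≤ ε) {γ : ℝ} (hγ : 0 < γ) :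
    ∀ᶠ k in (Filter.hyperfilter ℕ : Filter ℕ), En l lp lm (v k) 1 ≤ En l lp lm w0 1 + γ := by
  obtain ⟨C, hC, hitp⟩ := Mn.interp hl hp hm h0 hM
  set t : ℝ := min (1 / 2) (γ / (2 * (C + 1))) with htd
  have t0 : 0 < t := lt_min (by norm_num) (by positivity)
  have t1 : t ≤ 1 / 2 := min_le_left _ _
  have t2 : t * (2 * (C + 1)) ≤ γ := (le_div_iff₀ (by positivity)).1 (min_le_right _ _)
  set ε : ℝ := min 1 (γ * t / (2 * (C + 1))) with hεd
  have e0 : 0 < ε := lt_min one_pos (by positivity)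
  have e1 : ε ≤ 1 := min_le_left _ _
  have e2 : ε * (2 * (C + 1)) ≤ γ * t := (le_div_iff₀ (by positivity)).1 (min_le_right _ _)
  filter_upwards [hG ε e0] with k hk
  have h1 := hitp (v k) (hv k) (ht k) ε e0.le hk t t0 t1
  have h2 : C * t ≤ γ / 2 := by nlinarith
  have h3 : C * (ε ^ 2 / t) ≤ γ / 2 := by
    rw [← mul_div_assoc, div_le_iff₀ t0]
    have : ε ^ 2 ≤ ε := by nlinarith
    have : C * ε ^ 2 ≤ C * ε := by gcongr
    linarith
  linarith

theorem Mn.pos_limit {l lp lm M : ℝ} (hl : 0 < l) (hlpi : Real.pi ≤ l) (hl2 : l < 2 * Real.pi) (hp : 0 ≤ lp) (hm : 0 ≤ lm) (hM : 0 ≤ M)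
    {v : ℕ → ℝ → ℝ → ℝ} (hv : ∀ k, Mn l lp lm (v k)) (ht : ∀ k, tau l (v k) 1 ≤ M)
    (hδ : ∀ δ > 0, ∀ᶠ k in (Filter.hyperfilter ℕ : Filter ℕ), deff l lp lm (v k) ≤ δ) {p A : ℝ} (hA : 0 < A)
    (hG : ∀ ε > 0, ∀ᶠ k in (Filter.hyperfilter ℕ : Filter ℕ), ∀ θ, |v k 1 θ - A * max (cosd l p θ) 0| ≤ ε) : False := by
  obtain ⟨w0, h0, hw, hE⟩ := t10 (lm := lm) hl hlpi hl2 hp hm p hA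
  set γ : ℝ := ((A ^ 2 + lp) * Real.pi / 2 - En l lp lm w0 1) / 6 with hγd
  have hγ : 0 < γ := by linarith
  have hpi := Real.pi_gt_three
  set κ : ℝ := min 1 (γ / (lp + 1)) with hκd
  have κ0 : 0 < κ := lt_min one_pos (by positivity)
  have κ1 : κ ≤ 1 := min_le_left _ _
  have κ2 : κ * (lp + 1) ≤ γ := (le_div_iff₀ (by positivity)).1 (min_le_right _ _)
  have hs : 0 < Real.sin κ := Real.sin_pos_of_pos_of_lt_pi κ0 (by linarith)
  set ε : ℝ := min (A * Real.sin κ / 2) (γ / (10 * A)) with hεd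
  have e0 : 0 < ε := lt_min (by positivity) (by positivity)
  have e1 : ε ≤ A * Real.sin κ / 2 := min_le_left _ _
  have e2 : ε * (10 * A) ≤ γ := (le_div_iff₀ (by positivity)).1 (min_le_right _ _)
  have hlim := Mn.limsup hl hp hm hM hv ht h0 (fun e he => by simpa only [hw] using hG e he) hγ
  obtain ⟨k, ⟨h1, h2⟩, h3⟩ := ((hlim.and (hδ γ hγ)).and (hG ε e0)).exists
  have h4 := ((hv k).gl.tr 1).hom_lower (lp := lp) (lm := lm) hl hlpi hp hm (p := p) hA e0.le κ0 (by linarith) (fun θ hθ => by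
    have h5 := h3 θ
    have h6 : cosd l p θ = Real.cos (θ - p) := by
      have := cosd_eq hl p (x := θ - p) (abs_le.2 ⟨by linarith [hθ.1], by linarith [hθ.2]⟩)
      rwa [show p + (θ - p) = θ by ring] at this
    rw [h6, max_eq_left (Real.cos_nonneg_of_mem_Icc ⟨by linarith [hθ.1], by linarith [hθ.2]⟩)] at h5
    exact h5) (by have : 0 < A * Real.sin κ := by positivity
                  linarith)
  unfold deff at h2
  have h7 : (A ^ 2 * Real.pi + lp * (Real.pi - 2 * κ) - 20 * A * ε) / 2 = (A ^ 2 + lp) * Real.pi / 2 - κ * lp - ε * (10 * A) := by ring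
  rw [h7] at h4
  have h8 : 6 * γ = (A ^ 2 + lp) * Real.pi / 2 - En l lp lm w0 1 := by rw [hγd]; ring
  nlinarith

theorem hom_neg (l lp lm : ℝ) (g : ℝ → ℝ) : hom l lm lp (fun θ => -g θ) = hom l lp lm g := by
  unfold hom
  congr 2
  ext θ
  have : deriv (fun θ => -g θ) θ = -deriv g θ := deriv.fun_neg
  rw [this, ar_symm]; ring

theorem deff_neg (l lp lm : ℝ) (v : ℝ → ℝ → ℝ) : deff l lm lp (fun s θ => -v s θ) = deff l lp lm v := by
  unfold deff
  rw [En_neg]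
  congr 1
  exact hom_neg l lp lm (v 1)

theorem tau_neg (l : ℝ) (v : ℝ → ℝ → ℝ) (s : ℝ) : tau l (fun s θ => -v s θ) s = tau l v s := by
  unfold tau
  congr 1
  ext θ
  have : deriv (fun θ => -v s θ) θ = -deriv (v s) θ := deriv.fun_neg
  rw [show deriv ((fun s θ => -v s θ) s) θ = -deriv (v s) θ from this]; ring

theorem Mn.small {l lp lm : ℝ} (hl : 0 < l) (hl2 : l < 2 * Real.pi) (hp : 0 ≤ lp) (hm : 0 ≤ lm) {η : ℝ} (hη : 0 < η) :
    ∃ δ : ℝ, 0 < δ ∧ ∀ v, Mn l lp lm v → deff l lp lm v ≤ δ → En l lp lm v 1 ≤ η := by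
  by_contra hcon
  push Not at hcon
  obtain ⟨M, hM, hH1⟩ := Mn.H1_bound (lp := lp) (lm := lm) hl hl2 hp hm
  have hk : ∀ k : ℕ, (0:ℝ) < 1 / ((k:ℝ) + 1) := fun k => by positivity
  choose v hv hvd hvE using fun k : ℕ => hcon _ (hk k)
  have hb := fun k => hH1 (v k) (hv k) ((hvd k).trans (by
    rw [div_le_one (by positivity)]; have : (0:ℝ) ≤ k := by positivity
    linarith))
  have ht : ∀ k, tau l (v k) 1 ≤ M := fun k => (hb k).1
  obtain ⟨G, hGc, hGp, hG⟩ := Tr.limit hl hM (g := fun k => v k 1) (fun k => (hv k).gl.tr 1) ht (fun k => (hb k).2)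
  have hδ : ∀ δ > 0, ∀ᶠ k in (Filter.hyperfilter ℕ : Filter ℕ), deff l lp lm (v k) ≤ δ := by
    intro δ hδ
    have h1 : ∀ᶠ k : ℕ in Filter.atTop, 1 / ((k:ℝ) + 1) < δ :=
      (tendsto_one_div_add_atTop_nhds_zero_nat (𝕜 := ℝ)).eventually (gt_mem_nhds hδ)
    have h2 : ∀ᶠ k : ℕ in (Filter.hyperfilter ℕ : Filter ℕ), 1 / ((k:ℝ) + 1) < δ :=
      h1.filter_mono (by rw [← Nat.cofinite_eq_atTop]; exact Filter.hyperfilter_le_cofinite)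
    filter_upwards [h2] with k hk
    exact (hvd k).trans hk.le
  have hT := Mn.trig_limit hl hp hm hv hδ hGc hG
  rcases hT.classify hl hl2 hGc hGp with h | ⟨p, A, hA, hlpi, h⟩
  · have hz : GLp l (fun _ _ => (0:ℝ)) := GLp.const 0
    have hlim := Mn.limsup hl hp hm hM hv ht hz (fun e he => by simpa only [h] using hG e he) hη
    obtain ⟨k, hk⟩ := hlim.exists
    have hE : En l lp lm (fun _ _ => (0:ℝ)) 1 = 0 := by
      simp [En, gradSq, ar]
    linarith [hvE k]
  · rcases lt_or_gt_of_ne hA with hA | hA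
    · refine Mn.pos_limit hl hlpi hl2 hm hp hM (v := fun k s θ => -v k s θ) (fun k => (hv k).neg) (fun k => ?_) (fun δ hd => ?_)
        (p := p) (A := -A) (by linarith) (fun e he => ?_)
      · rw [tau_neg]; exact ht k
      · simpa only [deff_neg] using hδ δ hd
      · filter_upwards [hG e he] with k hk θ
        have := hk θ
        rw [h θ] at this
        rw [← abs_neg]
        convert this using 2
        ring
    · exact Mn.pos_limit hl hlpi hl2 hp hm hM hv ht hδ hA (fun e he => by simpa only [h] using hG e he)

/-! ### Conclusion -/

theorem Mn.small_sign {l lp lm : ℝ} (hl : 0 < l) (hp : 0 < lp) (hm : 0 ≤ lm) :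
    ∃ η : ℝ, 0 < η ∧ ∀ v, Mn l lp lm v → En l lp lm v 1 ≤ η →
      (∀ s ∈ Icc (0:ℝ) (1 / 8), ∀ θ, v s θ < 0) ∨ (∀ s ∈ Icc (0:ℝ) (1 / 8), ∀ θ, v s θ = 0) := by
  obtain ⟨η, hη, h1⟩ := Mn.nondeg (lm := lm) hl hp hm
  rcases hm.eq_or_lt with h0 | h0
  · subst h0
    refine ⟨η, hη, fun v hv hE => ?_⟩
    have hneg := h1 v hv hE
    have hsc := hv.sc hl.le (r := 1 / 2) (by norm_num) (by norm_num)
    have hval : ∀ s θ, v s θ = _root_.sc (1 / 2) v (2 * s) θ / 2 := fun s θ => by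
      unfold _root_.sc
      rw [show 1 / 2 * (2 * s) = s by ring]; ring
    rcases hsc.dichotomy hl hp.le (fun s hs θ => by
      unfold _root_.sc
      exact div_nonpos_of_nonpos_of_nonneg (hneg _ ⟨by linarith [hs.1], by linarith [hs.2]⟩ θ) (by norm_num)) with h | h
    · refine Or.inl fun s hs θ => ?_
      have := h (2 * s) ⟨by linarith [hs.1], by linarith [hs.2]⟩ θ
      rw [hval]; linarith
    · refine Or.inr fun s hs θ => ?_
      have := h (2 * s) ⟨by linarith [hs.1], by linarith [hs.2]⟩ θ
      rw [hval]; linarith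
  · obtain ⟨η', hη', h2⟩ := Mn.nondeg (lm := lp) hl h0 hp.le
    refine ⟨min η η', lt_min hη hη', fun v hv hE => Or.inr fun s hs θ => ?_⟩
    have a1 := h1 v hv (hE.trans (min_le_left _ _)) s ⟨hs.1, by linarith [hs.2]⟩ θ
    have a2 := h2 _ hv.neg (by rw [En_neg]; exact hE.trans (min_le_right _ _)) s ⟨hs.1, by linarith [hs.2]⟩ θ
    linarith

theorem Mn.main_pos {l lp lm : ℝ} (hl : 0 < l) (hl2 : l < 2 * Real.pi) (hp : 0 < lp) (hm : 0 ≤ lm) :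
    ∃ ε : ℝ, 0 < ε ∧ ε ≤ 1 ∧ ∀ u, Mn l lp lm u → I2 l (fun p => gradSq u p * p.1) 1 ≤ 1 →
      (∀ r ∈ Icc (0:ℝ) ε, ∀ θ : ℝ, 0 < u r θ) ∨
      (∀ r ∈ Icc (0:ℝ) ε, ∀ θ : ℝ, u r θ < 0) ∨
      (∀ r ∈ Icc (0:ℝ) ε, ∀ θ : ℝ, u r θ = 0) := by
  obtain ⟨η, hη, hsign⟩ := Mn.small_sign (lm := lm) hl hp hm
  obtain ⟨δ, hδ, hsm⟩ := Mn.small hl hl2 hp.le hm hη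
  obtain ⟨K, hK, hgood⟩ := Mn.good_scale (lp := lp) (lm := lm) hl hl2 hp.le hm
  set B : ℝ := 1 + max lp lm * l * 1 ^ 2 / 2 + l * K ^ 2 with hB
  have hB0 : 0 ≤ B := by
    have : 0 ≤ max lp lm := hm.trans (le_max_right _ _)
    positivity
  set r : ℝ := Real.exp (-((B + 1) / (2 * δ))) with hr
  have r0 : 0 < r := Real.exp_pos _
  have r1 : r ≤ 1 := by
    rw [hr, Real.exp_le_one_iff]
    have : 0 ≤ (B + 1) / (2 * δ) := by positivity
    linarith
  refine ⟨r / 16, by linarith, by linarith, fun u hu hD => ?_⟩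
  have hTan : Tan l u 1 ≤ 1 := by
    have h1 := Rad_add_Tan hu.gl (le_refl (1:ℝ))
    have h2 : 0 ≤ Rad l u 1 := setIntegral_nonneg (Q_meas l 1) fun p hp => mul_nonneg (sq_nonneg _) hp.1.1.le
    linarith
  have hEn := En_le_Dir (lp := lp) (lm := lm) hl.le hp.le hm hu.gl zero_le_one le_rfl
  obtain ⟨s, hs, hcase⟩ := hgood u hu hTan r r0 r1
  have s0 : 0 < s := by linarith [hs.1]
  rcases hcase with hb | hpos | hneg
  · by_contra hno
    have hall : ∀ σ ∈ Icc s 1, δ ≤ deff l lp lm (_root_.sc σ u) := by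
      intro σ hσ
      by_contra hlt
      push Not at hlt
      have σ0 : 0 < σ := s0.trans_le hσ.1
      have hMn := hu.sc hl.le σ0 hσ.2
      have hval : ∀ x θ, u x θ = σ * _root_.sc σ u (x / σ) θ := fun x θ => by
        unfold _root_.sc
        rw [mul_div_cancel₀ _ σ0.ne']; field_simp
      have hmem : ∀ x ∈ Icc (0:ℝ) (r / 16), x / σ ∈ Icc (0:ℝ) (1 / 8) := fun x hx =>
        ⟨div_nonneg hx.1 σ0.le, by rw [div_le_iff₀ σ0]; linarith [hx.2, hs.1, hσ.1]⟩
      rcases hsign _ hMn (hsm _ hMn hlt.le) with h | h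
      · exact hno (Or.inr (Or.inl fun x hx θ => by
          rw [hval]; exact mul_neg_of_pos_of_neg σ0 (h _ (hmem x hx) θ)))
      · exact hno (Or.inr (Or.inr fun x hx θ => by
          rw [hval, h _ (hmem x hx) θ, mul_zero]))
    have hw := hu.gl.weiss hl s0 (by linarith [hs.2]) hp.le hm hall
    have hH : Hc l u s / s ^ 2 ≤ l * K ^ 2 := by
      rw [div_le_iff₀ (by positivity)]
      have : Hc l u s ≤ ∫ θ in (0:ℝ)..l, (K * s) ^ 2 := by
        refine intervalIntegral.integral_mono_on hl.le ((hu.gl.tr s).int_sq 0 l) (by simp) fun θ _ => ?_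
        have := abs_le.1 (hb θ)
        exact sq_le_sq' this.1 this.2
      rw [intervalIntegral.integral_const, smul_eq_mul] at this
      linarith [show (l - 0) * (K * s) ^ 2 = l * K ^ 2 * s ^ 2 by ring]
    have hlog : (B + 1) / (2 * δ) ≤ Real.log (1 / s) := by
      rw [one_div, Real.log_inv]
      have := Real.log_le_log s0 hs.2.le
      rw [hr, Real.log_exp] at this
      linarith
    rw [div_le_iff₀ (by positivity)] at hlog
    linarith
  · exact Or.inl fun x hx θ => hpos x ⟨hx.1, by linarith [hx.2, hs.1]⟩ θ
  · exact Or.inr (Or.inl fun x hx θ => hneg x ⟨hx.1, by linarith [hx.2, hs.1]⟩ θ)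

theorem vertex_aux (l lp lm : ℝ) (hl0 : 0 < l)
    (hl : l < 2 * Real.pi) (hlp : 0 ≤ lp) (hlm : 0 ≤ lm) (hne : lp ≠ lm) :
    ∃ ε > (0:ℝ), ∀ u : ℝ → ℝ → ℝ, IsMinimizerJ l lp lm 1 u → Dir l u 1 ≤ 1 →
      (∀ r ∈ Set.Icc (0:ℝ) ε, ∀ θ : ℝ, 0 < u r θ) ∨
      (∀ r ∈ Set.Icc (0:ℝ) ε, ∀ θ : ℝ, u r θ < 0) ∨
      (∀ r ∈ Set.Icc (0:ℝ) ε, ∀ θ : ℝ, u r θ = 0) := by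
  have key : ∃ ε : ℝ, 0 < ε ∧ ε ≤ 1 ∧ ∀ u, Mn l lp lm u → I2 l (fun p => gradSq u p * p.1) 1 ≤ 1 →
      (∀ r ∈ Icc (0:ℝ) ε, ∀ θ : ℝ, 0 < u r θ) ∨
      (∀ r ∈ Icc (0:ℝ) ε, ∀ θ : ℝ, u r θ < 0) ∨
      (∀ r ∈ Icc (0:ℝ) ε, ∀ θ : ℝ, u r θ = 0) := by
    rcases hlp.eq_or_lt with h0 | h0
    · have hm0 : 0 < lm := lt_of_le_of_ne hlm (by rw [h0]; exact hne)
      obtain ⟨ε, h1, h2, h3⟩ := Mn.main_pos (lm := lp) hl0 hl hm0 hlp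
      refine ⟨ε, h1, h2, fun u hu hD => ?_⟩
      rcases h3 _ hu.neg (by simpa only [gradSq_neg] using hD) with h | h | h
      · exact Or.inr (Or.inl fun x hx θ => by linarith [h x hx θ])
      · exact Or.inl fun x hx θ => by linarith [h x hx θ]
      · exact Or.inr (Or.inr fun x hx θ => by linarith [h x hx θ])
    · exact Mn.main_pos hl0 hl h0 hlm
  obtain ⟨ε, h1, h2, h3⟩ := key
  refine ⟨ε, h1, fun u hu hD => ?_⟩
  have hcl : ∀ x ∈ Icc (0:ℝ) 1, ∀ θ, u x θ = u (cl x) θ := fun x hx θ => by rw [cl_of_mem hx]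
  have hD' : I2 l (fun p => gradSq (fun s θ => u (cl s) θ) p * p.1) 1 ≤ 1 := by
    refine le_trans (le_of_eq ?_) hD
    unfold I2 Dir
    refine setIntegral_congr_fun (Q_meas l 1) fun p hp => ?_
    rw [gradSq_congr isOpen_Ioo (fun s hs θ => (hcl s ⟨hs.1.le, hs.2.le⟩ θ).symm) p hp.1]
  rcases h3 _ (hu.toMn hl0 hl) hD' with h | h | h
  · exact Or.inl fun x hx θ => by rw [hcl x ⟨hx.1, hx.2.trans h2⟩]; exact h x hx θ
  · exact Or.inr (Or.inl fun x hx θ => by rw [hcl x ⟨hx.1, hx.2.trans h2⟩]; exact h x hx θ)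
  · exact Or.inr (Or.inr fun x hx θ => by rw [hcl x ⟨hx.1, hx.2.trans h2⟩]; exact h x hx θ)

/-- Uniform version: on a cone of length `l < 2π` there is `ε = ε(l, λ₊, λ₋) > 0` such
that every minimizer of `J(C_1, λ₊, λ₋)` with Dirichlet energy at most `1` is everywhere
positive, everywhere negative, or identically zero on `C_ε`. -/
theorem vertex_avoids_free_boundary_uniform (l lp lm : ℝ) (hl0 : 0 < l)
    (hl : l < 2 * Real.pi) (hlp : 0 ≤ lp) (hlm : 0 ≤ lm) (hne : lp ≠ lm) :
    ∃ ε > (0:ℝ), ∀ u : ℝ → ℝ → ℝ, IsMinimizerJ l lp lm 1 u → Dir l u 1 ≤ 1 →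
      (∀ r ∈ Set.Icc (0:ℝ) ε, ∀ θ : ℝ, 0 < u r θ) ∨
      (∀ r ∈ Set.Icc (0:ℝ) ε, ∀ θ : ℝ, u r θ < 0) ∨
      (∀ r ∈ Set.Icc (0:ℝ) ε, ∀ θ : ℝ, u r θ = 0) := by
  exact vertex_aux l lp lm hl0 hl hlp hlm hne
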